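/- arXiv:2401.04674 — 5 statements merged into one kernel-verified Lean document; each statement's English description precedes it below -/
import Mathlib

section
/- Let d ≥ 2 and write points of ℝ^d as x = (x₁, x′) ∈ ℝ × ℝ^{d−1}. Let q₁ : ℝ^{d−1} → ℝ be smooth with compact support, let E, k ∈ ℝ with E² + k² > 0, set λ = √(E² + k²), and let u ∈ 𝒮(ℝ^{d−1}) satisfy Δ′u + q₁ u = E² u on ℝ^{d−1}, where Δ′ is the Laplacian in the x′ variables. Let R > 0 and δ > 0, and let χ : ℝ^d → ℝ be smooth with all partial derivatives bounded, such that χ(x) = 1 whenever x₁ ≥ 2R and |x′| ≤ δ x₁, and χ(x) = 0 unless x₁ ≥ R and |x′| ≤ 2δ x₁. Let q : ℝ^d → ℝ be smooth with q(x) = q₁(x′) for every x in the support of χ. Then the function f(x) := Δ( χ(x) e^{iλx₁} u(x′) ) + (q(x) + k²) χ(x) e^{iλx₁} u(x′) belongs to the Schwartz space 𝒮(ℝ^d). -/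
open MeasureTheory

noncomputable section

/-- The Euclidean Laplacian `Δ′u(y) = ∑_{j=1}^n ∂²u/∂y_j²(y)` of a function on `ℝ^n`. -/
def transverseLaplacian {n : ℕ} (u : EuclideanSpace ℝ (Fin n) → ℂ)
    (y : EuclideanSpace ℝ (Fin n)) : ℂ :=
  ∑ j : Fin n,
    iteratedFDeriv ℝ 2 u y ![EuclideanSpace.single j 1, EuclideanSpace.single j 1]

/-- The Euclidean Laplacian `Δf(x) = ∂²f/∂x₁² + ∑_{j=1}^n ∂²f/∂(x′_j)²` of a function on
`ℝ^d = ℝ × ℝ^n` (`n = d − 1`). -/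
def fullLaplacian {n : ℕ} (f : ℝ × EuclideanSpace ℝ (Fin n) → ℂ)
    (x : ℝ × EuclideanSpace ℝ (Fin n)) : ℂ :=
  iteratedFDeriv ℝ 2 f x ![((1 : ℝ), 0), ((1 : ℝ), 0)] +
    ∑ j : Fin n,
      iteratedFDeriv ℝ 2 f x ![((0 : ℝ), EuclideanSpace.single j 1),
        ((0 : ℝ), EuclideanSpace.single j 1)]

/-- The conically localized wave-guide mode `χ(x) e^{iλx₁} u(x′)`. -/
def cutoffMode {n : ℕ} (χ : ℝ × EuclideanSpace ℝ (Fin n) → ℝ) (lam : ℝ)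
    (u : EuclideanSpace ℝ (Fin n) → ℂ) : ℝ × EuclideanSpace ℝ (Fin n) → ℂ :=
  fun x => (χ x : ℂ) * Complex.exp (Complex.I * lam * x.1) * u x.2

/-- `f` is smooth, and each of its derivatives is `O((1 + ‖x′‖)^{-j})`, uniformly in `x₁`. -/
structure HasTransverseDecay {n : ℕ} {F : Type*} [NormedAddCommGroup F] [NormedSpace ℝ F] (j : ℕ)
    (f : ℝ × EuclideanSpace ℝ (Fin n) → F) : Prop where
  contDiff : ContDiff ℝ (⊤ : ℕ∞) f
  bound : ∀ i : ℕ, ∃ C : ℝ, ∀ x, (1 + ‖x.2‖) ^ j * ‖iteratedFDeriv ℝ i f x‖ ≤ C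

namespace HasTransverseDecay

variable {n : ℕ} {F : Type*} [NormedAddCommGroup F] [NormedSpace ℝ F] {j : ℕ}

theorem add {f g : ℝ × EuclideanSpace ℝ (Fin n) → F} (hf : HasTransverseDecay j f)
    (hg : HasTransverseDecay j g) : HasTransverseDecay j (fun x => f x + g x) where
  contDiff := hf.contDiff.add hg.contDiff
  bound i := by
    obtain ⟨A, hA⟩ := hf.bound i
    obtain ⟨B, hB⟩ := hg.bound i
    refine ⟨A + B, fun x => ?_⟩
    have hi : ((i : ℕ∞) : WithTop ℕ∞) ≤ ((⊤ : ℕ∞) : WithTop ℕ∞) := by exact_mod_cast le_top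
    have h : iteratedFDeriv ℝ i (fun x => f x + g x) x
        = iteratedFDeriv ℝ i f x + iteratedFDeriv ℝ i g x :=
      iteratedFDeriv_add_apply (hf.contDiff.of_le hi).contDiffAt (hg.contDiff.of_le hi).contDiffAt
    rw [h]
    calc _ ≤ (1 + ‖x.2‖) ^ j * (‖iteratedFDeriv ℝ i f x‖ + ‖iteratedFDeriv ℝ i g x‖) := by
          gcongr
          exact norm_add_le _ _
      _ ≤ A + B := by
          rw [mul_add]
          exact add_le_add (hA x) (hB x)

theorem zero : HasTransverseDecay j (fun _ : ℝ × EuclideanSpace ℝ (Fin n) => (0 : F)) where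
  contDiff := contDiff_const
  bound i := ⟨0, fun x => by simp [iteratedFDeriv_fun_zero]⟩

theorem sum {ι : Type*} (s : Finset ι) {f : ι → ℝ × EuclideanSpace ℝ (Fin n) → F}
    (hf : ∀ a, HasTransverseDecay j (f a)) :
    HasTransverseDecay j (fun x => ∑ a ∈ s, f a x) := by
  classical
  induction s using Finset.induction_on with
  | empty => simpa using zero
  | insert a s ha ih => simpa [Finset.sum_insert ha] using (hf a).add ih

/-- Multiplication by a function with bounded derivatives preserves transverse decay. -/
theorem mul {f g : ℝ × EuclideanSpace ℝ (Fin n) → ℂ} (hf : HasTransverseDecay 0 f)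
    (hg : HasTransverseDecay j g) : HasTransverseDecay j (fun x => f x * g x) where
  contDiff := hf.contDiff.mul hg.contDiff
  bound i := by
    choose A hA using hf.bound
    choose B hB using hg.bound
    refine ⟨∑ p ∈ Finset.range (i + 1), (i.choose p : ℝ) * A p * B (i - p), fun x => ?_⟩
    have hi : ((i : ℕ∞) : WithTop ℕ∞) ≤ ((⊤ : ℕ∞) : WithTop ℕ∞) := by exact_mod_cast le_top
    refine (mul_le_mul_of_nonneg_left
      (norm_iteratedFDeriv_mul_le hf.contDiff hg.contDiff x hi) (by positivity)).trans ?_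
    rw [Finset.mul_sum]
    refine Finset.sum_le_sum fun p _ => ?_
    have h1 : ‖iteratedFDeriv ℝ p f x‖ ≤ A p := by simpa using hA p x
    calc _ = (i.choose p : ℝ) * ‖iteratedFDeriv ℝ p f x‖ *
          ((1 + ‖x.2‖) ^ j * ‖iteratedFDeriv ℝ (i - p) g x‖) := by ring
      _ ≤ _ := by
        have h0 : 0 ≤ A p := (norm_nonneg _).trans h1
        gcongr
        exact hB _ x

theorem fderiv_apply {f : ℝ × EuclideanSpace ℝ (Fin n) → F} (hf : HasTransverseDecay j f)
    (v : ℝ × EuclideanSpace ℝ (Fin n)) : HasTransverseDecay j (fun x => fderiv ℝ f x v) where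
  contDiff := (hf.contDiff.fderiv_right (m := (⊤ : ℕ∞)) (by simp)).clm_apply contDiff_const
  bound i := by
    obtain ⟨A, hA⟩ := hf.bound (i + 1)
    refine ⟨‖v‖ * A, fun x => ?_⟩
    have hi : ((i : ℕ∞) : WithTop ℕ∞) ≤ ((⊤ : ℕ∞) : WithTop ℕ∞) := by exact_mod_cast le_top
    have h := norm_iteratedFDeriv_clm_apply_const (c := v) (x := x)
      (hf.contDiff.fderiv_right (m := (⊤ : ℕ∞)) (by simp)).contDiffAt hi
    rw [norm_iteratedFDeriv_fderiv] at h
    calc _ ≤ (1 + ‖x.2‖) ^ j * (‖v‖ * ‖iteratedFDeriv ℝ (i + 1) f x‖) := by gcongr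
      _ = ‖v‖ * ((1 + ‖x.2‖) ^ j * ‖iteratedFDeriv ℝ (i + 1) f x‖) := by ring
      _ ≤ _ := by
        gcongr
        exact hA x

theorem iteratedFDeriv_two_apply {f : ℝ × EuclideanSpace ℝ (Fin n) → F}
    (hf : HasTransverseDecay j f) (v w : ℝ × EuclideanSpace ℝ (Fin n)) :
    HasTransverseDecay j (fun x => iteratedFDeriv ℝ 2 f x ![v, w]) := by
  convert (hf.fderiv_apply w).fderiv_apply v using 2 with x
  have hd : DifferentiableAt ℝ (fderiv ℝ f) x :=
    (hf.contDiff.fderiv_right (m := (⊤ : ℕ∞)) (by simp)).differentiable (by simp) x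
  rw [_root_.iteratedFDeriv_two_apply, fderiv_clm_apply hd (differentiableAt_const w)]
  simp

theorem fullLaplacian {f : ℝ × EuclideanSpace ℝ (Fin n) → ℂ} (hf : HasTransverseDecay j f) :
    HasTransverseDecay j (fullLaplacian f) :=
  (hf.iteratedFDeriv_two_apply _ _).add (sum _ fun _ => hf.iteratedFDeriv_two_apply _ _)

theorem comp_snd {g : EuclideanSpace ℝ (Fin n) → F} (hg : ContDiff ℝ (⊤ : ℕ∞) g)
    (hb : ∀ i : ℕ, ∃ C : ℝ, ∀ y, (1 + ‖y‖) ^ j * ‖iteratedFDeriv ℝ i g y‖ ≤ C) :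
    HasTransverseDecay j (fun x : ℝ × EuclideanSpace ℝ (Fin n) => g x.2) where
  contDiff := hg.comp contDiff_snd
  bound i := by
    obtain ⟨C, hC⟩ := hb i
    refine ⟨C * ‖ContinuousLinearMap.snd ℝ ℝ (EuclideanSpace ℝ (Fin n))‖ ^ i, fun x => ?_⟩
    have hi : ((i : ℕ∞) : WithTop ℕ∞) ≤ ((⊤ : ℕ∞) : WithTop ℕ∞) := by exact_mod_cast le_top
    have h := (ContinuousLinearMap.snd ℝ ℝ (EuclideanSpace ℝ (Fin n))).iteratedFDeriv_comp_right
      hg x hi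
    have h' := ContinuousMultilinearMap.norm_compContinuousLinearMap_le
      (iteratedFDeriv ℝ i g x.2)
      (fun _ : Fin i => ContinuousLinearMap.snd ℝ ℝ (EuclideanSpace ℝ (Fin n)))
    rw [Finset.prod_const, Finset.card_univ, Fintype.card_fin] at h'
    change (1 + ‖x.2‖) ^ j * ‖iteratedFDeriv ℝ i
      (g ∘ ContinuousLinearMap.snd ℝ ℝ (EuclideanSpace ℝ (Fin n))) x‖ ≤ _
    rw [h]
    calc _ ≤ (1 + ‖x.2‖) ^ j * (‖iteratedFDeriv ℝ i g x.2‖ *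
          ‖ContinuousLinearMap.snd ℝ ℝ (EuclideanSpace ℝ (Fin n))‖ ^ i) := by
          gcongr
          exact h'
      _ = ((1 + ‖x.2‖) ^ j * ‖iteratedFDeriv ℝ i g x.2‖) *
          ‖ContinuousLinearMap.snd ℝ ℝ (EuclideanSpace ℝ (Fin n))‖ ^ i := by ring
      _ ≤ _ := by
        gcongr
        exact hC x.2

theorem comp_fst {g : ℝ → F} (hg : ContDiff ℝ (⊤ : ℕ∞) g)
    (hb : ∀ i : ℕ, ∃ C : ℝ, ∀ t, ‖iteratedDeriv i g t‖ ≤ C) :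
    HasTransverseDecay 0 (fun x : ℝ × EuclideanSpace ℝ (Fin n) => g x.1) where
  contDiff := hg.comp contDiff_fst
  bound i := by
    obtain ⟨C, hC⟩ := hb i
    refine ⟨C * ‖ContinuousLinearMap.fst ℝ ℝ (EuclideanSpace ℝ (Fin n))‖ ^ i, fun x => ?_⟩
    have hi : ((i : ℕ∞) : WithTop ℕ∞) ≤ ((⊤ : ℕ∞) : WithTop ℕ∞) := by exact_mod_cast le_top
    have h := (ContinuousLinearMap.fst ℝ ℝ (EuclideanSpace ℝ (Fin n))).iteratedFDeriv_comp_right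
      hg x hi
    have h' := ContinuousMultilinearMap.norm_compContinuousLinearMap_le
      (iteratedFDeriv ℝ i g x.1)
      (fun _ : Fin i => ContinuousLinearMap.fst ℝ ℝ (EuclideanSpace ℝ (Fin n)))
    rw [Finset.prod_const, Finset.card_univ, Fintype.card_fin,
      norm_iteratedFDeriv_eq_norm_iteratedDeriv] at h'
    change (1 + ‖x.2‖) ^ 0 * ‖iteratedFDeriv ℝ i
      (g ∘ ContinuousLinearMap.fst ℝ ℝ (EuclideanSpace ℝ (Fin n))) x‖ ≤ _
    rw [h, pow_zero, one_mul]
    refine h'.trans ?_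
    gcongr
    exact hC x.1

theorem ofReal {g : ℝ × EuclideanSpace ℝ (Fin n) → ℝ} (hg : HasTransverseDecay j g) :
    HasTransverseDecay j (fun x => (g x : ℂ)) where
  contDiff := Complex.ofRealCLM.contDiff.comp hg.contDiff
  bound i := by
    obtain ⟨C, hC⟩ := hg.bound i
    refine ⟨C, fun x => ?_⟩
    have hi : ((i : ℕ∞) : WithTop ℕ∞) ≤ ((⊤ : ℕ∞) : WithTop ℕ∞) := by exact_mod_cast le_top
    have h := Complex.ofRealLI.norm_iteratedFDeriv_comp_left (x := x) hg.contDiff.contDiffAt hi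
    change (1 + ‖x.2‖) ^ j * ‖iteratedFDeriv ℝ i (Complex.ofRealLI ∘ g) x‖ ≤ C
    rw [h]
    exact hC x

end HasTransverseDecay

theorem hasTransverseDecay_schwartz_comp_snd {n : ℕ} {F : Type*} [NormedAddCommGroup F]
    [NormedSpace ℝ F] (u : SchwartzMap (EuclideanSpace ℝ (Fin n)) F) (j : ℕ) :
    HasTransverseDecay j (fun x : ℝ × EuclideanSpace ℝ (Fin n) => u x.2) :=
  .comp_snd u.smooth' fun i => ⟨_, fun y =>
    u.one_add_le_sup_seminorm_apply (𝕜 := ℝ) (m := (j, i)) le_rfl le_rfl y⟩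

theorem iteratedDeriv_exp_I_mul (lam : ℝ) (i : ℕ) :
    iteratedDeriv i (fun t : ℝ => Complex.exp (Complex.I * lam * t)) =
      fun t : ℝ => (Complex.I * lam) ^ i * Complex.exp (Complex.I * lam * t) := by
  induction i with
  | zero => simp
  | succ i ih =>
    rw [iteratedDeriv_succ, ih]
    ext t
    have h : HasDerivAt (fun t : ℝ => Complex.exp (Complex.I * lam * t))
        (Complex.exp (Complex.I * lam * t) * (Complex.I * lam)) t := by
      simpa using ((Complex.ofRealCLM.hasDerivAt (x := t)).const_mul (Complex.I * lam)).cexp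
    rw [(h.const_mul _).deriv]
    ring

theorem contDiff_exp_I_mul (lam : ℝ) :
    ContDiff ℝ (⊤ : ℕ∞) (fun t : ℝ => Complex.exp (Complex.I * lam * t)) :=
  (contDiff_const.mul Complex.ofRealCLM.contDiff).cexp

theorem hasTransverseDecay_exp {n : ℕ} (lam : ℝ) :
    HasTransverseDecay 0
      (fun x : ℝ × EuclideanSpace ℝ (Fin n) => Complex.exp (Complex.I * lam * x.1)) := by
  refine .comp_fst (g := fun t : ℝ => Complex.exp (Complex.I * lam * t))
    (contDiff_exp_I_mul lam) fun i => ⟨|lam| ^ i, fun t => ?_⟩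
  rw [iteratedDeriv_exp_I_mul, norm_mul, norm_pow, norm_mul, Complex.norm_I, one_mul,
    Complex.norm_real, Real.norm_eq_abs,
    show Complex.I * lam * t = ((lam * t : ℝ) : ℂ) * Complex.I by push_cast; ring,
    Complex.norm_exp_ofReal_mul_I, mul_one]

theorem hasTransverseDecay_cutoffMode {n : ℕ} {χ : ℝ × EuclideanSpace ℝ (Fin n) → ℝ}
    (hχ : ContDiff ℝ (⊤ : ℕ∞) χ) (hχbd : ∀ i : ℕ, ∃ C : ℝ, ∀ x, ‖iteratedFDeriv ℝ i χ x‖ ≤ C)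
    (lam : ℝ) (u : SchwartzMap (EuclideanSpace ℝ (Fin n)) ℂ) (j : ℕ) :
    HasTransverseDecay j (cutoffMode χ lam u) := by
  have h : HasTransverseDecay 0 χ := ⟨hχ, by simpa using hχbd⟩
  exact (h.ofReal.mul (hasTransverseDecay_exp lam)).mul
    (hasTransverseDecay_schwartz_comp_snd u j)

theorem hasTransverseDecay_hasCompactSupport_comp_snd {n : ℕ}
    {g : EuclideanSpace ℝ (Fin n) → ℝ} (hg : ContDiff ℝ (⊤ : ℕ∞) g) (hs : HasCompactSupport g) :
    HasTransverseDecay 0 (fun x : ℝ × EuclideanSpace ℝ (Fin n) => g x.2) := by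
  refine .comp_snd hg fun i => ?_
  obtain ⟨C, hC⟩ := (hs.iteratedFDeriv (𝕜 := ℝ) i).exists_bound_of_continuous
    (hg.continuous_iteratedFDeriv (by exact_mod_cast le_top))
  exact ⟨C, by simpa using hC⟩

/-- A transversally decaying function that vanishes wherever `‖x‖ > C (1 + ‖x′‖)` is Schwartz. -/
theorem HasTransverseDecay.exists_schwartzMap {n : ℕ} {F : Type*} [NormedAddCommGroup F]
    [NormedSpace ℝ F] {f : ℝ × EuclideanSpace ℝ (Fin n) → F}
    (hf : ∀ j, HasTransverseDecay j f) {C : ℝ} (hC : 0 ≤ C)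
    (h0 : ∀ x, C * (1 + ‖x.2‖) < ‖x‖ → f x = 0) :
    ∃ g : SchwartzMap (ℝ × EuclideanSpace ℝ (Fin n)) F, ∀ x, g x = f x := by
  refine ⟨⟨f, (hf 0).contDiff, fun j i => ?_⟩, fun x => rfl⟩
  obtain ⟨A, hA⟩ := (hf j).bound i
  refine ⟨C ^ j * A, fun x => ?_⟩
  have hx0 : 0 ≤ C ^ j * A :=
    mul_nonneg (by positivity) ((by positivity : (0 : ℝ) ≤ _).trans (hA x))
  rcases lt_or_ge (C * (1 + ‖x.2‖)) ‖x‖ with hx | hx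
  · have he : f =ᶠ[nhds x] fun _ => (0 : F) := by
      have hop : IsOpen {y : ℝ × EuclideanSpace ℝ (Fin n) | C * (1 + ‖y.2‖) < ‖y‖} :=
        isOpen_lt (by fun_prop) (by fun_prop)
      filter_upwards [hop.mem_nhds hx] with y hy using h0 y hy
    rw [(he.iteratedFDeriv ℝ i).eq_of_nhds]
    simpa [iteratedFDeriv_fun_zero] using hx0
  · calc ‖x‖ ^ j * ‖iteratedFDeriv ℝ i f x‖
        ≤ (C * (1 + ‖x.2‖)) ^ j * ‖iteratedFDeriv ℝ i f x‖ := by gcongr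
      _ = C ^ j * ((1 + ‖x.2‖) ^ j * ‖iteratedFDeriv ℝ i f x‖) := by rw [mul_pow, mul_assoc]
      _ ≤ _ := by
        gcongr
        exact hA x

theorem fullLaplacian_congr {n : ℕ} {f g : ℝ × EuclideanSpace ℝ (Fin n) → ℂ}
    {x : ℝ × EuclideanSpace ℝ (Fin n)} (h : f =ᶠ[nhds x] g) :
    fullLaplacian f x = fullLaplacian g x := by
  simp only [fullLaplacian, (h.iteratedFDeriv ℝ 2).eq_of_nhds]

theorem fullLaplacian_exp_mul {n : ℕ} (lam : ℝ) {u : EuclideanSpace ℝ (Fin n) → ℂ}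
    (hu : ContDiff ℝ (⊤ : ℕ∞) u) (x : ℝ × EuclideanSpace ℝ (Fin n)) :
    fullLaplacian (fun x => Complex.exp (Complex.I * lam * x.1) * u x.2) x =
      Complex.exp (Complex.I * lam * x.1) * (transverseLaplacian u x.2 - lam ^ 2 * u x.2) := by
  set v : ℝ × EuclideanSpace ℝ (Fin n) → ℂ :=
    fun x => Complex.exp (Complex.I * lam * x.1) * u x.2 with hv
  have hexp (y : ℝ × EuclideanSpace ℝ (Fin n)) :
      HasFDerivAt (fun y : ℝ × EuclideanSpace ℝ (Fin n) => Complex.exp (Complex.I * lam * y.1))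
        (Complex.exp (Complex.I * lam * y.1) • (Complex.I * lam) •
          (Complex.ofRealCLM.comp (ContinuousLinearMap.fst ℝ ℝ (EuclideanSpace ℝ (Fin n))))) y :=
    (((Complex.ofRealCLM.comp (ContinuousLinearMap.fst ℝ ℝ
      (EuclideanSpace ℝ (Fin n)))).hasFDerivAt (x := y)).const_mul (Complex.I * lam)).cexp
  have hmul {w : EuclideanSpace ℝ (Fin n) → ℂ} (hw : Differentiable ℝ w)
      (y a : ℝ × EuclideanSpace ℝ (Fin n)) :
      fderiv ℝ (fun y : ℝ × EuclideanSpace ℝ (Fin n) =>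
        Complex.exp (Complex.I * lam * y.1) * w y.2) y a =
      Complex.exp (Complex.I * lam * y.1) *
        (fderiv ℝ w y.2 a.2 + Complex.I * lam * a.1 * w y.2) := by
    have h2 : HasFDerivAt (fun y : ℝ × EuclideanSpace ℝ (Fin n) => w y.2)
        ((fderiv ℝ w y.2).comp (ContinuousLinearMap.snd ℝ ℝ _)) y :=
      (hw y.2).hasFDerivAt.comp y hasFDerivAt_snd
    rw [((hexp y).fun_mul h2).fderiv]
    simp
    ring
  have hvd : ContDiff ℝ (⊤ : ℕ∞) v :=
    ((contDiff_exp_I_mul lam).comp contDiff_fst).mul (hu.comp contDiff_snd)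
  have hdu : ContDiff ℝ (⊤ : ℕ∞) (fderiv ℝ u) := hu.fderiv_right (by simp)
  have htwo (a : ℝ × EuclideanSpace ℝ (Fin n)) : iteratedFDeriv ℝ 2 v x ![a, a] =
      fderiv ℝ (fun y => fderiv ℝ v y a) x a := by
    have hd : DifferentiableAt ℝ (fderiv ℝ v) x :=
      (hvd.fderiv_right (m := (⊤ : ℕ∞)) (by simp)).differentiable (by simp) x
    rw [iteratedFDeriv_two_apply, fderiv_clm_apply hd (differentiableAt_const a)]
    simp
  have hu1 : Differentiable ℝ u := hu.differentiable (by simp)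
  have hfirst : iteratedFDeriv ℝ 2 v x ![((1 : ℝ), 0), ((1 : ℝ), 0)] =
      - (lam : ℂ) ^ 2 * (Complex.exp (Complex.I * lam * x.1) * u x.2) := by
    rw [htwo, show (fun y => fderiv ℝ v y ((1 : ℝ), 0)) = fun y =>
      Complex.exp (Complex.I * lam * y.1) * (Complex.I * lam * u y.2) from
        funext fun y => by rw [hv, hmul hu1]; simp,
      hmul (hu1.const_mul _)]
    simp only [map_zero, Complex.ofReal_one]
    linear_combination (Complex.exp (Complex.I * lam * x.1) * lam ^ 2 * u x.2) * Complex.I_sq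
  have hrest (a : EuclideanSpace ℝ (Fin n)) :
      iteratedFDeriv ℝ 2 v x ![((0 : ℝ), a), ((0 : ℝ), a)] =
      Complex.exp (Complex.I * lam * x.1) * iteratedFDeriv ℝ 2 u x.2 ![a, a] := by
    have hd : Differentiable ℝ (fun y => fderiv ℝ u y a) :=
      (hdu.clm_apply contDiff_const).differentiable (by simp)
    rw [htwo, show (fun y => fderiv ℝ v y ((0 : ℝ), a)) = fun y =>
      Complex.exp (Complex.I * lam * y.1) * fderiv ℝ u y.2 a from
        funext fun y => by rw [hv, hmul hu1]; simp,
      hmul hd, iteratedFDeriv_two_apply,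
      fderiv_clm_apply (hdu.differentiable (by simp) _) (differentiableAt_const a)]
    simp
  simp only [fullLaplacian, transverseLaplacian, hfirst, hrest, ← Finset.mul_sum]
  ring

/-- **Applying the Hamiltonian to a conically cut-off wave-guide mode gives a Schwartz source.**
Write points of `ℝ^d` as `x = (x₁, x′) ∈ ℝ × ℝ^{d−1}` (here `n = d − 1 ≥ 1`).  With `q₁` smooth
and compactly supported, `λ = √(E² + k²) > 0`, `u ∈ 𝒮(ℝ^{d−1})` with `Δ′u + q₁u = E²u`, and `χ`
a smooth bounded conic cutoff which is `1` on `{x₁ ≥ 2R, |x′| ≤ δx₁}` and supported in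
`{x₁ ≥ R, |x′| ≤ 2δx₁}`, and `q` smooth with `q(x) = q₁(x′)` on `supp χ`, the function
`f(x) = Δ(χ e^{iλx₁} u(x′)) + (q + k²) χ e^{iλx₁} u(x′)` is Schwartz on `ℝ^d`. -/
theorem hamiltonian_of_cutoff_mode_is_schwartz
    (n : ℕ) (hn : 1 ≤ n)
    (q₁ : EuclideanSpace ℝ (Fin n) → ℝ) (hq₁ : ContDiff ℝ (⊤ : ℕ∞) q₁)
    (hq₁supp : HasCompactSupport q₁)
    (E k : ℝ) (hEk : 0 < E ^ 2 + k ^ 2)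
    (u : SchwartzMap (EuclideanSpace ℝ (Fin n)) ℂ)
    (hu : ∀ y, transverseLaplacian (⇑u) y + (q₁ y : ℂ) * u y = (E : ℂ) ^ 2 * u y)
    (R δ : ℝ) (hR : 0 < R) (hδ : 0 < δ)
    (χ : ℝ × EuclideanSpace ℝ (Fin n) → ℝ) (hχ : ContDiff ℝ (⊤ : ℕ∞) χ)
    (hχbd : ∀ i : ℕ, ∃ C : ℝ, ∀ x, ‖iteratedFDeriv ℝ i χ x‖ ≤ C)
    (hχ1 : ∀ x : ℝ × EuclideanSpace ℝ (Fin n), 2 * R ≤ x.1 → ‖x.2‖ ≤ δ * x.1 → χ x = 1)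
    (hχ0 : ∀ x : ℝ × EuclideanSpace ℝ (Fin n), ¬(R ≤ x.1 ∧ ‖x.2‖ ≤ 2 * δ * x.1) → χ x = 0)
    (q : ℝ × EuclideanSpace ℝ (Fin n) → ℝ) (hq : ContDiff ℝ (⊤ : ℕ∞) q)
    (hqχ : ∀ x ∈ Function.support χ, q x = q₁ x.2) :
    ∃ f : SchwartzMap (ℝ × EuclideanSpace ℝ (Fin n)) ℂ, ∀ x,
      f x = fullLaplacian (cutoffMode χ (Real.sqrt (E ^ 2 + k ^ 2)) (⇑u)) x +
        ((q x : ℂ) + (k : ℂ) ^ 2) * cutoffMode χ (Real.sqrt (E ^ 2 + k ^ 2)) (⇑u) x := by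
  set lam := Real.sqrt (E ^ 2 + k ^ 2) with hlam
  have hlam2 : (lam : ℂ) ^ 2 = (E : ℂ) ^ 2 + (k : ℂ) ^ 2 := by
    exact_mod_cast Real.sq_sqrt hEk.le
  have hqw (x) : ((q x : ℂ) + (k : ℂ) ^ 2) * cutoffMode χ lam u x =
      (q₁ x.2 : ℂ) * cutoffMode χ lam u x + (k : ℂ) ^ 2 * cutoffMode χ lam u x := by
    by_cases hx : χ x = 0
    · simp [cutoffMode, hx]
    · rw [hqχ x hx]
      ring
  simp only [hqw]
  have hw := hasTransverseDecay_cutoffMode hχ hχbd lam u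
  have hk : HasTransverseDecay 0
      (fun _ : ℝ × EuclideanSpace ℝ (Fin n) => (k : ℂ) ^ 2) := by
    refine .comp_fst (g := fun _ : ℝ => (k : ℂ) ^ 2) contDiff_const
      fun i => ⟨‖(k : ℂ) ^ 2‖, fun t => ?_⟩
    rw [iteratedDeriv_const]
    split_ifs <;> simp [sq_nonneg]
  refine HasTransverseDecay.exists_schwartzMap (C := 2 * R + 1 + 1 / δ)
    (fun j => (hw j).fullLaplacian.add
      (((hasTransverseDecay_hasCompactSupport_comp_snd hq₁ hq₁supp).ofReal.mul (hw j)).add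
        (hk.mul (hw j)))) (by positivity) fun x hx => ?_
  have hy : 0 ≤ ‖x.2‖ := norm_nonneg _
  have hyδ : 0 ≤ 1 / δ * ‖x.2‖ := by positivity
  have hδ' : 0 < 1 / δ := by positivity
  have hx1 : 2 * R + 1 / δ * ‖x.2‖ < |x.1| := by
    have hle : ‖x.2‖ < ‖x‖ := by nlinarith
    have hmax : ‖x‖ = |x.1| := by
      rw [Prod.norm_def] at hle ⊢
      exact max_eq_left ((lt_max_iff.1 hle).resolve_right (lt_irrefl _)).le
    rw [← hmax]
    nlinarith
  rcases lt_or_ge x.1 0 with hneg | hpos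
  · have he : cutoffMode χ lam u =ᶠ[nhds x] fun _ => 0 := by
      filter_upwards [(isOpen_lt continuous_fst continuous_const).mem_nhds hneg] with y hy
      have hy' : y.1 < 0 := hy
      simp [cutoffMode, hχ0 y fun h => absurd h.1 (by linarith)]
    rw [fullLaplacian_congr he, he.eq_of_nhds]
    simp [fullLaplacian, iteratedFDeriv_fun_zero]
  · rw [abs_of_nonneg hpos] at hx1
    have hlt : 2 * R < x.1 := by linarith
    have hlt' : ‖x.2‖ < δ * x.1 := by
      have := mul_lt_mul_of_pos_left (show 1 / δ * ‖x.2‖ < x.1 by linarith) hδ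
      rwa [← mul_assoc, mul_one_div_cancel hδ.ne', one_mul] at this
    have he : cutoffMode χ lam u =ᶠ[nhds x]
        fun y => Complex.exp (Complex.I * lam * y.1) * u y.2 := by
      filter_upwards [(isOpen_lt continuous_const continuous_fst).mem_nhds hlt,
        (isOpen_lt continuous_snd.norm (continuous_const.mul continuous_fst)).mem_nhds hlt']
        with y h1 h2
      simp [cutoffMode, hχ1 y (le_of_lt h1) (le_of_lt h2)]
    rw [fullLaplacian_congr he, fullLaplacian_exp_mul lam (u.smooth _), he.eq_of_nhds]
    linear_combination Complex.exp (Complex.I * lam * x.1) * (hu x.2 - u x.2 * hlam2)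
end
end

section
/- Let v ∈ 𝒮(ℝ; ℂ), ξ° ∈ ℝ, and let ψ₊ : ℝ → ℝ be a smooth function with ψ₊(t) = 0 for t ≤ −1 and ψ₊(t) = 1 for t ≥ 1. Set ψ̂₊′(ζ) = ∫_ℝ ψ₊′(x) e^{−iζx} dx and v̂(ξ₂) = ∫_ℝ v(x₂) e^{−i x₂ ξ₂} dx₂. For σ < 0 and ξ = (ξ₁, ξ₂) ∈ ℝ² let U_σ(ξ) = ∫_{ℝ²} ψ₊(x₁) e^{iξ° x₁ + σ x₁} v(x₂) e^{−i(x₁ξ₁ + x₂ξ₂)} dx₁ dx₂ (an absolutely convergent integral). Then for every Schwartz function g on ℝ²: the limit lim_{σ→0⁻} ∫_{ℝ²} U_σ(ξ) g(ξ) dξ exists, the principal value limit lim_{ε→0⁺} ∬_{|ξ₁ − ξ°| > ε} (ψ̂₊′(ξ₁ − ξ°)/(ξ₁ − ξ°)) v̂(ξ₂) g(ξ₁, ξ₂) dξ₁ dξ₂ exists, and lim_{σ→0⁻} ∫_{ℝ²} U_σ(ξ) g(ξ) dξ = π ∫_ℝ v̂(ξ₂) g(ξ°, ξ₂) dξ₂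 − i · lim_{ε→0⁺} ∬_{|ξ₁ − ξ°| > ε} (ψ̂₊′(ξ₁ − ξ°)/(ξ₁ − ξ°)) v̂(ξ₂) g(ξ₁, ξ₂) dξ₁ dξ₂. -/
open MeasureTheory Filter Topology

noncomputable section

/-- The exponentially regularized Fourier transform
`U_σ(ξ) = ∫_{ℝ²} ψ₊(x₁) e^{iξ°x₁ + σx₁} v(x₂) e^{−i(x₁ξ₁ + x₂ξ₂)} dx₁ dx₂`
of the cut-off wave-guide mode `ψ₊(x₁) e^{iξ°x₁} v(x₂)`. -/
def modeRegFT (ξc : ℝ) (ψ : ℝ → ℝ) (v : ℝ → ℂ) (σ : ℝ) (ξ : ℝ × ℝ) : ℂ :=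
  ∫ x : ℝ × ℝ,
    (ψ x.1 : ℂ) * Complex.exp (Complex.I * ξc * x.1 + σ * x.1) * v x.2 *
      Complex.exp (-Complex.I * (x.1 * ξ.1 + x.2 * ξ.2))

/-- The Fourier transform `v̂(ξ₂) = ∫ v(x₂) e^{−ix₂ξ₂} dx₂`. -/
def oneDimFT (v : ℝ → ℂ) (ξ₂ : ℝ) : ℂ :=
  ∫ x₂ : ℝ, v x₂ * Complex.exp (-Complex.I * x₂ * ξ₂)

theorem integral_odd_kernel_mul {k h : ℝ → ℂ} (hh : Integrable h) (hm : Measurable k)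
    (hodd : ∀ x, k (-x) = -k x) {B : ℝ} (hB : ∀ x, ‖k x‖ ≤ B) :
    ∫ x, k x * h x = 2⁻¹ * ∫ x, k x * (h x - h (-x)) := by
  have h1 : Integrable fun x => k x * h x :=
    hh.bdd_mul hm.aestronglyMeasurable (.of_forall hB)
  have h2 : Integrable fun x => k x * h (-x) :=
    hh.comp_neg.bdd_mul hm.aestronglyMeasurable (.of_forall hB)
  have h3 : ∫ x, k x * h (-x) = -∫ x, k x * h x := by
    rw [← integral_neg_eq_self, ← integral_neg]
    simp [hodd]
  simp_rw [mul_sub]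
  rw [integral_sub h1 h2, h3]
  ring

theorem tendsto_integral_odd_kernel {h : ℝ → ℂ} (hh : Integrable h) {C : ℝ}
    (hC : ∀ x, ‖h x - h (-x)‖ ≤ C * |x|) {l : Filter ℝ} [l.IsCountablyGenerated]
    {k : ℝ → ℝ → ℂ} (hm : ∀ᶠ s in l, Measurable (k s))
    (hodd : ∀ᶠ s in l, ∀ x, k s (-x) = -k s x)
    (hB : ∀ᶠ s in l, ∃ B, ∀ x, ‖k s x‖ ≤ B) (hle : ∀ᶠ s in l, ∀ x, ‖k s x‖ ≤ |x|⁻¹)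
    (hlim : ∀ x ≠ 0, Tendsto (fun s => k s x) l (𝓝 (x : ℂ)⁻¹)) :
    Tendsto (fun s => ∫ x, k s x * h x) l
      (𝓝 (2⁻¹ * ∫ x : ℝ, (x : ℂ)⁻¹ * (h x - h (-x)))) := by
  have key : Tendsto (fun s => ∫ x, k s x * (h x - h (-x))) l
      (𝓝 (∫ x : ℝ, (x : ℂ)⁻¹ * (h x - h (-x)))) := by
    have hC0 : 0 ≤ C := by simpa using (norm_nonneg _).trans (hC 1)
    refine tendsto_integral_filter_of_dominated_convergence
      (fun x => (Set.Icc (-1 : ℝ) 1).indicator (fun _ => C) x + (‖h x‖ + ‖h (-x)‖)) ?_ ?_ ?_ ?_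
    · filter_upwards [hm] with s hs
      exact hs.aestronglyMeasurable.mul
        (hh.aestronglyMeasurable.sub hh.comp_neg.aestronglyMeasurable)
    · filter_upwards [hle] with s hs
      refine .of_forall fun x => ?_
      rw [norm_mul]
      by_cases hx : x ∈ Set.Icc (-1 : ℝ) 1
      · rw [Set.indicator_of_mem hx]
        calc ‖k s x‖ * ‖h x - h (-x)‖ ≤ |x|⁻¹ * (C * |x|) :=
              mul_le_mul (hs x) (hC x) (norm_nonneg _) (by positivity)
          _ ≤ C := by
              rcases eq_or_ne x 0 with rfl | h0
              · simpa using hC0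
              · have := abs_pos.2 h0
                field_simp
                exact le_rfl
          _ ≤ _ := by
              have := norm_nonneg (h x)
              have := norm_nonneg (h (-x))
              linarith
      · rw [Set.indicator_of_notMem hx, zero_add]
        have hx1 : 1 ≤ |x| := by
          by_contra! hlt
          exact hx ⟨(abs_lt.1 hlt).1.le, (abs_lt.1 hlt).2.le⟩
        calc ‖k s x‖ * ‖h x - h (-x)‖ ≤ 1 * (‖h x‖ + ‖h (-x)‖) :=
              mul_le_mul ((hs x).trans (inv_le_one_of_one_le₀ hx1)) (norm_sub_le _ _)
                (norm_nonneg _) zero_le_one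
          _ = _ := one_mul _
    · exact ((integrable_indicator_iff measurableSet_Icc).2 (by simp)).add
        (hh.norm.add hh.comp_neg.norm)
    · have : ∀ᵐ x : ℝ, x ≠ 0 := by simp [ae_iff]
      filter_upwards [this] with x hx
      exact (hlim x hx).mul_const _
  refine (key.const_mul (2⁻¹ : ℂ)).congr' ?_
  filter_upwards [hm, hodd, hB] with s h1 h2 ⟨B, h3⟩
  exact (integral_odd_kernel_mul hh h1 h2 h3).symm

theorem tendsto_integral_truncated_inv {h : ℝ → ℂ} (hh : Integrable h) {C : ℝ}
    (hC : ∀ x, ‖h x - h (-x)‖ ≤ C * |x|) :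
    Tendsto (fun ε : ℝ => ∫ x, {x : ℝ | ε < |x|}.indicator (fun x => (x : ℂ)⁻¹) x * h x) (𝓝[>] 0)
      (𝓝 (2⁻¹ * ∫ x : ℝ, (x : ℂ)⁻¹ * (h x - h (-x)))) := by
  refine tendsto_integral_odd_kernel hh hC ?_ ?_ ?_ ?_ ?_
  · exact .of_forall fun ε => Measurable.indicator (by fun_prop)
      (measurableSet_lt measurable_const (by fun_prop))
  · refine .of_forall fun ε x => ?_
    by_cases hx : ε < |x| <;> simp [Set.indicator, hx]
  · filter_upwards [self_mem_nhdsWithin] with ε (hε : 0 < ε)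
    refine ⟨ε⁻¹, fun x => ?_⟩
    by_cases hx : ε < |x|
    · simp only [Set.indicator, Set.mem_ofPred_eq, hx, if_true, norm_inv, Complex.norm_real,
        Real.norm_eq_abs]
      exact inv_anti₀ hε hx.le
    · simp [Set.indicator, hx, hε.le]
  · refine .of_forall fun ε x => ?_
    by_cases hx : ε < |x| <;> simp [Set.indicator, hx]
  · intro x hx
    refine tendsto_const_nhds.congr' ?_
    filter_upwards [nhdsWithin_le_nhds (Iio_mem_nhds (abs_pos.2 hx))] with ε hε
    exact (Set.indicator_of_mem (s := {x : ℝ | ε < |x|}) hε (fun x : ℝ => (x : ℂ)⁻¹)).symm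

theorem tendsto_integral_conjugate_poisson {h : ℝ → ℂ} (hh : Integrable h) {C : ℝ}
    (hC : ∀ x, ‖h x - h (-x)‖ ≤ C * |x|) :
    Tendsto (fun σ : ℝ => ∫ x, ((x / (x ^ 2 + σ ^ 2) : ℝ) : ℂ) * h x) (𝓝[<] 0)
      (𝓝 (2⁻¹ * ∫ x : ℝ, (x : ℂ)⁻¹ * (h x - h (-x)))) := by
  have hle (σ x : ℝ) : ‖((x / (x ^ 2 + σ ^ 2) : ℝ) : ℂ)‖ ≤ |x|⁻¹ := by
    rw [Complex.norm_real, Real.norm_eq_abs, abs_div, abs_of_nonneg (a := x ^ 2 + σ ^ 2)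
      (by positivity)]
    rcases eq_or_ne x 0 with rfl | h0
    · simp
    · have := abs_pos.2 h0
      rw [div_le_iff₀ (by positivity), ← sq_abs x]
      field_simp
      nlinarith [sq_nonneg σ]
  refine tendsto_integral_odd_kernel hh hC ?_ ?_ ?_ (.of_forall hle) ?_
  · exact .of_forall fun σ => by fun_prop
  · exact .of_forall fun σ x => by push_cast; ring
  · filter_upwards [self_mem_nhdsWithin] with σ (hσ : σ < 0)
    refine ⟨|σ|⁻¹, fun x => ?_⟩
    have := abs_pos.2 hσ.ne
    rw [Complex.norm_real, Real.norm_eq_abs, abs_div, abs_of_nonneg (a := x ^ 2 + σ ^ 2)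
      (by positivity), ← sq_abs x, ← sq_abs σ, div_le_iff₀ (by positivity)]
    field_simp
    nlinarith [sq_nonneg (|x| - |σ|), abs_nonneg x]
  · intro x hx
    have : ContinuousAt (fun σ : ℝ => ((x / (x ^ 2 + σ ^ 2) : ℝ) : ℂ)) 0 := by
      apply Complex.continuous_ofReal.continuousAt.comp
      exact ContinuousAt.div (by fun_prop) (by fun_prop) (by positivity)
    have h2 := this.tendsto.mono_left (nhdsWithin_le_nhds (s := Set.Iio 0))
    convert! h2 using 2
    have : (x : ℂ) ≠ 0 := by exact_mod_cast hx
    push_cast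
    field_simp
    simp

theorem tendsto_integral_poisson {h : ℝ → ℂ} (hc : Continuous h) {M : ℝ} (hM : ∀ x, ‖h x‖ ≤ M) :
    Tendsto (fun σ : ℝ => ∫ x, ((-σ / (x ^ 2 + σ ^ 2) : ℝ) : ℂ) * h x) (𝓝[<] 0)
      (𝓝 (Real.pi * h 0)) := by
  have key : Tendsto (fun σ : ℝ => ∫ t : ℝ, (((1 + t ^ 2)⁻¹ : ℝ) : ℂ) * h (σ * t)) (𝓝[<] 0)
      (𝓝 (∫ t : ℝ, (((1 + t ^ 2)⁻¹ : ℝ) : ℂ) * h 0)) := by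
    refine tendsto_integral_filter_of_dominated_convergence
      (fun t => (1 + t ^ 2)⁻¹ * M) ?_ ?_ (integrable_inv_one_add_sq.mul_const M) ?_
    · refine .of_forall fun σ => ?_
      have : Measurable h := hc.measurable
      exact Measurable.aestronglyMeasurable (by fun_prop)
    · refine .of_forall fun σ => .of_forall fun t => ?_
      rw [norm_mul, Complex.norm_real, Real.norm_of_nonneg (by positivity)]
      exact mul_le_mul_of_nonneg_left (hM _) (by positivity)
    · refine .of_forall fun t => ?_
      have : ContinuousAt (fun σ : ℝ => (((1 + t ^ 2)⁻¹ : ℝ) : ℂ) * h (σ * t)) 0 :=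
        Continuous.continuousAt (by fun_prop)
      simpa using this.tendsto.mono_left (nhdsWithin_le_nhds (s := Set.Iio 0))
  have hpi : ∫ t : ℝ, (((1 + t ^ 2)⁻¹ : ℝ) : ℂ) = Real.pi := by
    rw [← integral_univ_inv_one_add_sq]
    exact integral_ofReal
  rw [integral_mul_const, hpi] at key
  refine key.congr' ?_
  filter_upwards [self_mem_nhdsWithin] with σ (hσ : σ < 0)
  have := Measure.integral_comp_mul_left
    (fun x => ((-σ / (x ^ 2 + σ ^ 2) : ℝ) : ℂ) * h x) σ
  have h2 : ∫ x, ((-σ / (x ^ 2 + σ ^ 2) : ℝ) : ℂ) * h x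
      = ((-σ : ℝ) : ℂ) * ∫ x, ((-σ / ((σ * x) ^ 2 + σ ^ 2) : ℝ) : ℂ) * h (σ * x) := by
    rw [this, abs_of_neg (inv_neg''.2 hσ), Complex.real_smul, ← mul_assoc, ← Complex.ofReal_mul,
      neg_mul_neg, mul_inv_cancel₀ hσ.ne, Complex.ofReal_one, one_mul]
  rw [h2, ← integral_const_mul]
  congr 1
  ext x
  rw [← mul_assoc, ← Complex.ofReal_mul]
  congr 2
  have : (σ * x) ^ 2 + σ ^ 2 = σ ^ 2 * (1 + x ^ 2) := by ring
  rw [this]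
  have := hσ.ne
  field_simp

/-- The Sokhotski–Plemelj formula for an integrable density. -/
theorem tendsto_integral_inv_sub {h : ℝ → ℂ} (hh : Integrable h) (hc : Continuous h) {C M : ℝ}
    (hC : ∀ x, ‖h x - h (-x)‖ ≤ C * |x|) (hM : ∀ x, ‖h x‖ ≤ M) :
    Tendsto (fun σ : ℝ => ∫ x : ℝ, (Complex.I * x - σ)⁻¹ * h x) (𝓝[<] 0)
      (𝓝 (Real.pi * h 0 - Complex.I * (2⁻¹ * ∫ x : ℝ, (x : ℂ)⁻¹ * (h x - h (-x))))) := by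
  refine ((tendsto_integral_poisson hc hM).sub
    ((tendsto_integral_conjugate_poisson hh hC).const_mul Complex.I)).congr' ?_
  filter_upwards [self_mem_nhdsWithin] with σ (hσ : σ < 0)
  have hbd {f : ℝ → ℝ} (hf : Measurable f) (B : ℝ) (hB : ∀ x, |f x| ≤ B) :
      Integrable fun x => (f x : ℂ) * h x :=
    hh.bdd_mul (c := B) (Measurable.aestronglyMeasurable (by fun_prop))
      (.of_forall fun x => by simpa using hB x)
  have hs := abs_pos.2 hσ.ne
  have i1 : Integrable fun x : ℝ => ((-σ / (x ^ 2 + σ ^ 2) : ℝ) : ℂ) * h x := by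
    refine hbd (by fun_prop) |σ|⁻¹ fun x => ?_
    rw [abs_div, abs_of_nonneg (a := x ^ 2 + σ ^ 2) (by positivity), abs_neg, ← sq_abs σ,
      div_le_iff₀ (by positivity)]
    field_simp
    nlinarith [sq_nonneg x]
  have i2 : Integrable fun x : ℝ => ((x / (x ^ 2 + σ ^ 2) : ℝ) : ℂ) * h x := by
    refine hbd (by fun_prop) |σ|⁻¹ fun x => ?_
    rw [abs_div, abs_of_nonneg (a := x ^ 2 + σ ^ 2) (by positivity), ← sq_abs x, ← sq_abs σ,
      div_le_iff₀ (by positivity)]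
    field_simp
    nlinarith [sq_nonneg (|x| - |σ|), abs_nonneg x]
  rw [← integral_const_mul, ← integral_sub i1 (i2.const_mul _)]
  congr 1
  ext x
  rw [← mul_assoc, ← sub_mul]
  congr 1
  have h2 : (x : ℂ) ^ 2 + σ ^ 2 ≠ 0 := by
    have : x ^ 2 + σ ^ 2 ≠ 0 := by have := sq_pos_of_neg hσ; positivity
    exact_mod_cast this
  push_cast
  refine eq_inv_of_mul_eq_one_left ?_
  field_simp
  linear_combination (-(x:ℂ)^2) * Complex.I_sq

theorem norm_oneDimFT_le {f : ℝ → ℂ} (ξ : ℝ) : ‖oneDimFT f ξ‖ ≤ ∫ x, ‖f x‖ := by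
  refine (norm_integral_le_integral_norm _).trans_eq ?_
  congr 1
  ext x
  have : -Complex.I * x * ξ = ((-(x * ξ) : ℝ) : ℂ) * Complex.I := by push_cast; ring
  rw [norm_mul, this, Complex.norm_exp_ofReal_mul_I, mul_one]

theorem integrable_mul_exp_I {f : ℝ → ℂ} (hf : Integrable f) (ξ : ℝ) :
    Integrable fun x : ℝ => f x * Complex.exp (-Complex.I * x * ξ) := by
  refine hf.mul_bdd (c := 1) (Continuous.aestronglyMeasurable (by fun_prop)) (.of_forall fun x => ?_)
  have : -Complex.I * x * ξ = ((-(x * ξ) : ℝ) : ℂ) * Complex.I := by push_cast; ring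
  rw [this, Complex.norm_exp_ofReal_mul_I]

theorem norm_oneDimFT_sub_le {f : ℝ → ℂ} (hf : Integrable f)
    (hf' : Integrable fun x => ‖f x‖ * |x|) (ξ η : ℝ) :
    ‖oneDimFT f ξ - oneDimFT f η‖ ≤ (∫ x, ‖f x‖ * |x|) * |ξ - η| := by
  rw [oneDimFT, oneDimFT, ← integral_sub (integrable_mul_exp_I hf ξ) (integrable_mul_exp_I hf η),
    ← integral_mul_const]
  refine norm_integral_le_of_norm_le (hf'.mul_const _) (.of_forall fun x => ?_)
  have h1 : f x * Complex.exp (-Complex.I * x * ξ) - f x * Complex.exp (-Complex.I * x * η)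
      = f x * (Complex.exp (((-(x * η) : ℝ) : ℂ) * Complex.I) *
        (Complex.exp (Complex.I * ((-(x * (ξ - η)) : ℝ) : ℂ)) - 1)) := by
    rw [mul_sub, ← Complex.exp_add, mul_one, mul_sub]
    push_cast
    ring_nf
  rw [h1, norm_mul, norm_mul, Complex.norm_exp_ofReal_mul_I, one_mul, mul_assoc, ← abs_mul]
  refine mul_le_mul_of_nonneg_left ?_ (norm_nonneg _)
  exact Real.norm_exp_I_mul_ofReal_sub_one_le.trans_eq (by rw [norm_neg, Real.norm_eq_abs])

theorem continuous_oneDimFT {f : ℝ → ℂ} (hf : Integrable f) : Continuous (oneDimFT f) := by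
  refine continuous_of_dominated (bound := fun x => ‖f x‖) ?_ ?_ hf.norm ?_
  · exact fun ξ => (integrable_mul_exp_I hf ξ).aestronglyMeasurable
  · refine fun ξ => .of_forall fun x => ?_
    have : -Complex.I * x * ξ = ((-(x * ξ) : ℝ) : ℂ) * Complex.I := by push_cast; ring
    rw [norm_mul, this, Complex.norm_exp_ofReal_mul_I, mul_one]
  · exact .of_forall fun x => by fun_prop

theorem integrable_oneDimFT_schwartz (v : SchwartzMap ℝ ℂ) : Integrable (oneDimFT v) := by
  have h := (FourierTransform.fourier v).integrable (μ := volume)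
  have h2 := h.comp_div (g := FourierTransform.fourier v) (R := 2 * Real.pi) (by positivity)
  convert! h2 using 2 with ξ
  rw [SchwartzMap.fourier_coe, Real.fourier_eq', oneDimFT]
  congr 1
  ext x
  rw [smul_eq_mul, mul_comm]
  congr 2
  have : (Real.pi : ℂ) ≠ 0 := by exact_mod_cast Real.pi_ne_zero
  simp
  field_simp

theorem deriv_step_eq_zero {ψ : ℝ → ℝ} (hψ0 : ∀ t : ℝ, t ≤ -1 → ψ t = 0)
    (hψ1 : ∀ t : ℝ, 1 ≤ t → ψ t = 1) {x : ℝ} (hx : x ∉ Set.Icc (-1 : ℝ) 1) : deriv ψ x = 0 := by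
  rcases lt_or_ge x (-1) with h | h
  · have : ψ =ᶠ[𝓝 x] fun _ => 0 := by
      filter_upwards [Iio_mem_nhds h] with t ht using hψ0 t (le_of_lt ht)
    rw [this.deriv_eq, deriv_const]
  · have h' : 1 < x := by
      by_contra! h'
      exact hx ⟨h, h'⟩
    have : ψ =ᶠ[𝓝 x] fun _ => 1 := by
      filter_upwards [Ioi_mem_nhds h'] with t ht using hψ1 t (le_of_lt ht)
    rw [this.deriv_eq, deriv_const]

theorem integrable_of_eq_zero_off_Icc {E : Type*} [NormedAddCommGroup E] {f : ℝ → E}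
    (hf : Continuous f) (h0 : ∀ x ∉ Set.Icc (-1 : ℝ) 1, f x = 0) : Integrable f :=
  hf.integrable_of_hasCompactSupport (HasCompactSupport.intro isCompact_Icc h0)

theorem exists_norm_step_le {ψ : ℝ → ℝ} (hψ : Continuous ψ)
    (hψ0 : ∀ t : ℝ, t ≤ -1 → ψ t = 0) (hψ1 : ∀ t : ℝ, 1 ≤ t → ψ t = 1) :
    ∃ M, ∀ t, |ψ t| ≤ M := by
  obtain ⟨M, hM⟩ := isCompact_Icc.exists_bound_of_continuousOn
    (hψ.continuousOn (s := Set.Icc (-1 : ℝ) 1))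
  refine ⟨max M 1, fun t => ?_⟩
  rcases le_total t (-1) with h | h
  · simp [hψ0 t h]
  rcases le_total 1 t with h' | h'
  · simp [hψ1 t h']
  · exact (hM t ⟨h, h'⟩).trans (le_max_left _ _)

theorem integrable_step_mul_exp {ψ : ℝ → ℝ} (hψ : Continuous ψ)
    (hψ0 : ∀ t : ℝ, t ≤ -1 → ψ t = 0) (hψ1 : ∀ t : ℝ, 1 ≤ t → ψ t = 1) {a : ℂ} (ha : a.re < 0) :
    Integrable fun x : ℝ => (ψ x : ℂ) * Complex.exp (a * x) := by
  obtain ⟨M, hM⟩ := exists_norm_step_le hψ hψ0 hψ1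
  have hi : Integrable ((Set.Ioi (-1 : ℝ)).indicator fun x => Real.exp (a.re * x)) :=
    (integrable_indicator_iff measurableSet_Ioi).2 (integrableOn_exp_mul_Ioi ha _)
  refine (hi.const_mul M).mono' (Continuous.aestronglyMeasurable (by fun_prop))
    (.of_forall fun x => ?_)
  rcases le_or_gt x (-1) with h | h
  · simp [hψ0 x h, h]
  · rw [Set.indicator_of_mem (Set.mem_Ioi.2 h), norm_mul, Complex.norm_exp, Complex.norm_real]
    simpa using mul_le_mul_of_nonneg_right (hM x) (Real.exp_pos _).le

/-- Integration by parts: the regularized transform of the step is the transform of its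
derivative divided by `iζ - σ`. -/
theorem integral_step_mul_exp {ψ : ℝ → ℝ} (hψ : ContDiff ℝ (⊤ : ℕ∞) ψ)
    (hψ0 : ∀ t : ℝ, t ≤ -1 → ψ t = 0) (hψ1 : ∀ t : ℝ, 1 ≤ t → ψ t = 1) {σ : ℝ} (hσ : σ < 0)
    (ζ : ℝ) :
    ∫ x : ℝ, (ψ x : ℂ) * Complex.exp ((σ - Complex.I * ζ) * x) =
      (Complex.I * ζ - σ)⁻¹ *
        oneDimFT (fun x => ((deriv ψ x : ℝ) : ℂ) * Complex.exp (σ * x)) ζ := by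
  have hre : (σ - Complex.I * ζ : ℂ).re = σ := by simp
  have ha : (σ - Complex.I * ζ : ℂ) ≠ 0 := fun h => hσ.ne (by simpa [h] using hre.symm)
  have hd : Continuous (deriv ψ) := hψ.continuous_deriv (by simp)
  have hint := integrable_step_mul_exp hψ.continuous hψ0 hψ1 (hre.trans_lt hσ)
  have hparts := integral_mul_deriv_eq_deriv_mul_of_integrable
    (u := fun x : ℝ => (ψ x : ℂ)) (u' := fun x : ℝ => ((deriv ψ x : ℝ) : ℂ))
    (v := fun x : ℝ => Complex.exp ((σ - Complex.I * ζ) * x) / (σ - Complex.I * ζ))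
    (v' := fun x : ℝ => Complex.exp ((σ - Complex.I * ζ) * x))
    (fun x _ => ((hψ.differentiable (by simp)) x).hasDerivAt.ofReal_comp)
    (fun x _ => by
      have h := ((((hasDerivAt_id (x : ℂ)).const_mul (σ - Complex.I * ζ : ℂ)).cexp).div_const
        (σ - Complex.I * ζ : ℂ)).comp_ofReal
      simpa [ha] using h)
    hint
    (integrable_of_eq_zero_off_Icc (by fun_prop) fun x hx => by
      simp [deriv_step_eq_zero hψ0 hψ1 hx])
    (by
      convert! hint.div_const (σ - Complex.I * ζ : ℂ) using 2
      simp [mul_div_assoc])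
  rw [hparts, oneDimFT, ← integral_const_mul, ← integral_neg]
  congr 1
  ext x
  have h2 : (Complex.I * ζ - σ)⁻¹ = -(σ - Complex.I * ζ : ℂ)⁻¹ := by rw [← inv_neg, neg_sub]
  have h3 : Complex.exp ((σ - Complex.I * ζ) * x)
      = Complex.exp (σ * x) * Complex.exp (-Complex.I * x * ζ) := by
    rw [← Complex.exp_add]
    ring_nf
  rw [h2, h3]
  ring

theorem integral_deriv_step {ψ : ℝ → ℝ} (hψ : ContDiff ℝ (⊤ : ℕ∞) ψ)
    (hψ0 : ∀ t : ℝ, t ≤ -1 → ψ t = 0) (hψ1 : ∀ t : ℝ, 1 ≤ t → ψ t = 1) :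
    ∫ x, deriv ψ x = 1 := by
  rw [integral_of_hasDerivAt_of_tendsto (f := ψ) (m := 0) (n := 1)
    (fun x => ((hψ.differentiable (by simp)) x).hasDerivAt)
    (integrable_of_eq_zero_off_Icc (hψ.continuous_deriv (by simp)) fun x hx =>
      deriv_step_eq_zero hψ0 hψ1 hx), sub_zero]
  · exact tendsto_const_nhds.congr'
      ((eventually_le_atBot (-1 : ℝ)).mono fun t ht => (hψ0 t ht).symm)
  · exact tendsto_const_nhds.congr'
      ((eventually_ge_atTop (1 : ℝ)).mono fun t ht => (hψ1 t ht).symm)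

theorem norm_oneDimFT_mul_exp_sub_le {f : ℝ → ℂ} (hf : Continuous f)
    (h0 : ∀ x ∉ Set.Icc (-1 : ℝ) 1, f x = 0) {σ : ℝ} (hσ : |σ| ≤ 1) (ζ : ℝ) :
    ‖oneDimFT (fun x => f x * Complex.exp (σ * x)) ζ - oneDimFT f ζ‖ ≤
      2 * |σ| * ∫ x, ‖f x‖ := by
  have hi := integrable_of_eq_zero_off_Icc hf h0
  have hi' : Integrable fun x : ℝ => f x * Complex.exp (σ * x) :=
    integrable_of_eq_zero_off_Icc (by fun_prop) fun x hx => by simp [h0 x hx]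
  rw [oneDimFT, oneDimFT, ← integral_sub (integrable_mul_exp_I hi' ζ) (integrable_mul_exp_I hi ζ),
    ← integral_const_mul]
  refine norm_integral_le_of_norm_le (hi.norm.const_mul _) (.of_forall fun x => ?_)
  by_cases hx : x ∈ Set.Icc (-1 : ℝ) 1
  · have hsx : ‖(σ * x : ℂ)‖ ≤ |σ| := by
      rw [norm_mul, Complex.norm_real, Complex.norm_real]
      exact mul_le_of_le_one_right (abs_nonneg _) (abs_le.2 hx)
    have he := Complex.norm_exp_sub_one_le (hsx.trans hσ)
    have h1 : -Complex.I * x * ζ = ((-(x * ζ) : ℝ) : ℂ) * Complex.I := by push_cast; ring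
    rw [← sub_mul, norm_mul, h1, Complex.norm_exp_ofReal_mul_I, mul_one, ← mul_sub_one, norm_mul,
      mul_comm]
    refine mul_le_mul_of_nonneg_right ?_ (norm_nonneg _)
    linarith
  · simp [h0 x hx]

theorem modeRegFT_eq {ψ : ℝ → ℝ} (hψ : ContDiff ℝ (⊤ : ℕ∞) ψ)
    (hψ0 : ∀ t : ℝ, t ≤ -1 → ψ t = 0) (hψ1 : ∀ t : ℝ, 1 ≤ t → ψ t = 1) {σ : ℝ} (hσ : σ < 0)
    (ξc : ℝ) (v : ℝ → ℂ) (ξ : ℝ × ℝ) :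
    modeRegFT ξc ψ v σ ξ = (Complex.I * (ξ.1 - ξc : ℝ) - σ)⁻¹ *
      oneDimFT (fun x => ((deriv ψ x : ℝ) : ℂ) * Complex.exp (σ * x)) (ξ.1 - ξc) *
        oneDimFT v ξ.2 := by
  rw [← integral_step_mul_exp hψ hψ0 hψ1 hσ, oneDimFT, ← integral_prod_mul, modeRegFT,
    Measure.volume_eq_prod]
  congr 1
  ext x
  have : Complex.exp (-Complex.I * (x.1 * ξ.1 + x.2 * ξ.2)) =
      Complex.exp (-Complex.I * (x.1 * ξ.1)) * Complex.exp (-Complex.I * x.2 * ξ.2) := by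
    rw [← Complex.exp_add]
    ring_nf
  have h2 : Complex.exp ((σ - Complex.I * (ξ.1 - ξc : ℝ)) * x.1) =
      Complex.exp (Complex.I * ξc * x.1 + σ * x.1) * Complex.exp (-Complex.I * (x.1 * ξ.1)) := by
    rw [← Complex.exp_add]
    push_cast
    ring_nf
  rw [this, h2]
  ring

theorem integral_comp_fst_mul {K : ℝ → ℂ} (hK : Measurable K) {B : ℝ} (hB : ∀ x, ‖K x‖ ≤ B)
    {w : ℝ → ℂ} (hw : Continuous w) {M : ℝ} (hM : ∀ x, ‖w x‖ ≤ M) (c : ℝ)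
    {g : ℝ × ℝ → ℂ} (hg : Integrable g) :
    ∫ ξ : ℝ × ℝ, K (ξ.1 - c) * w ξ.2 * g ξ = ∫ ζ, K ζ * ∫ y, w y * g (ζ + c, y) := by
  have hi : Integrable fun ξ : ℝ × ℝ => K (ξ.1 - c) * w ξ.2 * g ξ := by
    refine hg.bdd_mul (c := B * M) ?_ (.of_forall fun ξ => ?_)
    · have := hw.measurable
      exact Measurable.aestronglyMeasurable (by fun_prop)
    · rw [norm_mul]
      exact mul_le_mul (hB _) (hM _) (norm_nonneg _) ((norm_nonneg _).trans (hB 0))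
  rw [Measure.volume_eq_prod] at hi ⊢
  rw [integral_prod _ hi, ← integral_add_right_eq_self _ c]
  simp_rw [add_sub_cancel_right, mul_assoc, integral_const_mul]

theorem exists_norm_schwartz_sub_le {E : Type*} [NormedAddCommGroup E] [NormedSpace ℝ E]
    (g : SchwartzMap E ℂ) : ∃ L, ∀ p q, ‖g p - g q‖ ≤ L * ‖p - q‖ := by
  refine ⟨SchwartzMap.seminorm ℝ 0 0 (SchwartzMap.fderivCLM ℝ E ℂ g), fun p q => ?_⟩
  exact Convex.norm_image_sub_le_of_norm_fderiv_le (𝕜 := ℝ)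
    (fun x _ => g.differentiableAt)
    (fun x _ => SchwartzMap.norm_le_seminorm ℝ (SchwartzMap.fderivCLM ℝ E ℂ g) x)
    convex_univ (Set.mem_univ _) (Set.mem_univ _)

theorem exists_norm_integral_slice_sub_le {w : ℝ → ℂ} (hw : Integrable w)
    (g : SchwartzMap (ℝ × ℝ) ℂ) :
    ∃ L, ∀ a b, ‖(∫ y, w y * g (a, y)) - ∫ y, w y * g (b, y)‖ ≤ L * |a - b| := by
  obtain ⟨L, hL⟩ := exists_norm_schwartz_sub_le g
  have hi (a : ℝ) : Integrable fun y => w y * g (a, y) :=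
    hw.mul_bdd (c := SchwartzMap.seminorm ℝ 0 0 g)
      (Continuous.aestronglyMeasurable (by have := g.continuous; fun_prop))
      (.of_forall fun y => SchwartzMap.norm_le_seminorm ℝ g _)
  refine ⟨(∫ y, ‖w y‖) * L, fun a b => ?_⟩
  rw [← integral_sub (hi a) (hi b), mul_assoc, ← integral_mul_const]
  refine norm_integral_le_of_norm_le (hw.norm.mul_const _) (.of_forall fun y => ?_)
  rw [← mul_sub, norm_mul]
  refine mul_le_mul_of_nonneg_left ((hL _ _).trans_eq ?_) (norm_nonneg _)
  simp [Prod.norm_def]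

theorem norm_integral_slice_le {w : ℝ → ℂ} (hw : Integrable w)
    (g : SchwartzMap (ℝ × ℝ) ℂ) (a : ℝ) :
    ‖∫ y, w y * g (a, y)‖ ≤ (∫ y, ‖w y‖) * SchwartzMap.seminorm ℝ 0 0 g := by
  rw [← integral_mul_const]
  refine norm_integral_le_of_norm_le (hw.norm.mul_const _) (.of_forall fun y => ?_)
  rw [norm_mul]
  exact mul_le_mul_of_nonneg_left (SchwartzMap.norm_le_seminorm ℝ g _) (norm_nonneg _)

theorem integrable_integral_slice {w : ℝ → ℂ} (hw : Continuous w) {M : ℝ} (hM : ∀ x, ‖w x‖ ≤ M)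
    {g : ℝ × ℝ → ℂ} (hg : Integrable g) : Integrable fun a => ∫ y, w y * g (a, y) := by
  have hi : Integrable fun ξ : ℝ × ℝ => w ξ.2 * g ξ :=
    hg.bdd_mul (c := M) (Continuous.aestronglyMeasurable (by fun_prop))
      (.of_forall fun ξ => hM _)
  rw [Measure.volume_eq_prod] at hi
  exact hi.integral_prod_left

/-- Replacing `ψ'(x) e^{σx}` by `ψ'(x)` does not change the boundary value. -/
theorem tendsto_integral_regularized_sub {f : ℝ → ℂ} (hf : Continuous f)
    (h0 : ∀ x ∉ Set.Icc (-1 : ℝ) 1, f x = 0) {G : ℝ → ℂ} (hG : Integrable G) :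
    Tendsto (fun σ : ℝ => ∫ ζ : ℝ, (Complex.I * ζ - σ)⁻¹ *
      (oneDimFT (fun x => f x * Complex.exp (σ * x)) ζ - oneDimFT f ζ) * G ζ) (𝓝[<] 0) (𝓝 0) := by
  set A := ∫ x, ‖f x‖
  have hi := integrable_of_eq_zero_off_Icc hf h0
  have hcont (σ : ℝ) : Continuous (oneDimFT fun x => f x * Complex.exp (σ * x)) :=
    continuous_oneDimFT
      (integrable_of_eq_zero_off_Icc (by fun_prop) fun x hx => by simp [h0 x hx])
  have hnear : ∀ᶠ σ : ℝ in 𝓝[<] 0, |σ| ≤ 1 :=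
    nhdsWithin_le_nhds ((continuous_abs.tendsto' (0 : ℝ) 0 abs_zero).eventually_le_const one_pos)
  have hlow1 (σ ζ : ℝ) : |σ| ≤ ‖(Complex.I * ζ - σ : ℂ)‖ := by
    simpa using Complex.abs_re_le_norm (Complex.I * ζ - σ)
  have hlow2 (σ ζ : ℝ) : |ζ| ≤ ‖(Complex.I * ζ - σ : ℂ)‖ := by
    simpa using Complex.abs_im_le_norm (Complex.I * ζ - σ)
  have hA : 0 ≤ A := integral_nonneg fun _ => norm_nonneg _
  rw [← integral_zero ℝ ℂ (μ := volume)]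
  refine tendsto_integral_filter_of_dominated_convergence (fun ζ => 2 * A * ‖G ζ‖) ?_ ?_
    (hG.norm.const_mul _) ?_
  · refine .of_forall fun σ => ?_
    have h1 := (hcont σ).measurable
    have h2 := (continuous_oneDimFT hi).measurable
    exact (Measurable.aestronglyMeasurable (by fun_prop)).mul hG.aestronglyMeasurable
  · filter_upwards [hnear, self_mem_nhdsWithin] with σ hσ1 (hσ : σ < 0)
    refine .of_forall fun ζ => ?_
    have hs := abs_pos.2 hσ.ne
    rw [norm_mul, norm_mul, norm_inv]
    refine mul_le_mul_of_nonneg_right ?_ (norm_nonneg _)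
    calc _ ≤ |σ|⁻¹ * (2 * |σ| * A) :=
          mul_le_mul (inv_anti₀ hs (hlow1 σ ζ)) (norm_oneDimFT_mul_exp_sub_le hf h0 hσ1 ζ)
            (norm_nonneg _) (by positivity)
      _ = 2 * A := by field_simp
  · have : ∀ᵐ x : ℝ, x ≠ 0 := by simp [ae_iff]
    filter_upwards [this] with ζ hζ
    have hz := abs_pos.2 hζ
    refine squeeze_zero_norm' (a := fun σ : ℝ => |ζ|⁻¹ * (2 * |σ| * A) * ‖G ζ‖) ?_ ?_
    · filter_upwards [hnear] with σ hσ1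
      rw [norm_mul, norm_mul, norm_inv]
      refine mul_le_mul_of_nonneg_right ?_ (norm_nonneg _)
      exact mul_le_mul (inv_anti₀ hz (hlow2 σ ζ)) (norm_oneDimFT_mul_exp_sub_le hf h0 hσ1 ζ)
            (norm_nonneg _) (by positivity)
    · have : Continuous fun σ : ℝ => |ζ|⁻¹ * (2 * |σ| * A) * ‖G ζ‖ := by fun_prop
      exact (this.tendsto' 0 0 (by simp)).mono_left nhdsWithin_le_nhds

/-- **Distributional Fourier transform of a cut-off wave-guide mode.**
With `v` Schwartz, `ξ° ∈ ℝ`, and `ψ₊` a smooth step function (`0` for `t ≤ −1`, `1` for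
`t ≥ 1`), for every Schwartz `g` on `ℝ²` the limit `lim_{σ→0⁻} ∫ U_σ g` exists, the principal
value `lim_{ε→0⁺} ∬_{|ξ₁−ξ°|>ε} (ψ̂₊′(ξ₁−ξ°)/(ξ₁−ξ°)) v̂(ξ₂) g(ξ) dξ` exists, and
`lim_{σ→0⁻} ∫ U_σ g = π ∫ v̂(ξ₂) g(ξ°,ξ₂) dξ₂ − i · PV`. -/
theorem mode_fourier_transform_structure
    (v : SchwartzMap ℝ ℂ) (ξc : ℝ)
    (ψ : ℝ → ℝ) (hψ : ContDiff ℝ (⊤ : ℕ∞) ψ)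
    (hψ0 : ∀ t : ℝ, t ≤ -1 → ψ t = 0) (hψ1 : ∀ t : ℝ, 1 ≤ t → ψ t = 1)
    (g : SchwartzMap (ℝ × ℝ) ℂ) :
    ∃ P : ℂ,
      Tendsto
        (fun ε : ℝ => ∫ ξ : ℝ × ℝ in {ξ : ℝ × ℝ | ε < |ξ.1 - ξc|},
          (oneDimFT (fun x => ((deriv ψ x : ℝ) : ℂ)) (ξ.1 - ξc) / (ξ.1 - ξc)) *
            oneDimFT (⇑v) ξ.2 * g ξ)
        (𝓝[>] 0) (𝓝 P) ∧
      Tendsto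
        (fun σ : ℝ => ∫ ξ : ℝ × ℝ, modeRegFT ξc ψ (⇑v) σ ξ * g ξ)
        (𝓝[<] 0)
        (𝓝 ((Real.pi : ℂ) * (∫ ξ₂ : ℝ, oneDimFT (⇑v) ξ₂ * g (ξc, ξ₂)) - Complex.I * P)) := by
  set f : ℝ → ℂ := fun x => ((deriv ψ x : ℝ) : ℂ) with hf_def
  have hd : Continuous (deriv ψ) := hψ.continuous_deriv (by simp)
  have hf : Continuous f := by fun_prop
  have hf0 : ∀ x ∉ Set.Icc (-1 : ℝ) 1, f x = 0 := fun x hx => by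
    simp [hf_def, deriv_step_eq_zero hψ0 hψ1 hx]
  have hfi := integrable_of_eq_zero_off_Icc hf hf0
  have hfx : Integrable fun x => ‖f x‖ * |x| :=
    integrable_of_eq_zero_off_Icc (by fun_prop) fun x hx => by simp [hf0 x hx]
  have hD : Continuous (oneDimFT f) := continuous_oneDimFT hfi
  have hw : Continuous (oneDimFT v) := continuous_oneDimFT v.integrable
  have hwi := integrable_oneDimFT_schwartz v
  have hD0 : oneDimFT f 0 = 1 := by
    have h1 : ∫ x, f x = 1 := by
      rw [← Complex.ofReal_one, ← integral_deriv_step hψ hψ0 hψ1]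
      exact integral_ofReal
    simpa [oneDimFT] using h1
  obtain ⟨L, hL⟩ := exists_norm_integral_slice_sub_le hwi g
  set G : ℝ → ℂ := fun ζ => ∫ y, oneDimFT v y * g (ζ + ξc, y) with hG_def
  have hGL (a b : ℝ) : ‖G a - G b‖ ≤ L * |a - b| := by
    simpa using hL (a + ξc) (b + ξc)
  have hGB (a : ℝ) : ‖G a‖ ≤ _ := norm_integral_slice_le hwi g (a + ξc)
  have hGi : Integrable G :=
    (integrable_integral_slice hw (norm_oneDimFT_le (f := v)) g.integrable).comp_add_right ξc
  have hGc : Continuous G :=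
    (LipschitzWith.of_dist_le' (K := L) fun a b => by
      simpa only [dist_eq_norm, Real.norm_eq_abs] using hGL a b).continuous
  set B := ∫ x, ‖f x‖
  set N := (∫ y, ‖oneDimFT v y‖) * SchwartzMap.seminorm ℝ 0 0 g
  have hB : ∀ ζ, ‖oneDimFT f ζ‖ ≤ B := norm_oneDimFT_le
  have hB0 : 0 ≤ B := (norm_nonneg _).trans (hB 0)
  have hhi : Integrable fun ζ => oneDimFT f ζ * G ζ :=
    hGi.bdd_mul hD.aestronglyMeasurable (.of_forall hB)
  have hhL (x : ℝ) : ‖oneDimFT f x * G x - oneDimFT f (-x) * G (-x)‖ ≤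
      (2 * (B * L + (∫ x, ‖f x‖ * |x|) * N)) * |x| := by
    have h1 : oneDimFT f x * G x - oneDimFT f (-x) * G (-x) =
        oneDimFT f x * (G x - G (-x)) + (oneDimFT f x - oneDimFT f (-x)) * G (-x) := by ring
    have h2 : |x - -x| = 2 * |x| := by rw [sub_neg_eq_add, ← two_mul, abs_mul, abs_two]
    rw [h1]
    refine (norm_add_le _ _).trans ?_
    rw [norm_mul, norm_mul]
    have h3 := mul_le_mul (hB x) (hGL x (-x)) (norm_nonneg _) hB0
    have h4 := mul_le_mul (norm_oneDimFT_sub_le hfi hfx x (-x)) (hGB (-x)) (norm_nonneg _)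
      ((norm_nonneg _).trans (norm_oneDimFT_sub_le hfi hfx x (-x)))
    rw [h2] at h3 h4
    linarith
  have hhB (x : ℝ) : ‖oneDimFT f x * G x‖ ≤ B * N := by
    rw [norm_mul]
    exact mul_le_mul (hB x) (hGB x) (norm_nonneg _) hB0
  refine ⟨2⁻¹ * ∫ x : ℝ, (x : ℂ)⁻¹ * (oneDimFT f x * G x - oneDimFT f (-x) * G (-x)), ?_, ?_⟩
  · refine (tendsto_integral_truncated_inv hhi hhL).congr' ?_
    filter_upwards [self_mem_nhdsWithin] with ε (hε : 0 < ε)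
    have hs : MeasurableSet {x : ℝ | ε < |x|} :=
      measurableSet_lt measurable_const (by fun_prop)
    have hK : Measurable fun x : ℝ =>
        {x : ℝ | ε < |x|}.indicator (fun x => (x : ℂ)⁻¹) x * oneDimFT f x :=
      (Measurable.indicator (by fun_prop) hs).mul hD.measurable
    have hKB (x : ℝ) :
        ‖{x : ℝ | ε < |x|}.indicator (fun x => (x : ℂ)⁻¹) x * oneDimFT f x‖ ≤ ε⁻¹ * B := by
      rw [norm_mul]
      refine mul_le_mul ?_ (hB x) (norm_nonneg _) (by positivity)
      by_cases hx : ε < |x|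
      · simpa [Set.indicator, hx] using inv_anti₀ hε hx.le
      · simp [Set.indicator, hx, hε.le]
    have h1 := integral_comp_fst_mul hK hKB hw (norm_oneDimFT_le (f := v)) ξc g.integrable
    simp_rw [← mul_assoc]
    rw [← h1, ← integral_indicator (measurableSet_lt measurable_const (by fun_prop))]
    congr 1
    ext ξ
    by_cases hx : ε < |ξ.1 - ξc|
    · simp [Set.indicator, hx, div_eq_inv_mul]
    · simp [Set.indicator, hx]
  · have h1 := (tendsto_integral_regularized_sub hf hf0 hGi).add
      (tendsto_integral_inv_sub hhi (hD.mul hGc) hhL hhB)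
    simp only [zero_add, hD0, one_mul] at h1
    have hG0 : G 0 = ∫ ξ₂ : ℝ, oneDimFT v ξ₂ * g (ξc, ξ₂) := by simp [hG_def]
    rw [← hG0]
    refine h1.congr' ?_
    filter_upwards [self_mem_nhdsWithin] with σ (hσ : σ < 0)
    have hfσ : Integrable fun x : ℝ => f x * Complex.exp (σ * x) :=
      integrable_of_eq_zero_off_Icc (by fun_prop) fun x hx => by simp [hf0 x hx]
    have hDσ := continuous_oneDimFT hfσ
    have hs := abs_pos.2 hσ.ne
    have hinv (ζ : ℝ) : ‖(Complex.I * ζ - σ : ℂ)⁻¹‖ ≤ |σ|⁻¹ := by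
      rw [norm_inv]
      exact inv_anti₀ hs (by simpa using Complex.abs_re_le_norm (Complex.I * ζ - σ))
    have hinvm : Measurable fun ζ : ℝ => (Complex.I * ζ - σ : ℂ)⁻¹ := by fun_prop
    have hbd {E : ℝ → ℂ} (hE : Continuous E) {R : ℝ} (hR : ∀ x, ‖E x‖ ≤ R) :
        Measurable (fun ζ : ℝ => (Complex.I * ζ - σ : ℂ)⁻¹ * E ζ) ∧
          ∀ ζ : ℝ, ‖(Complex.I * ζ - σ : ℂ)⁻¹ * E ζ‖ ≤ |σ|⁻¹ * R := by
      refine ⟨hinvm.mul hE.measurable, fun ζ => ?_⟩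
      rw [norm_mul]
      exact mul_le_mul (hinv ζ) (hR ζ) (norm_nonneg _) (by positivity)
    have hint {E : ℝ → ℂ} (hE : Continuous E) {R : ℝ} (hR : ∀ x, ‖E x‖ ≤ R) :
        Integrable fun ζ : ℝ => (Complex.I * ζ - σ : ℂ)⁻¹ * E ζ * G ζ :=
      hGi.bdd_mul (hbd hE hR).1.aestronglyMeasurable (.of_forall (hbd hE hR).2)
    obtain ⟨hm, hb⟩ := hbd hDσ (norm_oneDimFT_le (f := fun x : ℝ => f x * Complex.exp (σ * x)))
    have h2 := integral_comp_fst_mul hm hb hw (norm_oneDimFT_le (f := v)) ξc g.integrable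
    simp_rw [modeRegFT_eq hψ hψ0 hψ1 hσ]
    rw [h2]
    simp_rw [← mul_assoc]
    rw [← integral_add]
    · congr 1
      ext ζ
      ring
    · exact hint (hDσ.sub hD) fun x => (norm_sub_le _ _).trans
        (add_le_add (norm_oneDimFT_le x) (hB x))
    · exact hint hD hB
end
end

section
/- Let λ > 0, R ∈ ℝ, and let h₀ : ℝ → ℝ be smooth with h₀(x) = 0 for x ≤ R and h₀(x) = 1 for x ≥ R + 1. Set ĥ₀′(ζ) = ∫_ℝ h₀′(x) e^{−iζx} dx. For σ < 0 let W_σ(ξ) = ∫_ℝ h₀(x) e^{−iλx + σx − iξx} dx (an absolutely convergent integral). Then for every Schwartz function g on ℝ: the limit lim_{σ→0⁻} ∫_ℝ W_σ(ξ) g(ξ) dξ exists, the principal value limit lim_{ε→0⁺} ∫_{|ξ + λ| > ε} (ĥ₀′(ξ + λ)/(ξ + λ)) g(ξ) dξ exists, and lim_{σ→0⁻} ∫_ℝ W_σ(ξ) g(ξ) dξ = π g(−λ) − i · lim_{ε→0⁺} ∫_{|ξ + λ| > ε} (ĥ₀′(ξ + λ)/(ξ + λ)) g(ξ) dξ. 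-/
open MeasureTheory Filter Topology

noncomputable section

/-- The quotient `f η / (η + iσ)` with its singular part on `[-1, 1]` removed. -/
def regularizedQuotient (σ : ℝ) (f : ℝ → ℂ) (η : ℝ) : ℂ :=
  (f η - (Set.Icc (-1 : ℝ) 1).indicator (fun _ => f 0) η) / ((η : ℂ) + σ * Complex.I)

lemma abs_le_norm_add_mul_I (σ η : ℝ) : |η| ≤ ‖(η : ℂ) + σ * Complex.I‖ := by
  simpa using Complex.abs_re_le_norm ((η : ℂ) + σ * Complex.I)

lemma norm_regularizedQuotient_le {f : ℝ → ℂ} {B : ℝ → ℝ} {C : ℝ}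
    (hB : ∀ η, ‖f η‖ ≤ B η) (hC : ∀ η, |η| ≤ 1 → ‖f η - f 0‖ ≤ C * |η|) (σ η : ℝ) :
    ‖regularizedQuotient σ f η‖ ≤ B η + (Set.Icc (-1 : ℝ) 1).indicator (fun _ => C) η := by
  have hle := abs_le_norm_add_mul_I σ η
  have hB0 : 0 ≤ B η := (norm_nonneg _).trans (hB η)
  have hC0 : 0 ≤ C := by simpa using (norm_nonneg _).trans (hC 1 (by simp))
  unfold regularizedQuotient
  rw [norm_div]
  by_cases hη : η ∈ Set.Icc (-1 : ℝ) 1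
  · rw [Set.indicator_of_mem hη, Set.indicator_of_mem hη]
    refine div_le_of_le_mul₀ (norm_nonneg _) (by positivity) ?_
    calc ‖f η - f 0‖ ≤ C * |η| := hC η (abs_le.2 hη)
      _ ≤ (B η + C) * ‖(η : ℂ) + σ * Complex.I‖ := by gcongr; linarith
  · rw [Set.indicator_of_notMem hη, Set.indicator_of_notMem hη, sub_zero, add_zero]
    refine div_le_of_le_mul₀ (norm_nonneg _) hB0 ?_
    have h1 : 1 ≤ |η| := by
      by_contra! h
      exact hη (abs_le.1 h.le)
    calc ‖f η‖ ≤ B η * 1 := by simpa using hB η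
      _ ≤ B η * ‖(η : ℂ) + σ * Complex.I‖ := by gcongr; linarith

lemma measurable_regularizedQuotient {f : ℝ → ℂ} (hf : Continuous f) (σ : ℝ) :
    Measurable (regularizedQuotient σ f) := by
  unfold regularizedQuotient
  have := hf.measurable
  have : Measurable ((Set.Icc (-1 : ℝ) 1).indicator (fun _ => f 0)) :=
    measurable_const.indicator measurableSet_Icc
  fun_prop

lemma integrable_indicator_Icc_const {E : Type*} [NormedAddCommGroup E] (a b : ℝ) (c : E) :
    Integrable ((Set.Icc a b).indicator (fun _ => c)) :=
  (integrable_indicator_iff measurableSet_Icc).2 (by simp)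

lemma integral_eq_zero_of_odd {f : ℝ → ℂ} (hf : ∀ x, f (-x) = -f x) : ∫ x, f x = 0 := by
  have h := integral_neg_eq_self f volume
  simp only [hf, integral_neg] at h
  exact self_eq_neg.1 h.symm

lemma tendsto_principalValue {f : ℝ → ℂ} {B : ℝ → ℝ} {C : ℝ} (hf : Continuous f)
    (hBi : Integrable B) (hB : ∀ η, ‖f η‖ ≤ B η)
    (hC : ∀ η, |η| ≤ 1 → ‖f η - f 0‖ ≤ C * |η|) :
    Tendsto (fun ε : ℝ => ∫ η in {η : ℝ | ε < |η|}, f η / η) (𝓝[>] 0)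
      (𝓝 (∫ η, regularizedQuotient 0 f η)) := by
  have hmeas : ∀ ε : ℝ, MeasurableSet {η : ℝ | ε < |η|} := fun ε =>
    measurableSet_lt measurable_const continuous_abs.measurable
  have hK := measurable_regularizedQuotient hf 0
  have hbound := norm_regularizedQuotient_le hB hC 0
  have hbi : Integrable (fun η => B η + (Set.Icc (-1 : ℝ) 1).indicator (fun _ => C) η) :=
    hBi.add (integrable_indicator_Icc_const _ _ _)
  have key : ∀ ε : ℝ, 0 < ε → ∫ η in {η : ℝ | ε < |η|}, f η / η =
      ∫ η, {η : ℝ | ε < |η|}.indicator (regularizedQuotient 0 f) η := by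
    intro ε hε
    have hodd : ∫ η, {η : ℝ | ε < |η|}.indicator
        (fun η => (Set.Icc (-1 : ℝ) 1).indicator (fun _ => f 0) η / (η : ℂ)) η = 0 := by
      refine integral_eq_zero_of_odd fun x => ?_
      have : -x ∈ Set.Icc (-1 : ℝ) 1 ↔ x ∈ Set.Icc (-1 : ℝ) 1 := by
        rw [Set.mem_Icc, Set.mem_Icc, ← abs_le, ← abs_le, abs_neg]
      simp only [Set.indicator, Set.mem_ofPred_eq, abs_neg, this]
      split_ifs <;> simp [div_neg]
    rw [← integral_indicator (hmeas ε), ← sub_eq_zero, ← integral_sub]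
    · refine Eq.trans ?_ hodd
      congr 1
      ext η
      simp only [Set.indicator, regularizedQuotient, Complex.ofReal_zero, zero_mul, add_zero]
      split_ifs <;> ring
    · rw [integrable_indicator_iff (hmeas ε)]
      refine Integrable.mono' (g := fun η => B η * ε⁻¹) (hBi.mul_const _).integrableOn
        (hf.measurable.div Complex.measurable_ofReal).aestronglyMeasurable ?_
      refine (ae_restrict_iff' (hmeas ε)).2 (.of_forall fun η (hη : ε < |η|) => ?_)
      rw [norm_div, div_eq_mul_inv, Complex.norm_real, Real.norm_eq_abs]
      have := hB η
      have : 0 ≤ B η := (norm_nonneg _).trans this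
      gcongr
    · exact (hbi.mono' hK.aestronglyMeasurable (.of_forall hbound)).indicator (hmeas ε)
  refine Tendsto.congr' (f₁ := fun ε : ℝ =>
    ∫ η, {η : ℝ | ε < |η|}.indicator (regularizedQuotient 0 f) η) ?_ ?_
  · filter_upwards [self_mem_nhdsWithin] with ε hε using (key ε hε).symm
  · refine tendsto_integral_filter_of_dominated_convergence _
      (.of_forall fun ε => (hK.indicator (hmeas ε)).aestronglyMeasurable)
      (.of_forall fun ε => .of_forall fun η => (norm_indicator_le_norm_self _ _).trans (hbound η))
      hbi ?_
    filter_upwards [Measure.ae_ne volume (0 : ℝ)] with η hη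
    refine tendsto_const_nhds.congr' ?_
    filter_upwards [nhdsWithin_le_nhds (Iio_mem_nhds (abs_pos.2 hη))] with ε hε
    exact (Set.indicator_of_mem (s := {η : ℝ | ε < |η|}) hε _).symm

lemma add_mul_I_ne_zero {σ : ℝ} (hσ : σ ≠ 0) (η : ℝ) : (η : ℂ) + σ * Complex.I ≠ 0 := by
  intro h
  exact hσ (by simpa using congrArg Complex.im h)

lemma tendsto_integral_Icc_inv_add_mul_I :
    Tendsto (fun σ : ℝ => ∫ η in Set.Icc (-1 : ℝ) 1, ((η : ℂ) + σ * Complex.I)⁻¹) (𝓝[<] 0)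
      (𝓝 (Real.pi * Complex.I)) := by
  have key : ∀ σ : ℝ, σ < 0 → ∫ η in Set.Icc (-1 : ℝ) 1, ((η : ℂ) + σ * Complex.I)⁻¹ =
      Complex.log (1 + σ * Complex.I) - Complex.log (-1 + σ * Complex.I) := by
    intro σ hσ
    have hne := add_mul_I_ne_zero hσ.ne
    have hcont : Continuous fun η : ℝ => ((η : ℂ) + σ * Complex.I)⁻¹ :=
      Continuous.inv₀ (by fun_prop) hne
    rw [integral_Icc_eq_integral_Ioc, ← intervalIntegral.integral_of_le (by norm_num),
      intervalIntegral.integral_eq_sub_of_hasDerivAt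
        (f := fun η : ℝ => Complex.log ((η : ℂ) + σ * Complex.I)) _
        (hcont.intervalIntegrable _ _)]
    · simp
    · intro η _
      have h := (Complex.ofRealCLM.hasDerivAt (x := η)).add_const ((σ : ℂ) * Complex.I)
      have h2 := HasDerivAt.clog_real h (Or.inr (by simpa using hσ.ne))
      simpa using h2
  have h0 : Tendsto (fun σ : ℝ => (σ : ℂ) * Complex.I) (𝓝[<] 0) (𝓝 0) := by
    have : Continuous fun σ : ℝ => (σ : ℂ) * Complex.I := by fun_prop
    simpa using (this.tendsto 0).mono_left nhdsWithin_le_nhds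
  have h1 : Tendsto (fun σ : ℝ => Complex.log (1 + σ * Complex.I)) (𝓝[<] 0) (𝓝 0) := by
    have h := (tendsto_const_nhds (x := (1 : ℂ))).add h0
    rw [add_zero] at h
    simpa using h.clog (by simp)
  have h2 : Tendsto (fun σ : ℝ => Complex.log (-1 + σ * Complex.I)) (𝓝[<] 0)
      (𝓝 (-(Real.pi * Complex.I))) := by
    have h := (tendsto_const_nhds (x := (-1 : ℂ))).add h0
    rw [add_zero] at h
    have hl := Complex.tendsto_log_nhdsWithin_im_neg_of_re_neg_of_im_zero
      (z := -1) (by simp) (by simp)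
    have := hl.comp (tendsto_nhdsWithin_iff.2 ⟨h, by
      filter_upwards [self_mem_nhdsWithin] with σ hσ
      simpa using hσ⟩)
    simpa [Function.comp_def] using this
  have h3 := h1.sub h2
  rw [zero_sub, neg_neg] at h3
  refine h3.congr' ?_
  filter_upwards [self_mem_nhdsWithin] with σ hσ using (key σ hσ).symm

lemma tendsto_integral_div_add_mul_I {G : ℝ → ℝ → ℂ} {B : ℝ → ℝ} {C : ℝ}
    (hG : Continuous (Function.uncurry G)) (hBi : Integrable B)
    (hB : ∀ σ ∈ Set.Icc (-1 : ℝ) 0, ∀ η, ‖G σ η‖ ≤ B η)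
    (hC : ∀ σ ∈ Set.Icc (-1 : ℝ) 0, ∀ η, |η| ≤ 1 → ‖G σ η - G σ 0‖ ≤ C * |η|) :
    Tendsto (fun σ : ℝ => ∫ η, G σ η / ((η : ℂ) + σ * Complex.I)) (𝓝[<] 0)
      (𝓝 ((∫ η, regularizedQuotient 0 (G 0) η) + G 0 0 * (Real.pi * Complex.I))) := by
  have hGσ : ∀ σ, Continuous (G σ) := fun σ => hG.comp (by fun_prop : Continuous fun η => (σ, η))
  have hGη : ∀ η, Tendsto (fun σ => G σ η) (𝓝[<] 0) (𝓝 (G 0 η)) := fun η =>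
    ((hG.comp (by fun_prop : Continuous fun σ : ℝ => (σ, η))).tendsto 0).mono_left
      nhdsWithin_le_nhds
  have hbi : Integrable (fun η => B η + (Set.Icc (-1 : ℝ) 1).indicator (fun _ => C) η) :=
    hBi.add (integrable_indicator_Icc_const _ _ _)
  have hev : ∀ᶠ σ : ℝ in 𝓝[<] 0, σ ∈ Set.Ico (-1 : ℝ) 0 := Ico_mem_nhdsLT (by norm_num)
  have hreg : Tendsto (fun σ : ℝ => ∫ η, regularizedQuotient σ (G σ) η) (𝓝[<] 0)
      (𝓝 (∫ η, regularizedQuotient 0 (G 0) η)) := by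
    refine tendsto_integral_filter_of_dominated_convergence _
      (.of_forall fun σ => (measurable_regularizedQuotient (hGσ σ) σ).aestronglyMeasurable)
      ?_ hbi ?_
    · filter_upwards [hev] with σ hσ
      have hσ' := Set.Ico_subset_Icc_self hσ
      exact .of_forall (norm_regularizedQuotient_le (hB σ hσ') (hC σ hσ') σ)
    · filter_upwards [Measure.ae_ne volume (0 : ℝ)] with η hη
      unfold regularizedQuotient
      refine Tendsto.div ((hGη η).sub ?_) ?_ (by simpa using hη)
      · by_cases h : η ∈ Set.Icc (-1 : ℝ) 1
        · simpa only [Set.indicator_of_mem h] using hGη 0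
        · simpa only [Set.indicator_of_notMem h] using tendsto_const_nhds
      · have : Continuous fun σ : ℝ => (η : ℂ) + σ * Complex.I := by fun_prop
        exact (this.tendsto 0).mono_left nhdsWithin_le_nhds
  refine (hreg.add ((hGη 0).mul tendsto_integral_Icc_inv_add_mul_I)).congr' ?_
  filter_upwards [hev] with σ hσ
  have hσ' := Set.Ico_subset_Icc_self hσ
  have hcont : Continuous fun η : ℝ => ((η : ℂ) + σ * Complex.I)⁻¹ :=
    Continuous.inv₀ (by fun_prop) (add_mul_I_ne_zero hσ.2.ne)
  rw [← integral_const_mul, ← integral_indicator measurableSet_Icc, ← integral_add]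
  · congr 1
    ext η
    simp only [Set.indicator, regularizedQuotient]
    split_ifs <;> ring
  · exact hbi.mono' (measurable_regularizedQuotient (hGσ σ) σ).aestronglyMeasurable
      (.of_forall (norm_regularizedQuotient_le (hB σ hσ') (hC σ hσ') σ))
  · rw [integrable_indicator_iff measurableSet_Icc]
    exact (continuous_const.mul hcont).continuousOn.integrableOn_compact isCompact_Icc

/-- The Fourier transform of `k`, continued to the complex frequency `η + iσ`. -/
def fourierLaplace (k : ℝ → ℝ) (σ η : ℝ) : ℂ :=
  ∫ x : ℝ, (k x : ℂ) * Complex.exp ((-Complex.I * η + σ) * x)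

section fourierLaplace

variable {k : ℝ → ℝ}

lemma continuous_fourierLaplace (hk : Continuous k) (hs : HasCompactSupport k) :
    Continuous (Function.uncurry (fourierLaplace k)) := by
  have h := continuous_parametric_integral_of_continuous (μ := volume)
    (f := fun (p : ℝ × ℝ) (x : ℝ) =>
      (k x : ℂ) * Complex.exp ((-Complex.I * (p.2 : ℂ) + (p.1 : ℂ)) * x))
    (by fun_prop) hs
  refine h.congr fun p => ?_
  refine setIntegral_eq_integral_of_forall_compl_eq_zero fun x hx => ?_
  simp [image_eq_zero_of_notMem_tsupport hx]

lemma norm_exp_frequency (σ η x : ℝ) :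
    ‖Complex.exp ((-Complex.I * η + σ) * x)‖ = Real.exp (σ * x) := by
  simp [Complex.norm_exp]

lemma mul_le_abs_of_mem_Icc {σ : ℝ} (hσ : σ ∈ Set.Icc (-1 : ℝ) 0) (x : ℝ) : σ * x ≤ |x| := by
  refine (le_abs_self _).trans ?_
  rw [abs_mul]
  exact mul_le_of_le_one_left (abs_nonneg x) (abs_le.2 ⟨hσ.1, hσ.2.trans zero_le_one⟩)

lemma integrable_mul_exp_frequency (hk : Continuous k) (hs : HasCompactSupport k) (σ η : ℝ) :
    Integrable fun x : ℝ => (k x : ℂ) * Complex.exp ((-Complex.I * η + σ) * x) := by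
  refine Continuous.integrable_of_hasCompactSupport (by fun_prop) ?_
  exact (hs.comp_left (g := ((↑) : ℝ → ℂ)) Complex.ofReal_zero).mul_right

lemma norm_fourierLaplace_le (hk : Continuous k) (hs : HasCompactSupport k) {σ : ℝ}
    (hσ : σ ∈ Set.Icc (-1 : ℝ) 0) (η : ℝ) :
    ‖fourierLaplace k σ η‖ ≤ ∫ x, |k x| * Real.exp |x| := by
  have hi : Integrable fun x => |k x| * Real.exp |x| :=
    Continuous.integrable_of_hasCompactSupport (by fun_prop)
      ((hs.comp_left (g := (|·|)) abs_zero).mul_right)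
  refine norm_integral_le_of_norm_le hi (.of_forall fun x => ?_)
  rw [norm_mul, norm_exp_frequency, Complex.norm_real, Real.norm_eq_abs]
  gcongr
  exact mul_le_abs_of_mem_Icc hσ x

lemma norm_fourierLaplace_sub_le (hk : Continuous k) (hs : HasCompactSupport k) {σ : ℝ}
    (hσ : σ ∈ Set.Icc (-1 : ℝ) 0) (η : ℝ) :
    ‖fourierLaplace k σ η - fourierLaplace k σ 0‖ ≤ (∫ x, |k x| * (Real.exp |x| * |x|)) * |η| := by
  have hi : Integrable fun x => |k x| * (Real.exp |x| * |x|) :=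
    Continuous.integrable_of_hasCompactSupport (by fun_prop)
      ((hs.comp_left (g := (|·|)) abs_zero).mul_right)
  unfold fourierLaplace
  rw [← integral_sub (integrable_mul_exp_frequency hk hs σ η)
    (integrable_mul_exp_frequency hk hs σ 0), ← integral_mul_const]
  refine norm_integral_le_of_norm_le (hi.mul_const _) (.of_forall fun x => ?_)
  have hfac : (k x : ℂ) * Complex.exp ((-Complex.I * η + σ) * x) -
      (k x : ℂ) * Complex.exp ((-Complex.I * (0 : ℝ) + σ) * x) =
      (k x : ℂ) * (Complex.exp ((-Complex.I * (0 : ℝ) + σ) * x) *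
        (Complex.exp (Complex.I * (-(η * x) : ℝ)) - 1)) := by
    rw [mul_sub, ← Complex.exp_add, mul_sub, mul_one]
    congr 3
    push_cast
    ring
  rw [hfac, norm_mul, norm_mul, norm_exp_frequency, Complex.norm_real, Real.norm_eq_abs,
    mul_assoc, mul_assoc, ← abs_mul, mul_comm x η, ← abs_neg (η * x)]
  gcongr
  · exact mul_le_abs_of_mem_Icc hσ x
  · exact Real.norm_exp_I_mul_ofReal_sub_one_le

end fourierLaplace

lemma SchwartzMap.norm_sub_le_mul_abs (g : SchwartzMap ℝ ℂ) (x y : ℝ) :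
    ‖g y - g x‖ ≤ SchwartzMap.seminorm ℝ 0 0 (SchwartzMap.derivCLM ℝ ℂ g) * |y - x| := by
  refine Convex.norm_image_sub_le_of_norm_deriv_le (s := Set.univ)
    (fun z _ => g.differentiableAt) (fun z _ => ?_) convex_univ trivial trivial
  rw [← SchwartzMap.derivCLM_apply ℝ]
  exact SchwartzMap.norm_le_seminorm ℝ _ z

section Step

variable {R : ℝ} {h : ℝ → ℝ}

lemma deriv_eq_zero_of_notMem_Icc (hvan : ∀ x, x ≤ R → h x = 0) (hone : ∀ x, R + 1 ≤ x → h x = 1)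
    {x : ℝ} (hx : x ∉ Set.Icc R (R + 1)) : deriv h x = 0 := by
  rcases lt_or_ge x R with hl | hl
  · have : h =ᶠ[𝓝 x] fun _ => 0 := by
      filter_upwards [Iio_mem_nhds hl] with y hy using hvan y (le_of_lt hy)
    rw [this.deriv_eq, deriv_const]
  · have hl' : R + 1 < x := by
      by_contra! hc
      exact hx ⟨hl, hc⟩
    have : h =ᶠ[𝓝 x] fun _ => 1 := by
      filter_upwards [Ioi_mem_nhds hl'] with y hy using hone y (le_of_lt hy)
    rw [this.deriv_eq, deriv_const]

lemma hasCompactSupport_deriv_of_step (hvan : ∀ x, x ≤ R → h x = 0)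
    (hone : ∀ x, R + 1 ≤ x → h x = 1) : HasCompactSupport (deriv h) :=
  HasCompactSupport.intro isCompact_Icc fun _ hx => deriv_eq_zero_of_notMem_Icc hvan hone hx

lemma exists_abs_le_of_step (hc : Continuous h) (hvan : ∀ x, x ≤ R → h x = 0)
    (hone : ∀ x, R + 1 ≤ x → h x = 1) : ∃ M, ∀ x, |h x| ≤ M := by
  obtain ⟨M, hM⟩ := (isCompact_Icc (a := R) (b := R + 1)).exists_bound_of_continuousOn
    hc.continuousOn
  refine ⟨max M 1, fun x => ?_⟩
  by_cases hx : x ∈ Set.Icc R (R + 1)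
  · exact (hM x hx).trans (le_max_left _ _)
  · rcases lt_or_ge x R with hl | hl
    · simp [hvan x hl.le]
    · have hl' : R + 1 ≤ x := by
        by_contra! hc
        exact hx ⟨hl, hc.le⟩
      simp [hone x hl']

lemma tendsto_step_atBot (hvan : ∀ x, x ≤ R → h x = 0) : Tendsto h atBot (𝓝 0) :=
  tendsto_const_nhds.congr' (by
    filter_upwards [eventually_le_atBot R] with x hx using (hvan x hx).symm)

lemma tendsto_step_atTop (hone : ∀ x, R + 1 ≤ x → h x = 1) : Tendsto h atTop (𝓝 1) :=
  tendsto_const_nhds.congr' (by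
    filter_upwards [eventually_ge_atTop (R + 1)] with x hx using (hone x hx).symm)

lemma fourierLaplace_deriv_step_zero (hh : ContDiff ℝ 1 h) (hvan : ∀ x, x ≤ R → h x = 0)
    (hone : ∀ x, R + 1 ≤ x → h x = 1) : fourierLaplace (deriv h) 0 0 = 1 := by
  have hi : Integrable (deriv h) := (hh.continuous_deriv le_rfl).integrable_of_hasCompactSupport
    (hasCompactSupport_deriv_of_step hvan hone)
  have := integral_of_hasDerivAt_of_tendsto
    (fun x => (hh.differentiable one_ne_zero x).hasDerivAt) hi
    (tendsto_step_atBot hvan) (tendsto_step_atTop hone)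
  simp [fourierLaplace, integral_complex_ofReal, this]

lemma integral_step_mul_exp_s5 (hh : ContDiff ℝ 1 h) (hvan : ∀ x, x ≤ R → h x = 0)
    (hone : ∀ x, R + 1 ≤ x → h x = 1) {σ : ℝ} (hσ : σ < 0) (η : ℝ) :
    ∫ x : ℝ, (h x : ℂ) * Complex.exp ((-Complex.I * η + σ) * x) =
      -Complex.I * (fourierLaplace (deriv h) σ η / ((η : ℂ) + σ * Complex.I)) := by
  obtain ⟨M, hM⟩ := exists_abs_le_of_step hh.continuous hvan hone
  have hk := hh.continuous_deriv le_rfl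
  have hs := hasCompactSupport_deriv_of_step hvan hone
  have hcont := hh.continuous
  set s : ℂ := -Complex.I * η + σ with hs_def
  have hi1 := integrable_mul_exp_frequency hk hs σ η
  have hi2 : Integrable fun x : ℝ => (h x : ℂ) * Complex.exp (s * x) := by
    refine (integrableOn_iff_integrable_of_support_subset (s := Set.Ioi R) fun x hx => ?_).1
      (Integrable.mono' ((integrableOn_exp_mul_Ioi hσ R).const_mul M)
        (by fun_prop) (.of_forall fun x => ?_))
    · by_contra hc
      exact hx (by simp [hvan x (not_lt.1 hc)])
    · rw [norm_mul, norm_exp_frequency, Complex.norm_real, Real.norm_eq_abs]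
      gcongr
      exact hM x
  have hderiv : ∀ x : ℝ, HasDerivAt (fun x : ℝ => (h x : ℂ) * Complex.exp (s * x))
      ((deriv h x : ℝ) * Complex.exp (s * x) + s * ((h x : ℂ) * Complex.exp (s * x))) x := by
    intro x
    have h1 := (hh.differentiable one_ne_zero x).hasDerivAt.ofReal_comp
    have h2 := ((Complex.ofRealCLM.hasDerivAt (x := x)).const_mul s).cexp
    refine (h1.mul h2).congr_deriv ?_
    simp only [Complex.ofRealCLM_apply, Complex.ofReal_one]
    ring
  have hbot : Tendsto (fun x : ℝ => (h x : ℂ) * Complex.exp (s * x)) atBot (𝓝 0) :=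
    tendsto_const_nhds.congr' (by
      filter_upwards [eventually_le_atBot R] with x hx
      simp [hvan x hx])
  have htop : Tendsto (fun x : ℝ => (h x : ℂ) * Complex.exp (s * x)) atTop (𝓝 0) := by
    have h0 : Tendsto (fun x => M * Real.exp (σ * x)) atTop (𝓝 0) := by
      simpa using (Real.tendsto_exp_atBot.comp
        (tendsto_id.const_mul_atTop_of_neg hσ)).const_mul M
    refine squeeze_zero_norm (fun x => ?_) h0
    rw [norm_mul, norm_exp_frequency, Complex.norm_real, Real.norm_eq_abs]
    gcongr
    exact hM x
  have key := integral_of_hasDerivAt_of_tendsto hderiv (hi1.add (hi2.const_mul s)) hbot htop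
  rw [integral_add hi1 (hi2.const_mul s), integral_const_mul, sub_zero] at key
  have hne := add_mul_I_ne_zero hσ.ne η
  have hsI : s = -Complex.I * ((η : ℂ) + σ * Complex.I) := by
    linear_combination hs_def + (σ : ℂ) * Complex.I_mul_I
  rw [← mul_div_assoc, eq_div_iff hne]
  change fourierLaplace (deriv h) σ η + _ = 0 at key
  generalize (∫ x : ℝ, (h x : ℂ) * Complex.exp (s * x)) = W at key ⊢
  rw [hsI] at key
  linear_combination Complex.I * key + (W * ((η : ℂ) + σ * Complex.I)) * Complex.I_mul_I

end Step

noncomputable section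

/-- **Distributional Fourier transform of a cut-off incoming exponential.**
Let `λ > 0`, `R ∈ ℝ`, and let `h₀` be a smooth step function with `h₀ = 0` on `(−∞, R]` and
`h₀ = 1` on `[R+1, ∞)`.  Set `ĥ₀′(ζ) = ∫ h₀′(x) e^{−iζx} dx` and, for `σ < 0`,
`W_σ(ξ) = ∫ h₀(x) e^{−iλx + σx − iξx} dx`.  Then for every Schwartz `g` the limit
`lim_{σ→0⁻} ∫ W_σ g` exists, the principal value
`lim_{ε→0⁺} ∫_{|ξ+λ|>ε} (ĥ₀′(ξ+λ)/(ξ+λ)) g(ξ) dξ` exists, and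
`lim_{σ→0⁻} ∫ W_σ g = π g(−λ) − i · PV`. -/
theorem cutoff_incoming_exponential_fourier_structure
    (lam R : ℝ) (hlam : 0 < lam)
    (h₀ : ℝ → ℝ) (hh₀ : ContDiff ℝ (⊤ : ℕ∞) h₀)
    (hvan : ∀ x : ℝ, x ≤ R → h₀ x = 0) (hone : ∀ x : ℝ, R + 1 ≤ x → h₀ x = 1)
    (g : SchwartzMap ℝ ℂ) :
    ∃ P : ℂ,
      Tendsto
        (fun ε : ℝ => ∫ ξ : ℝ in {ξ : ℝ | ε < |ξ + lam|},
          ((∫ x : ℝ, ((deriv h₀ x : ℝ) : ℂ) * Complex.exp (-Complex.I * (ξ + lam) * x)) /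
              ((ξ : ℂ) + lam)) * g ξ)
        (𝓝[>] 0) (𝓝 P) ∧
      Tendsto
        (fun σ : ℝ => ∫ ξ : ℝ,
          (∫ x : ℝ, (h₀ x : ℂ) *
            Complex.exp (-Complex.I * lam * x + σ * x - Complex.I * ξ * x)) * g ξ)
        (𝓝[<] 0)
        (𝓝 ((Real.pi : ℂ) * g (-lam) - Complex.I * P)) := by
  have hh : ContDiff ℝ 1 h₀ := hh₀.of_le (by exact_mod_cast le_top)
  have hk := hh.continuous_deriv le_rfl
  have hs := hasCompactSupport_deriv_of_step hvan hone
  obtain ⟨G, hG_def⟩ : ∃ G : ℝ → ℝ → ℂ, ∀ σ η,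
      G σ η = fourierLaplace (deriv h₀) σ η * g (η - lam) := ⟨_, fun _ _ => rfl⟩
  set M : ℝ := ∫ x, |deriv h₀ x| * Real.exp |x|
  set L : ℝ := ∫ x, |deriv h₀ x| * (Real.exp |x| * |x|)
  set S : ℝ := SchwartzMap.seminorm ℝ 0 0 g
  set D : ℝ := SchwartzMap.seminorm ℝ 0 0 (SchwartzMap.derivCLM ℝ ℂ g)
  have hM0 : 0 ≤ M := integral_nonneg fun x => by positivity
  have hGc : Continuous (Function.uncurry G) := by
    have hF := continuous_fourierLaplace hk hs
    have hg := g.continuous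
    have hmul := hF.mul (hg.comp (by fun_prop : Continuous fun p : ℝ × ℝ => p.2 - lam))
    exact hmul.congr fun p => (hG_def p.1 p.2).symm
  have hBi : Integrable fun η : ℝ => M * ‖g (η - lam)‖ :=
    ((g.integrable (μ := volume)).comp_sub_right lam).norm.const_mul M
  have hB : ∀ σ ∈ Set.Icc (-1 : ℝ) 0, ∀ η, ‖G σ η‖ ≤ M * ‖g (η - lam)‖ := by
    intro σ hσ η
    rw [hG_def, norm_mul]
    gcongr
    exact norm_fourierLaplace_le hk hs hσ η
  have hC : ∀ σ ∈ Set.Icc (-1 : ℝ) 0, ∀ η, |η| ≤ 1 → ‖G σ η - G σ 0‖ ≤ (L * S + M * D) * |η| := by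
    intro σ hσ η _
    have hsplit : G σ η - G σ 0 =
        (fourierLaplace (deriv h₀) σ η - fourierLaplace (deriv h₀) σ 0) * g (η - lam) +
        fourierLaplace (deriv h₀) σ 0 * (g (η - lam) - g (0 - lam)) := by
      simp only [hG_def]
      ring
    have h1 := norm_fourierLaplace_sub_le hk hs hσ η
    have h2 := norm_fourierLaplace_le hk hs hσ 0
    have h3 : ‖g (η - lam) - g (0 - lam)‖ ≤ D * |η| := by
      simpa using g.norm_sub_le_mul_abs (0 - lam) (η - lam)
    have h4 : ‖g (η - lam)‖ ≤ S := SchwartzMap.norm_le_seminorm ℝ g _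
    rw [hsplit]
    calc _ ≤ (L * |η|) * S + M * (D * |η|) := by
          refine (norm_add_le _ _).trans ?_
          rw [norm_mul, norm_mul]
          gcongr
      _ = _ := by ring
  have h0 : (0 : ℝ) ∈ Set.Icc (-1 : ℝ) 0 := by simp
  refine ⟨∫ η, regularizedQuotient 0 (G 0) η, ?_, ?_⟩
  · have hG0 : Continuous (G 0) := hGc.uncurry_left 0
    refine (tendsto_principalValue hG0 hBi (hB 0 h0) (hC 0 h0)).congr fun ε => ?_
    have hmeas : ∀ c : ℝ, MeasurableSet {η : ℝ | ε < |η + c|} := fun c =>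
      measurableSet_lt measurable_const (by fun_prop)
    have hmeas0 : MeasurableSet {η : ℝ | ε < |η|} := by simpa using hmeas 0
    rw [← integral_indicator hmeas0, ← integral_indicator (hmeas lam),
      ← integral_add_right_eq_self _ lam]
    congr 1
    ext ξ
    simp only [Set.indicator, Set.mem_ofPred_eq, hG_def, fourierLaplace, add_sub_cancel_right,
      Complex.ofReal_add, Complex.ofReal_zero, add_zero]
    split_ifs
    · ring
    · rfl
  · have hlim := (tendsto_integral_div_add_mul_I hGc hBi hB hC).const_mul (-Complex.I)
    have hG00 : G 0 0 = g (-lam) := by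
      simp [hG_def, fourierLaplace_deriv_step_zero hh hvan hone]
    have hval : -Complex.I * ((∫ η, regularizedQuotient 0 (G 0) η) +
        G 0 0 * (Real.pi * Complex.I)) =
        (Real.pi : ℂ) * g (-lam) - Complex.I * ∫ η, regularizedQuotient 0 (G 0) η := by
      rw [hG00]
      linear_combination (-(g (-lam) * (Real.pi : ℂ))) * Complex.I_mul_I
    rw [hval] at hlim
    refine hlim.congr' ?_
    filter_upwards [self_mem_nhdsWithin] with σ hσ
    rw [← integral_const_mul, ← integral_add_right_eq_self _ lam]
    congr 1
    ext ξ
    have hW := integral_step_mul_exp_s5 hh hvan hone hσ (ξ + lam)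
    have hexp : ∀ x : ℝ, Complex.exp (-Complex.I * lam * x + σ * x - Complex.I * ξ * x) =
        Complex.exp ((-Complex.I * ((ξ + lam : ℝ) : ℂ) + σ) * x) := by
      intro x
      congr 1
      push_cast
      ring
    simp only [hexp, hW, hG_def, add_sub_cancel_right]
    ring
end
end
end

section
/- Let v ∈ 𝒮(ℝ; ℂ) and set v̂(ξ₂) = ∫_ℝ v(x₂) e^{−i x₂ ξ₂} dx₂. Let ξ° > 0, ν > 0 and ε > 0 satisfy 2ε < ξ°/√(1 + ν²), and let χ₋ : ℝ → ℝ be smooth with χ₋(t) = 1 for t ≤ ε and χ₋(t) = 0 for t ≥ 2ε. Then for every N ∈ ℕ there is a constant C_N such that for all r ≥ 1 and all unit vectors (ω₁, ω₂) ∈ ℝ² with ω₁ > 0 and |ω₂| ≤ ν ω₁, one has | ∫_ℝ χ₋(ω₁ ξ° + ω₂ ξ₂) v̂(ξ₂) e^{i r ω₂ ξ₂} dξ₂ | ≤ C_N r^{−N}. -/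
open MeasureTheory Filter Topology

noncomputable section

/-- The conic oscillatory integral with cutoff `χ`, amplitude `g` and phase `r ω₂ ξ`. -/
def cutoffOscInt (χ : ℝ → ℂ) (g : SchwartzMap ℝ ℂ) (ξc r ω₁ ω₂ : ℝ) : ℂ :=
  ∫ ξ : ℝ, χ (ω₁ * ξc + ω₂ * ξ) * g ξ * Complex.exp (Complex.I * r * ω₂ * ξ)

/-- A smooth function that is constant near `-∞` and vanishes beyond `b`. -/
structure IsLeftCutoff (b : ℝ) (χ : ℝ → ℂ) : Prop where
  smooth : ContDiff ℝ (⊤ : ℕ∞) χ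
  const_left : ∃ a c, ∀ t < a, χ t = c
  zero_right : ∀ t, b < t → χ t = 0

theorem IsLeftCutoff.deriv {b : ℝ} {χ : ℝ → ℂ} (h : IsLeftCutoff b χ) :
    IsLeftCutoff b (deriv χ) where
  smooth := (contDiff_infty_iff_deriv.1 h.smooth).2
  const_left := by
    obtain ⟨a, c, hc⟩ := h.const_left
    refine ⟨a, 0, fun t ht => ?_⟩
    have : χ =ᶠ[𝓝 t] fun _ => c := by
      filter_upwards [Iio_mem_nhds ht] with s hs using hc s hs
    simpa using this.deriv_eq
  zero_right := fun t ht => by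
    have : χ =ᶠ[𝓝 t] fun _ => 0 := by
      filter_upwards [Ioi_mem_nhds ht] with s hs using h.zero_right s hs
    simpa using this.deriv_eq

theorem IsLeftCutoff.exists_bound {b : ℝ} {χ : ℝ → ℂ} (h : IsLeftCutoff b χ) :
    ∃ K, 0 ≤ K ∧ ∀ t, ‖χ t‖ ≤ K := by
  obtain ⟨a, c, hc⟩ := h.const_left
  obtain ⟨K, hK⟩ := (isCompact_Icc (a := a) (b := b)).exists_bound_of_continuousOn
    h.smooth.continuous.continuousOn
  refine ⟨max ‖c‖ K, (norm_nonneg c).trans (le_max_left _ _), fun t => ?_⟩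
  rcases lt_or_ge t a with ht | ht
  · rw [hc t ht]
    exact le_max_left _ _
  rcases lt_or_ge b t with hb | hb
  · rw [h.zero_right t hb, norm_zero]
    exact (norm_nonneg c).trans (le_max_left _ _)
  · exact (hK t ⟨ht, hb⟩).trans (le_max_right _ _)

theorem norm_exp_I_mul_real (r ω ξ : ℝ) : ‖Complex.exp (Complex.I * r * ω * ξ)‖ = 1 := by
  rw [show Complex.I * r * ω * ξ = ((r * ω * ξ : ℝ) : ℂ) * Complex.I by push_cast; ring]
  exact Complex.norm_exp_ofReal_mul_I _

theorem IsLeftCutoff.integrable {b : ℝ} {χ : ℝ → ℂ} (h : IsLeftCutoff b χ)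
    (g : SchwartzMap ℝ ℂ) (ξc r ω₁ ω₂ : ℝ) :
    Integrable fun ξ : ℝ =>
      χ (ω₁ * ξc + ω₂ * ξ) * g ξ * Complex.exp (Complex.I * r * ω₂ * ξ) := by
  obtain ⟨K, -, hK⟩ := h.exists_bound
  have hχ := h.smooth.continuous
  have hg := g.continuous
  refine Integrable.mono' (g.integrable.norm.const_mul K)
    (Continuous.aestronglyMeasurable (by fun_prop)) (ae_of_all _ fun ξ => ?_)
  rw [norm_mul, norm_mul, norm_exp_I_mul_real, mul_one]
  gcongr
  exact hK _

theorem IsLeftCutoff.integral_by_parts {b : ℝ} {χ : ℝ → ℂ} (h : IsLeftCutoff b χ)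
    (g : SchwartzMap ℝ ℂ) (ξc r ω₁ ω₂ : ℝ) :
    Complex.I * r * ω₂ * cutoffOscInt χ g ξc r ω₁ ω₂ =
      -(ω₂ * cutoffOscInt (_root_.deriv χ) g ξc r ω₁ ω₂ +
        cutoffOscInt χ (SchwartzMap.derivCLM ℂ ℂ g) ξc r ω₁ ω₂) := by
  have i0 := (h.integrable g ξc r ω₁ ω₂).const_mul (Complex.I * r * ω₂)
  have i1 := (h.deriv.integrable g ξc r ω₁ ω₂).const_mul (ω₂ : ℂ)
  have i2 := h.integrable (SchwartzMap.derivCLM ℂ ℂ g) ξc r ω₁ ω₂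
  have i12 := i1.add i2
  simp only [Pi.add_def] at i12
  have hd : ∀ ξ : ℝ, HasDerivAt
      (fun ξ : ℝ => χ (ω₁ * ξc + ω₂ * ξ) * g ξ * Complex.exp (Complex.I * r * ω₂ * ξ))
      (Complex.I * r * ω₂ *
          (χ (ω₁ * ξc + ω₂ * ξ) * g ξ * Complex.exp (Complex.I * r * ω₂ * ξ)) +
        (ω₂ * (_root_.deriv χ (ω₁ * ξc + ω₂ * ξ) * g ξ *
          Complex.exp (Complex.I * r * ω₂ * ξ)) +
        χ (ω₁ * ξc + ω₂ * ξ) * SchwartzMap.derivCLM ℂ ℂ g ξ *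
          Complex.exp (Complex.I * r * ω₂ * ξ))) ξ := by
    intro ξ
    have hl : HasDerivAt (fun ξ : ℝ => ω₁ * ξc + ω₂ * ξ) ω₂ ξ := by
      simpa using ((hasDerivAt_id ξ).const_mul ω₂).const_add (ω₁ * ξc)
    have hχ := (h.smooth.differentiable (by simp) (ω₁ * ξc + ω₂ * ξ)).hasDerivAt.scomp ξ hl
    have hg := (g.differentiableAt (x := ξ)).hasDerivAt
    have he : HasDerivAt (fun ξ : ℝ => Complex.exp (Complex.I * r * ω₂ * ξ))
        (Complex.exp (Complex.I * r * ω₂ * ξ) * (Complex.I * r * ω₂)) ξ := by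
      simpa using (((hasDerivAt_id (ξ : ℂ)).const_mul (Complex.I * r * ω₂)).cexp).comp_ofReal
    refine ((hχ.mul hg).mul he).congr_deriv ?_
    simp [SchwartzMap.derivCLM_apply]
    ring
  have key := integral_eq_zero_of_hasDerivAt_of_integrable hd (i0.add i12)
    (h.integrable g ξc r ω₁ ω₂)
  rw [integral_add i0 i12, integral_add i1 i2, integral_const_mul,
    integral_const_mul] at key
  exact eq_neg_of_add_eq_zero_left key

/-- On the support of a cutoff living left of `b`, the frequency is at least of order
`|ω₂|⁻¹`, uniformly over directions in the cone. -/
theorem le_abs_mul_abs_of_mem_cone {b ξc ν ω₁ ω₂ ξ : ℝ} (hξc : 0 < ξc)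
    (hω : ω₁ ^ 2 + ω₂ ^ 2 = 1) (hω₁ : 0 < ω₁) (hcone : |ω₂| ≤ ν * ω₁)
    (hξ : ω₁ * ξc + ω₂ * ξ ≤ b) : ξc / √(1 + ν ^ 2) - b ≤ |ω₂| * |ξ| := by
  have hs : 0 < √(1 + ν ^ 2) := by positivity
  have h1 : 1 ≤ ω₁ * √(1 + ν ^ 2) := by
    rw [← Real.sqrt_sq hω₁.le, ← Real.sqrt_mul (sq_nonneg _), Real.one_le_sqrt]
    have := pow_le_pow_left₀ (abs_nonneg _) hcone 2
    rw [sq_abs] at this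
    nlinarith
  have h2 : ξc / √(1 + ν ^ 2) ≤ ω₁ * ξc := by
    rw [div_le_iff₀ hs]
    nlinarith
  rw [← abs_mul]
  linarith [neg_abs_le (ω₂ * ξ)]

theorem IsLeftCutoff.exists_bound_pow {b ξc ν : ℝ} (hξc : 0 < ξc)
    (hb : b < ξc / √(1 + ν ^ 2)) (N : ℕ) :
    ∀ (M : ℕ) (χ : ℝ → ℂ), IsLeftCutoff b χ → ∀ g : SchwartzMap ℝ ℂ,
      ∃ C, 0 ≤ C ∧ ∀ r : ℝ, 1 ≤ r → ∀ ω₁ ω₂ : ℝ,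
        ω₁ ^ 2 + ω₂ ^ 2 = 1 → 0 < ω₁ → |ω₂| ≤ ν * ω₁ →
        ‖cutoffOscInt χ g ξc r ω₁ ω₂‖ ≤ C * |ω₂| ^ M / r ^ N := by
  set δ := ξc / √(1 + ν ^ 2) - b
  have hδ0 : 0 < δ := sub_pos.2 hb
  induction N with
  | zero =>
    intro M χ h g
    obtain ⟨K, hK0, hK⟩ := h.exists_bound
    refine ⟨K / δ ^ M * ∫ ξ : ℝ, ‖ξ‖ ^ M * ‖g ξ‖, by positivity, ?_⟩
    intro r _ ω₁ ω₂ hω hω₁ hcone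
    have hint := (g.integrable_pow_mul volume M).const_mul (K / δ ^ M * |ω₂| ^ M)
    rw [pow_zero, div_one, mul_right_comm, ← integral_const_mul]
    refine norm_integral_le_of_norm_le hint (ae_of_all _ fun ξ => ?_)
    rw [norm_mul, norm_mul, norm_exp_I_mul_real, mul_one]
    rcases lt_or_ge b (ω₁ * ξc + ω₂ * ξ) with hlt | hle
    · rw [h.zero_right _ hlt, norm_zero, zero_mul]
      positivity
    · have h1 := le_abs_mul_abs_of_mem_cone hξc hω hω₁ hcone hle
      have h2 : 1 ≤ (|ω₂| * |ξ| / δ) ^ M := one_le_pow₀ ((one_le_div hδ0).2 h1)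
      calc ‖χ (ω₁ * ξc + ω₂ * ξ)‖ * ‖g ξ‖ ≤ K * ‖g ξ‖ := by gcongr; exact hK _
        _ ≤ K * ‖g ξ‖ * (|ω₂| * |ξ| / δ) ^ M := le_mul_of_one_le_right (by positivity) h2
        _ = K / δ ^ M * |ω₂| ^ M * (‖ξ‖ ^ M * ‖g ξ‖) := by
          rw [div_pow, mul_pow, Real.norm_eq_abs]
          ring
  | succ N ih =>
    intro M χ h g
    obtain ⟨C₁, hC₁, h₁⟩ := ih (M + 1) _ h.deriv g
    obtain ⟨C₂, hC₂, h₂⟩ := ih (M + 1) _ h (SchwartzMap.derivCLM ℂ ℂ g)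
    obtain ⟨C₀, -, h₀⟩ := ih 1 _ h g
    refine ⟨C₁ + C₂, by positivity, fun r hr ω₁ ω₂ hω hω₁ hcone => ?_⟩
    have hr0 : 0 < r := by linarith
    rcases eq_or_ne ω₂ 0 with rfl | hne
    · have := h₀ r hr ω₁ 0 hω hω₁ hcone
      rw [abs_zero, pow_one, mul_zero, zero_div] at this
      exact this.trans (by positivity)
    have hω₂ : 0 < |ω₂| := abs_pos.2 hne
    have hω₂1 : |ω₂| ≤ 1 := (sq_le_one_iff_abs_le_one ω₂).1 (by nlinarith)
    have e := congrArg norm (h.integral_by_parts g ξc r ω₁ ω₂)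
    simp only [norm_mul, Complex.norm_I, one_mul, Complex.norm_real, norm_neg,
      Real.norm_eq_abs, abs_of_pos hr0] at e
    have b₁ := h₁ r hr ω₁ ω₂ hω hω₁ hcone
    have b₂ := h₂ r hr ω₁ ω₂ hω hω₁ hcone
    have hle : r * |ω₂| * ‖cutoffOscInt χ g ξc r ω₁ ω₂‖ ≤
        (C₁ + C₂) * |ω₂| ^ (M + 1) / r ^ N := by
      rw [e]
      refine (norm_add_le _ _).trans ?_
      rw [norm_mul, Complex.norm_real, Real.norm_eq_abs, add_mul, add_div]
      exact add_le_add
        ((mul_le_of_le_one_left (norm_nonneg _) hω₂1).trans b₁) b₂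
    have hpos : 0 < r * |ω₂| := by positivity
    refine le_of_mul_le_mul_left (hle.trans_eq ?_) hpos
    field_simp
    ring

/-- The Fourier transform, in the normalization of `oneDimFT`, of a Schwartz function is
Schwartz. -/
theorem exists_schwartzMap_eq_oneDimFT (v : SchwartzMap ℝ ℂ) :
    ∃ g : SchwartzMap ℝ ℂ, ∀ ξ, oneDimFT v ξ = g ξ := by
  have h2π : (2 * Real.pi)⁻¹ ≠ 0 := by positivity
  refine ⟨SchwartzMap.compCLMOfContinuousLinearEquiv ℂ
    (ContinuousLinearEquiv.unitsEquivAut ℝ (Units.mk0 _ h2π)) (FourierTransform.fourier v),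
    fun ξ => ?_⟩
  rw [SchwartzMap.compCLMOfContinuousLinearEquiv_apply, Function.comp_apply,
    SchwartzMap.fourier_coe, Real.fourier_real_eq_integral_exp_smul, oneDimFT]
  refine integral_congr_ae (ae_of_all _ fun x => ?_)
  simp only [smul_eq_mul]
  rw [mul_comm]
  congr 2
  simp
  field_simp

/-- **Rapid decay of the delta-function contribution in Isozaki's condition.**
Let `v` be Schwartz, `ξ° > 0`, `ν > 0`, `ε > 0` with `2ε < ξ°/√(1+ν²)`, and let `χ₋` be a
smooth cutoff with `χ₋ = 1` on `(−∞, ε]` and `χ₋ = 0` on `[2ε, ∞)`. Then for every `N` there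
is `C_N` such that for all `r ≥ 1` and unit vectors `(ω₁, ω₂)` with `ω₁ > 0`, `|ω₂| ≤ νω₁`:
`|∫ χ₋(ω₁ξ° + ω₂ξ₂) v̂(ξ₂) e^{irω₂ξ₂} dξ₂| ≤ C_N r^{−N}`. -/
theorem delta_contribution_rapid_decay
    (v : SchwartzMap ℝ ℂ) (ξc ν ε : ℝ) (hξc : 0 < ξc) (hν : 0 < ν) (hε : 0 < ε)
    (hεν : 2 * ε < ξc / Real.sqrt (1 + ν ^ 2))
    (χ : ℝ → ℝ) (hχ : ContDiff ℝ (⊤ : ℕ∞) χ)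
    (hχ1 : ∀ t : ℝ, t ≤ ε → χ t = 1) (hχ0 : ∀ t : ℝ, 2 * ε ≤ t → χ t = 0) :
    ∀ N : ℕ, ∃ C : ℝ, ∀ r : ℝ, 1 ≤ r → ∀ ω₁ ω₂ : ℝ,
      ω₁ ^ 2 + ω₂ ^ 2 = 1 → 0 < ω₁ → |ω₂| ≤ ν * ω₁ →
      ‖∫ ξ₂ : ℝ, (χ (ω₁ * ξc + ω₂ * ξ₂) : ℂ) * oneDimFT (⇑v) ξ₂ *
          Complex.exp (Complex.I * r * ω₂ * ξ₂)‖ ≤ C / r ^ N := by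
  intro N
  obtain ⟨g, hg⟩ := exists_schwartzMap_eq_oneDimFT v
  have hcut : IsLeftCutoff (2 * ε) fun t => (χ t : ℂ) :=
    ⟨Complex.ofRealCLM.contDiff.comp hχ, ⟨ε, 1, fun t ht => by simp [hχ1 t ht.le]⟩,
      fun t ht => by simp [hχ0 t ht.le]⟩
  obtain ⟨C, -, hC⟩ := IsLeftCutoff.exists_bound_pow hξc hεν N 0 _ hcut g
  refine ⟨C, fun r hr ω₁ ω₂ hω hω₁ hcone => ?_⟩
  simpa only [hg, pow_zero, mul_one, cutoffOscInt] using hC r hr ω₁ ω₂ hω hω₁ hcone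
end
end

section
/- Let v ∈ 𝒮(ℝ; ℂ) and ξ° > 0, and let ψ₊ : ℝ → ℝ be a smooth function with ψ₊(t) = 0 for t ≤ −1 and ψ₊(t) = 1 for t ≥ 1. Let ν > 0 and ε > 0 satisfy 2ε < ξ°/√(1 + ν²), and let χ₋ : ℝ → ℝ be smooth with χ₋(t) = 1 for t ≤ ε and χ₋(t) = 0 for t ≥ 2ε. For σ < 0 and ξ ∈ ℝ² let U_σ(ξ) = ∫_{ℝ²} ψ₊(x₁) e^{iξ° x₁ + σ x₁} v(x₂) e^{−i(x₁ξ₁ + x₂ξ₂)} dx₁ dx₂, and for x ∈ ℝ² with x ≠ 0 let A_σ(x) = ∫_{ℝ²} χ₋(⟨x, ξ⟩/|x|) U_σ(ξ) e^{i⟨x,ξ⟩} dξ. Then: (i) for every σ < 0 and x ≠ 0, the integral defining A_σ(x) converges absolutely; (ii) for every x in the cone C_ν = {x = (x₁, x₂) : x₁ > 0, |x₂| ≤ ν x₁}, the limit A(x) := lim_{σ→0⁻} A_σ(x) exists; and (iii) for every N ∈ ℕ there is a constant C_N such that |A(x)| ≤ C_N |x|^{−N} for all x ∈ C_ν with |x|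 ≥ 1. -/
open MeasureTheory Filter Topology

noncomputable section

/-- The regularized Isozaki test integral
`A_σ(x) = ∫_{ℝ²} χ₋(⟨x,ξ⟩/|x|) U_σ(ξ) e^{i⟨x,ξ⟩} dξ` (with `|x|` the Euclidean norm). -/
def isozakiTest (χ : ℝ → ℝ) (ξc : ℝ) (ψ : ℝ → ℝ) (v : ℝ → ℂ) (σ : ℝ) (x : ℝ × ℝ) : ℂ :=
  ∫ ξ : ℝ × ℝ,
    (χ ((x.1 * ξ.1 + x.2 * ξ.2) / Real.sqrt (x.1 ^ 2 + x.2 ^ 2)) : ℂ) *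
      modeRegFT ξc ψ v σ ξ * Complex.exp (Complex.I * (x.1 * ξ.1 + x.2 * ξ.2))

section

open Set

/-- A smooth function which is constant near `-∞` and near `+∞` has bounded derivatives. -/
lemma exists_bound_iteratedDeriv_of_eventually_const {f : ℝ → ℝ} (hf : ContDiff ℝ (⊤ : ℕ∞) f)
    {a b c d : ℝ} (ha : ∀ t ≤ a, f t = c) (hb : ∀ t, b ≤ t → f t = d) (j : ℕ) :
    ∃ C : ℝ, 0 ≤ C ∧ ∀ t, ‖iteratedDeriv j f t‖ ≤ C := by
  have hcont : Continuous (iteratedDeriv j f) :=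
    hf.continuous_iteratedDeriv j (by exact_mod_cast le_top)
  obtain ⟨K, hK⟩ := (isCompact_Icc (a := a) (b := b)).exists_bound_of_continuousOn
    hcont.continuousOn
  have key : ∀ (e t : ℝ), f =ᶠ[𝓝 t] (fun _ => e) → ‖iteratedDeriv j f t‖ ≤ ‖e‖ := by
    intro e t h
    rw [h.iteratedDeriv_eq, iteratedDeriv_const]
    split_ifs <;> simp
  refine ⟨|K| + ‖c‖ + ‖d‖, by positivity, fun t => ?_⟩
  have h1 := abs_nonneg K
  have h2 := norm_nonneg c
  have h3 := norm_nonneg d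
  rcases lt_or_ge t a with h | h
  · have := key c t (by filter_upwards [Iio_mem_nhds h] with u hu using ha u (le_of_lt hu))
    linarith
  · rcases lt_or_ge b t with h' | h'
    · have := key d t (by filter_upwards [Ioi_mem_nhds h'] with u hu using hb u (le_of_lt hu))
      linarith
    · have := hK t ⟨h, h'⟩
      have := le_abs_self K
      linarith

lemma norm_iteratedDeriv_ofReal {f : ℝ → ℝ} {n : ℕ} {t : ℝ} (hf : ContDiffAt ℝ n f t) :
    ‖iteratedDeriv n (fun s => (f s : ℂ)) t‖ = ‖iteratedDeriv n f t‖ := by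
  rw [← norm_iteratedFDeriv_eq_norm_iteratedDeriv, ← norm_iteratedFDeriv_eq_norm_iteratedDeriv]
  exact Complex.ofRealLI.norm_iteratedFDeriv_comp_left hf le_rfl

lemma contDiff_ofReal_comp {f : ℝ → ℝ} (hf : ContDiff ℝ (⊤ : ℕ∞) f) :
    ContDiff ℝ (⊤ : ℕ∞) (fun t => (f t : ℂ)) :=
  Complex.ofRealCLM.contDiff.comp hf

/-- Repeated integration by parts against an exponential. -/
lemma pow_mul_integral_mul_cexp {f : ℝ → ℂ} (hf : ContDiff ℝ (⊤ : ℕ∞) f) (z : ℂ)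
    (h_int : ∀ j, Integrable (fun t : ℝ => iteratedDeriv j f t * Complex.exp (z * t))) (M : ℕ) :
    z ^ M * ∫ t : ℝ, f t * Complex.exp (z * t) =
      (-1) ^ M * ∫ t : ℝ, iteratedDeriv M f t * Complex.exp (z * t) := by
  induction M with
  | zero => simp
  | succ M ih =>
    have hd : ∀ t : ℝ, HasDerivAt (iteratedDeriv M f) (iteratedDeriv (M + 1) f t) t := by
      intro t
      rw [iteratedDeriv_succ]
      exact ((hf.differentiable_iteratedDeriv M
        (by exact_mod_cast WithTop.coe_lt_top _)) t).hasDerivAt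
    have he : ∀ t : ℝ, HasDerivAt (fun t : ℝ => Complex.exp (z * t))
        (z * Complex.exp (z * t)) t := by
      intro t
      have h1 : HasDerivAt (fun t : ℝ => z * (t : ℂ)) z t := by
        simpa using (Complex.ofRealCLM.hasDerivAt (x := t)).const_mul z
      simpa [mul_comm] using h1.cexp
    have h := integral_mul_deriv_eq_deriv_mul_of_integrable
      (u := iteratedDeriv M f) (v := fun t : ℝ => Complex.exp (z * t))
      (u' := iteratedDeriv (M + 1) f) (v' := fun t : ℝ => z * Complex.exp (z * t))
      (fun t _ => hd t) (fun t _ => he t)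
      (by
        refine ((h_int M).const_mul z).congr (ae_of_all _ fun t => ?_)
        simp only [Pi.mul_apply]; ring)
      (h_int (M + 1)) (h_int M)
    have h' : ∫ t : ℝ, iteratedDeriv M f t * (z * Complex.exp (z * t)) =
        z * ∫ t : ℝ, iteratedDeriv M f t * Complex.exp (z * t) := by
      rw [← integral_const_mul]
      congr 1; ext t; ring
    rw [h'] at h
    calc z ^ (M + 1) * ∫ t : ℝ, f t * Complex.exp (z * t)
        = z * (z ^ M * ∫ t : ℝ, f t * Complex.exp (z * t)) := by ring
      _ = (-1) ^ M * (z * ∫ t : ℝ, iteratedDeriv M f t * Complex.exp (z * t)) := by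
          rw [ih]; ring
      _ = _ := by rw [h]; ring

/-- A bounded continuous function supported in `[-1, ∞)` is integrable against a decaying
exponential. -/
lemma integrable_mul_cexp_of_re_neg {g : ℝ → ℂ} (hg : Continuous g) {C : ℝ}
    (hC : ∀ t, ‖g t‖ ≤ C) (h0 : ∀ t < -1, g t = 0) {z : ℂ} (hz : z.re < 0) :
    Integrable (fun t : ℝ => g t * Complex.exp (z * t)) := by
  have hdom : Integrable (indicator (Ici (-1 : ℝ)) fun t : ℝ => C * Real.exp (z.re * t)) := by
    rw [integrable_indicator_iff measurableSet_Ici]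
    exact ((integrableOn_Ici_iff_integrableOn_Ioi).2 (integrableOn_exp_mul_Ioi hz (-1))).const_mul C
  refine hdom.mono' (by fun_prop) (ae_of_all _ fun t => ?_)
  by_cases ht : t < -1
  · rw [h0 t ht, zero_mul, norm_zero, indicator_of_notMem (by simpa using ht)]
  · rw [indicator_of_mem (by simpa using ht), norm_mul, Complex.norm_exp]
    have : (z * (t : ℂ)).re = z.re * t := by simp
    rw [this]
    gcongr
    exact hC t

lemma integrable_inv_one_add_abs_pow {M : ℕ} (hM : 2 ≤ M) :
    Integrable (fun t : ℝ => ((1 + |t|) ^ M)⁻¹) := by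
  refine integrable_inv_one_add_sq.mono' ?_ (ae_of_all _ fun t => ?_)
  · have : Continuous fun t : ℝ => ((1 + |t|) ^ M)⁻¹ :=
      Continuous.inv₀ (by fun_prop) fun t => by positivity
    exact this.aestronglyMeasurable
  · rw [Real.norm_of_nonneg (by positivity)]
    gcongr
    have h1 : (1 + |t|) ^ 2 ≤ (1 + |t|) ^ M := pow_le_pow_right₀ (by simp) hM
    nlinarith [abs_nonneg t, sq_abs t]

lemma one_add_sq_mul_le_abs_pow {d x : ℝ} (hd : 0 < d) (hx : d ≤ |x|) {n : ℕ} (hn : 2 ≤ n) :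
    (1 + x ^ 2) * d ^ n ≤ (1 + d ^ 2) * |x| ^ n := by
  obtain ⟨k, rfl⟩ := Nat.exists_eq_add_of_le hn
  have h1 : d ^ k ≤ |x| ^ k := pow_le_pow_left₀ hd.le hx k
  have h2 : d ^ 2 ≤ |x| ^ 2 := pow_le_pow_left₀ hd.le hx 2
  have h3 : (1 + x ^ 2) * d ^ 2 ≤ (1 + d ^ 2) * |x| ^ 2 := by
    rw [sq_abs] at h2 ⊢; nlinarith
  calc (1 + x ^ 2) * d ^ (2 + k) = ((1 + x ^ 2) * d ^ 2) * d ^ k := by ring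
    _ ≤ ((1 + d ^ 2) * |x| ^ 2) * |x| ^ k := by gcongr
    _ = _ := by ring

lemma exists_bound_iteratedDeriv_inv_sub_pow (b : ℝ) {d : ℝ} (hd : 0 < d) {M : ℕ} (hM : 2 ≤ M)
    (j : ℕ) : ∃ C : ℝ, 0 ≤ C ∧ ∀ τ : ℝ, d ≤ |τ - b| →
      ‖iteratedDeriv j (fun τ : ℝ => ((τ - b) ^ M)⁻¹) τ‖ ≤ C * (1 + (τ - b) ^ 2)⁻¹ := by
  refine ⟨|∏ i ∈ Finset.range j, (((-(M : ℤ) : ℤ) : ℝ) - i)| * ((1 + d ^ 2) / d ^ (M + j)),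
    by positivity, fun τ hτ => ?_⟩
  have hpos : 0 < |τ - b| := hd.trans_le hτ
  have h1 : (fun τ : ℝ => ((τ - b) ^ M)⁻¹) =
      fun τ : ℝ => (fun y : ℝ => y ^ (-(M : ℤ))) (τ - b) := by
    ext τ; simp
  rw [h1, iteratedDeriv_comp_sub_const j (fun y : ℝ => y ^ (-(M : ℤ))) b]
  simp only [iteratedDeriv_eq_iterate, iter_deriv_zpow, norm_mul, Real.norm_eq_abs, abs_zpow]
  rw [mul_assoc]
  refine mul_le_mul_of_nonneg_left ?_ (abs_nonneg _)
  have h2 : |τ - b| ^ (-(M : ℤ) - (j : ℤ)) = (|τ - b| ^ (M + j))⁻¹ := by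
    rw [← zpow_natCast, ← zpow_neg]; congr 1; push_cast; ring
  rw [h2, inv_eq_one_div, ← div_eq_mul_inv, div_div,
    div_le_div_iff₀ (by positivity) (by positivity)]
  have := one_add_sq_mul_le_abs_pow hd hτ (n := M + j) (by omega)
  nlinarith

lemma contDiffAt_inv_sub_pow {b τ : ℝ} (h : τ ≠ b) (M : ℕ) (n : WithTop ℕ∞) :
    ContDiffAt ℝ n (fun τ : ℝ => ((τ - b) ^ M)⁻¹) τ :=
  ContDiffAt.inv (by fun_prop) (pow_ne_zero _ (sub_ne_zero.2 h))

/-- If `χ (w ·)` vanishes on `[a, ∞)`, it may be divided by a power of `τ - b` with `a < b`. -/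
lemma contDiff_cutoff_mul_inv_pow {χ : ℝ → ℝ} (hχ : ContDiff ℝ (⊤ : ℕ∞) χ) {a b w : ℝ}
    (hab : a < b) (hw : ∀ τ, a ≤ τ → χ (w * τ) = 0) (M : ℕ) :
    ContDiff ℝ (⊤ : ℕ∞) (fun τ : ℝ => χ (w * τ) * ((τ - b) ^ M)⁻¹) := by
  rw [contDiff_iff_contDiffAt]
  intro τ
  rcases lt_or_ge τ b with h | h
  · exact ContDiffAt.mul (by fun_prop) (contDiffAt_inv_sub_pow h.ne M _)
  · have : (fun τ : ℝ => χ (w * τ) * ((τ - b) ^ M)⁻¹) =ᶠ[𝓝 τ] fun _ => 0 := by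
      filter_upwards [Ioi_mem_nhds (hab.trans_le h)] with u hu
      rw [hw u (le_of_lt hu), zero_mul]
    exact contDiffAt_const.congr_of_eventuallyEq this

lemma exists_bound_iteratedDeriv_cutoff_mul_inv_pow {χ : ℝ → ℝ} (hχ : ContDiff ℝ (⊤ : ℕ∞) χ)
    (hB : ∀ j, ∃ C : ℝ, 0 ≤ C ∧ ∀ t, ‖iteratedDeriv j χ t‖ ≤ C) {a b : ℝ} (hab : a < b)
    {M : ℕ} (hM : 2 ≤ M) (j : ℕ) :
    ∃ C : ℝ, 0 ≤ C ∧ ∀ w : ℝ, 0 ≤ w → w ≤ 1 → (∀ τ, a ≤ τ → χ (w * τ) = 0) → ∀ τ : ℝ,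
      ‖iteratedDeriv j (fun τ : ℝ => χ (w * τ) * ((τ - b) ^ M)⁻¹) τ‖ ≤
        C * (1 + (τ - b) ^ 2)⁻¹ := by
  choose Cχ hCχ0 hCχ using hB
  choose Cq hCq0 hCq using
    fun i => exists_bound_iteratedDeriv_inv_sub_pow b (sub_pos.2 hab) hM i
  have hC0 : 0 ≤ ∑ i ∈ Finset.range (j + 1), (j.choose i : ℝ) * Cχ i * Cq (j - i) :=
    Finset.sum_nonneg fun i _ => mul_nonneg (mul_nonneg (by positivity) (hCχ0 _)) (hCq0 _)
  refine ⟨_, hC0, fun w hw0 hw1 hw τ => ?_⟩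
  rcases lt_or_ge a τ with h | h
  · have : (fun τ : ℝ => χ (w * τ) * ((τ - b) ^ M)⁻¹) =ᶠ[𝓝 τ] fun _ => 0 := by
      filter_upwards [Ioi_mem_nhds h] with u hu
      rw [hw u (le_of_lt hu), zero_mul]
    rw [this.iteratedDeriv_eq, iteratedDeriv_const]
    simp only [ite_self, norm_zero]
    positivity
  · have hχw : ContDiff ℝ j (fun τ => χ (w * τ)) :=
      (hχ.of_le (by exact_mod_cast le_top)).comp (by fun_prop)
    have hd : b - a ≤ |τ - b| := by rw [abs_sub_comm]; exact le_trans (by linarith) (le_abs_self _)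
    rw [iteratedDeriv_fun_mul hχw.contDiffAt (contDiffAt_inv_sub_pow (by linarith) M _),
      Finset.sum_mul]
    refine (norm_sum_le _ _).trans (Finset.sum_le_sum fun i _ => ?_)
    rw [norm_mul, norm_mul, mul_assoc _ (Cq _)]
    have h1 : ‖iteratedDeriv i (fun τ => χ (w * τ)) τ‖ ≤ Cχ i := by
      rw [iteratedDeriv_comp_const_mul (hχ.of_le (by exact_mod_cast le_top)), norm_mul, norm_pow,
        Real.norm_of_nonneg hw0]
      calc w ^ i * ‖iteratedDeriv i χ (w * τ)‖ ≤ 1 * Cχ i :=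
            mul_le_mul (pow_le_one₀ hw0 hw1) (hCχ i _) (norm_nonneg _) zero_le_one
        _ = _ := one_mul _
    have h2 : ‖((j.choose i : ℕ) : ℝ)‖ = j.choose i := Real.norm_of_nonneg (by positivity)
    rw [h2]
    exact mul_le_mul (mul_le_mul_of_nonneg_left h1 (by positivity)) (hCq _ _ hd) (norm_nonneg _)
      (mul_nonneg (by positivity) (hCχ0 _))

/-- The derivatives of `t ↦ ψ t * v (s t)` decay like those of a symbol of order `0`, uniformly
for bounded `s`. -/
lemma exists_bound_iteratedDeriv_step_mul_schwartz (v : SchwartzMap ℝ ℂ) {ψ : ℝ → ℝ}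
    (hψ : ContDiff ℝ (⊤ : ℕ∞) ψ) (hψ0 : ∀ t : ℝ, t ≤ -1 → ψ t = 0)
    (hψ1 : ∀ t : ℝ, 1 ≤ t → ψ t = 1) (ν : ℝ) (M : ℕ) :
    ∃ C : ℝ, 0 ≤ C ∧ ∀ s : ℝ, |s| ≤ ν → ∀ t : ℝ,
      ‖iteratedDeriv M (fun t => (ψ t : ℂ) * v (s * t)) t‖ ≤ C * ((1 + |t|) ^ M)⁻¹ := by
  choose Cψ hCψ0 hCψ using exists_bound_iteratedDeriv_of_eventually_const hψ hψ0 hψ1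
  have hvd : ∀ k n, ∃ C : ℝ, 0 ≤ C ∧ ∀ x, |x| ^ k * ‖iteratedDeriv n v x‖ ≤ C := by
    intro k n
    obtain ⟨C, hC, h⟩ := v.decay k n
    exact ⟨C, hC.le, fun x => by simpa [norm_iteratedFDeriv_eq_norm_iteratedDeriv] using h x⟩
  choose Cv hCv0 hCv using hvd
  rcases lt_or_ge ν 0 with hν | hν
  · exact ⟨0, le_rfl, fun s hs => absurd (abs_nonneg s) (by linarith)⟩
  have hvs : ∀ (s : ℝ) (n : ℕ), iteratedDeriv n (fun t => v (s * t)) =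
      fun t => s ^ n • iteratedDeriv n v (s * t) := fun s n =>
    iteratedDeriv_comp_const_smul (v.smooth n) s
  have hS0 : 0 ≤ ∑ i ∈ Finset.range (M + 1),
      (M.choose i : ℝ) * Cψ i * (ν ^ (M - i) * Cv 0 (M - i)) :=
    Finset.sum_nonneg fun i _ => mul_nonneg (mul_nonneg (by positivity) (hCψ0 _))
      (mul_nonneg (by positivity) (hCv0 _ _))
  set S := ∑ i ∈ Finset.range (M + 1), (M.choose i : ℝ) * Cψ i * (ν ^ (M - i) * Cv 0 (M - i))
  refine ⟨2 ^ M * (Cv M M + S), mul_nonneg (by positivity) (add_nonneg (hCv0 _ _) hS0),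
    fun s hs t => ?_⟩
  rw [← div_eq_mul_inv, le_div_iff₀ (by positivity)]
  rcases lt_or_ge 1 t with ht | ht
  · have : (fun t => (ψ t : ℂ) * v (s * t)) =ᶠ[𝓝 t] fun t => v (s * t) := by
      filter_upwards [Ioi_mem_nhds ht] with u hu
      rw [hψ1 u (le_of_lt hu)]; simp
    rw [this.iteratedDeriv_eq, hvs, norm_smul, norm_pow, Real.norm_eq_abs]
    have h1 : (1 + |t|) ^ M ≤ (2 * |t|) ^ M := by
      gcongr; rw [abs_of_pos (by linarith)]; linarith
    calc |s| ^ M * ‖iteratedDeriv M v (s * t)‖ * (1 + |t|) ^ M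
        ≤ |s| ^ M * ‖iteratedDeriv M v (s * t)‖ * (2 * |t|) ^ M := by gcongr
      _ = 2 ^ M * (|s * t| ^ M * ‖iteratedDeriv M v (s * t)‖) := by rw [abs_mul]; ring
      _ ≤ 2 ^ M * (Cv M M + S) := by
          gcongr; exact (hCv M M (s * t)).trans (le_add_of_nonneg_right hS0)
  · rcases lt_or_ge t (-1) with ht' | ht'
    · have : (fun t => (ψ t : ℂ) * v (s * t)) =ᶠ[𝓝 t] fun _ => 0 := by
        filter_upwards [Iio_mem_nhds ht'] with u hu
        rw [hψ0 u (le_of_lt hu)]; simp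
      rw [this.iteratedDeriv_eq, iteratedDeriv_const]
      simp only [ite_self, norm_zero, zero_mul]
      exact mul_nonneg (by positivity) (add_nonneg (hCv0 _ _) hS0)
    · have h1 : (1 + |t|) ^ M ≤ 2 ^ M := by
        gcongr; have := abs_le.2 ⟨ht', ht⟩; linarith
      have h2 : ‖iteratedDeriv M (fun t => (ψ t : ℂ) * v (s * t)) t‖ ≤ S := by
        have hvc : ContDiff ℝ M (fun t => v (s * t)) :=
          (v.smooth M).comp (by fun_prop)
        rw [iteratedDeriv_fun_mul
          ((contDiff_ofReal_comp hψ).of_le (by exact_mod_cast le_top)).contDiffAt hvc.contDiffAt]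
        refine (norm_sum_le _ _).trans (Finset.sum_le_sum fun i _ => ?_)
        rw [norm_mul, norm_mul, hvs, norm_smul, norm_pow, Real.norm_eq_abs,
          norm_iteratedDeriv_ofReal (hψ.of_le (by exact_mod_cast le_top)).contDiffAt]
        have h4 : ‖((M.choose i : ℕ) : ℂ)‖ = M.choose i := by simp
        have h5 : ‖iteratedDeriv (M - i) v (s * t)‖ ≤ Cv 0 (M - i) := by
          simpa using hCv 0 (M - i) (s * t)
        rw [h4]
        have := hCψ0 i
        have := hCv0 0 (M - i)
        gcongr
        exact hCψ i t
      calc _ ≤ S * 2 ^ M := by gcongr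
        _ ≤ 2 ^ M * (Cv M M + S) := by
          rw [mul_comm]; gcongr; exact le_add_of_nonneg_left (hCv0 _ _)

lemma norm_cexp_I_mul_real_mul_real (y t : ℝ) : ‖Complex.exp (Complex.I * y * t)‖ = 1 := by
  rw [Complex.norm_exp]; simp

/-- Rapid decay of the inverse Fourier transform of `χ (w τ) (τ - b)^{-M}`, uniformly in `w`. -/
lemma exists_bound_integral_cutoff_mul_inv_pow {χ : ℝ → ℝ} (hχ : ContDiff ℝ (⊤ : ℕ∞) χ)
    (hB : ∀ j, ∃ C : ℝ, 0 ≤ C ∧ ∀ t, ‖iteratedDeriv j χ t‖ ≤ C) {a b : ℝ} (hab : a < b)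
    {M : ℕ} (hM : 2 ≤ M) :
    ∃ C : ℝ, 0 ≤ C ∧ ∀ w : ℝ, 0 ≤ w → w ≤ 1 → (∀ τ, a ≤ τ → χ (w * τ) = 0) →
      Integrable (fun τ : ℝ => χ (w * τ) * ((τ - b) ^ M)⁻¹) ∧
      ∀ y : ℝ, ‖∫ τ : ℝ, ((χ (w * τ) * ((τ - b) ^ M)⁻¹ : ℝ) : ℂ) *
        Complex.exp (Complex.I * y * τ)‖ ≤ C * ((1 + |y|) ^ M)⁻¹ := by
  choose Cp hCp0 hCp using
    fun j => exists_bound_iteratedDeriv_cutoff_mul_inv_pow hχ hB hab hM j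
  set J : ℝ := ∫ τ : ℝ, (1 + (τ - b) ^ 2)⁻¹ with hJ
  have hJint : Integrable fun τ : ℝ => (1 + (τ - b) ^ 2)⁻¹ :=
    integrable_inv_one_add_sq.comp_sub_right b
  have hJ0 : 0 ≤ J := integral_nonneg fun τ => by positivity
  refine ⟨2 ^ (M - 1) * (Cp 0 * J + Cp M * J),
    mul_nonneg (by positivity) (add_nonneg (mul_nonneg (hCp0 _) hJ0) (mul_nonneg (hCp0 _) hJ0)),
    fun w hw0 hw1 hw => ?_⟩
  have hsm := contDiff_cutoff_mul_inv_pow hχ hab hw M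
  set p : ℝ → ℝ := fun τ => χ (w * τ) * ((τ - b) ^ M)⁻¹ with hp
  have hsmC := contDiff_ofReal_comp hsm
  have hbd : ∀ j τ, ‖iteratedDeriv j (fun τ => (p τ : ℂ)) τ‖ ≤ Cp j * (1 + (τ - b) ^ 2)⁻¹ := by
    intro j τ
    rw [norm_iteratedDeriv_ofReal (hsm.of_le (by exact_mod_cast le_top)).contDiffAt]
    exact hCp j w hw0 hw1 hw τ
  refine ⟨(hJint.const_mul (Cp 0)).mono' hsm.continuous.aestronglyMeasurable
    (ae_of_all _ fun τ => by simpa only [iteratedDeriv_zero] using hCp 0 w hw0 hw1 hw τ),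
    fun y => ?_⟩
  have hbd' : ∀ j (τ : ℝ), ‖iteratedDeriv j (fun τ => (p τ : ℂ)) τ *
      Complex.exp (Complex.I * y * τ)‖ ≤ Cp j * (1 + (τ - b) ^ 2)⁻¹ := by
    intro j τ
    rw [norm_mul, norm_cexp_I_mul_real_mul_real, mul_one]
    exact hbd j τ
  have h_int : ∀ j, Integrable (fun τ : ℝ => iteratedDeriv j (fun τ => (p τ : ℂ)) τ *
      Complex.exp (Complex.I * y * τ)) := by
    intro j
    have hc : Continuous (iteratedDeriv j (fun τ => (p τ : ℂ))) :=
      hsmC.continuous_iteratedDeriv j (by exact_mod_cast le_top)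
    exact (hJint.const_mul (Cp j)).mono' (by fun_prop) (ae_of_all _ (hbd' j))
  have hI : ∀ j, ‖∫ τ : ℝ, iteratedDeriv j (fun τ => (p τ : ℂ)) τ *
      Complex.exp (Complex.I * y * τ)‖ ≤ Cp j * J := by
    intro j
    rw [hJ, ← integral_const_mul]
    exact norm_integral_le_of_norm_le (hJint.const_mul _) (ae_of_all _ (hbd' j))
  have h0 := hI 0
  simp only [iteratedDeriv_zero] at h0
  have h1 := congrArg norm (pow_mul_integral_mul_cexp hsmC (Complex.I * y) h_int M)
  rw [norm_mul, norm_mul, norm_pow, norm_pow, norm_mul, Complex.norm_I, norm_neg, norm_one,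
    one_pow, one_mul, one_mul, Complex.norm_real, Real.norm_eq_abs] at h1
  have h2 := hI M
  rw [← h1] at h2
  rw [← div_eq_mul_inv, le_div_iff₀ (by positivity)]
  have h3 := add_pow_le zero_le_one (abs_nonneg y) M
  rw [one_pow] at h3
  set Y := ‖∫ τ : ℝ, (p τ : ℂ) * Complex.exp (Complex.I * y * τ)‖
  calc Y * (1 + |y|) ^ M ≤ Y * (2 ^ (M - 1) * (1 + |y| ^ M)) := by gcongr
    _ = 2 ^ (M - 1) * (Y + |y| ^ M * Y) := by ring
    _ ≤ _ := by gcongr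

/-- The Fourier transform `∫ v(y) e^{-iyη} dy` on the line. -/
def lineFT (v : ℝ → ℂ) (η : ℝ) : ℂ := ∫ y : ℝ, v y * Complex.exp (-Complex.I * (y * η))

/-- The Fourier transform of `ψ(t) e^{iξ°t + σt}` on the line. -/
def stepFT (ξc : ℝ) (ψ : ℝ → ℝ) (σ η : ℝ) : ℂ :=
  ∫ t : ℝ, (ψ t : ℂ) * Complex.exp ((σ + Complex.I * (ξc - η)) * t)

lemma modeRegFT_eq_mul (ξc : ℝ) (ψ : ℝ → ℝ) (v : ℝ → ℂ) (σ : ℝ) (ξ : ℝ × ℝ) :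
    modeRegFT ξc ψ v σ ξ = stepFT ξc ψ σ ξ.1 * lineFT v ξ.2 := by
  rw [modeRegFT, stepFT, lineFT, ← integral_prod_mul]
  congr 1
  ext x
  have : Complex.exp ((σ + Complex.I * (ξc - ξ.1)) * x.1) *
      Complex.exp (-Complex.I * (x.2 * ξ.2)) = Complex.exp (Complex.I * ξc * x.1 + σ * x.1) *
        Complex.exp (-Complex.I * (x.1 * ξ.1 + x.2 * ξ.2)) := by
    rw [← Complex.exp_add, ← Complex.exp_add]; congr 1; ring
  linear_combination -(ψ x.1 : ℂ) * v x.2 * this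

open FourierTransform in
lemma lineFT_eq_fourier (v : SchwartzMap ℝ ℂ) (η : ℝ) :
    lineFT v η = (𝓕 v : SchwartzMap ℝ ℂ) (η / (2 * Real.pi)) := by
  rw [SchwartzMap.fourier_coe, Real.fourier_real_eq_integral_exp_smul, lineFT]
  congr 1
  ext y
  rw [smul_eq_mul, mul_comm]
  congr 2
  have : (Real.pi : ℂ) ≠ 0 := by exact_mod_cast Real.pi_ne_zero
  push_cast
  field_simp

open FourierTransform in
lemma integrable_lineFT (v : SchwartzMap ℝ ℂ) : Integrable (lineFT v) := by
  have h : Integrable fun η : ℝ => (𝓕 v : SchwartzMap ℝ ℂ) (η / (2 * Real.pi)) :=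
    (𝓕 v : SchwartzMap ℝ ℂ).integrable.comp_div (by positivity)
  exact h.congr (ae_of_all _ fun η => (lineFT_eq_fourier v η).symm)

open FourierTransform in
/-- Fourier inversion on the line. -/
lemma integral_lineFT_mul_cexp (v : SchwartzMap ℝ ℂ) (a : ℝ) :
    ∫ η : ℝ, lineFT v η * Complex.exp (Complex.I * a * η) = 2 * Real.pi * v a := by
  have h1 : ∀ η : ℝ, lineFT v η * Complex.exp (Complex.I * a * η) =
      (fun u : ℝ => (𝓕 v : SchwartzMap ℝ ℂ) u * Complex.exp (2 * Real.pi * Complex.I * a * u))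
        (η / (2 * Real.pi)) := by
    intro η
    have : (Real.pi : ℂ) ≠ 0 := by exact_mod_cast Real.pi_ne_zero
    simp only [lineFT_eq_fourier]
    congr 2
    push_cast
    field_simp
  rw [integral_congr_ae (ae_of_all _ h1), Measure.integral_comp_div (fun u : ℝ =>
    (𝓕 v : SchwartzMap ℝ ℂ) u * Complex.exp (2 * Real.pi * Complex.I * a * u)),
    abs_of_pos (by positivity)]
  have h2 : v a = (𝓕⁻ (𝓕 v : SchwartzMap ℝ ℂ) : SchwartzMap ℝ ℂ) a := by
    rw [fourierInv_fourier_eq]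
  rw [h2, SchwartzMap.fourierInv_coe, Real.fourierInv_eq', Complex.real_smul]
  push_cast
  congr 2
  ext u
  simp only [smul_eq_mul]
  rw [mul_comm]
  congr 2
  simp
  ring

lemma integrable_stepFT (ξc : ℝ) {ψ : ℝ → ℝ} (hψ : ContDiff ℝ (⊤ : ℕ∞) ψ)
    (hψ0 : ∀ t : ℝ, t ≤ -1 → ψ t = 0) (hψ1 : ∀ t : ℝ, 1 ≤ t → ψ t = 1) {σ : ℝ} (hσ : σ < 0) :
    Integrable (stepFT ξc ψ σ) := by
  have hψC := contDiff_ofReal_comp hψ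
  have hcont : ∀ j, Continuous (iteratedDeriv j (fun t => (ψ t : ℂ))) := fun j =>
    hψC.continuous_iteratedDeriv j (by exact_mod_cast le_top)
  have h_int : ∀ (j : ℕ) {z : ℂ}, z.re < 0 →
      Integrable (fun t : ℝ => iteratedDeriv j (fun t => (ψ t : ℂ)) t * Complex.exp (z * t)) := by
    intro j z hz
    obtain ⟨C, -, hC⟩ := exists_bound_iteratedDeriv_of_eventually_const hψ hψ0 hψ1 j
    refine integrable_mul_cexp_of_re_neg (hcont j) (C := C) (fun t => ?_) (fun t ht => ?_) hz
    · rw [norm_iteratedDeriv_ofReal (hψ.of_le (by exact_mod_cast le_top)).contDiffAt]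
      exact hC t
    · have : (fun t => (ψ t : ℂ)) =ᶠ[𝓝 t] fun _ => 0 := by
        filter_upwards [Iio_mem_nhds ht] with u hu
        rw [hψ0 u (le_of_lt hu), Complex.ofReal_zero]
      rw [this.iteratedDeriv_eq, iteratedDeriv_const, ite_self]
  set K : ℝ := ∫ t : ℝ, ‖iteratedDeriv 2 (fun t => (ψ t : ℂ)) t * Complex.exp (σ * t)‖ with hK
  have hdom : Integrable fun η : ℝ => K * (1 + (σ ^ 2)⁻¹) * (1 + (η - ξc) ^ 2)⁻¹ :=
    (integrable_inv_one_add_sq.comp_sub_right ξc).const_mul _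
  have hmeas : AEStronglyMeasurable (stepFT ξc ψ σ) := by
    have hj : Continuous fun q : ℝ × ℝ =>
        (ψ q.2 : ℂ) * Complex.exp ((σ + Complex.I * (ξc - q.1)) * q.2) := by
      have := hψ.continuous
      fun_prop
    exact (hj.stronglyMeasurable.integral_prod_right (ν := volume)).aestronglyMeasurable
  refine hdom.mono' hmeas (ae_of_all _ fun η => ?_)
  have hz : (σ + Complex.I * (ξc - η) : ℂ).re < 0 := by simpa using hσ
  have h1 := congrArg norm
    (pow_mul_integral_mul_cexp hψC (σ + Complex.I * (ξc - η)) (fun j => h_int j hz) 2)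
  have h2 : ‖∫ t : ℝ, iteratedDeriv 2 (fun t => (ψ t : ℂ)) t *
      Complex.exp ((σ + Complex.I * (ξc - η)) * t)‖ ≤ K := by
    refine (norm_integral_le_integral_norm _).trans (le_of_eq ?_)
    rw [hK]
    congr 1; ext t
    simp [Complex.norm_exp]
  have h3 : ‖(σ + Complex.I * (ξc - η) : ℂ)‖ ^ 2 = σ ^ 2 + (η - ξc) ^ 2 := by
    rw [← Complex.normSq_eq_norm_sq, Complex.normSq_apply]; simp; ring
  rw [norm_mul, norm_pow, h3] at h1
  simp only [norm_mul, norm_pow, norm_neg, norm_one, one_pow, one_mul] at h1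
  have hσ2 : 0 < σ ^ 2 := by have := hσ.ne; positivity
  rw [stepFT, ← div_eq_mul_inv, le_div_iff₀ (by positivity)]
  have h4 : 1 + (η - ξc) ^ 2 ≤ (1 + (σ ^ 2)⁻¹) * (σ ^ 2 + (η - ξc) ^ 2) := by
    have : (1 + (σ ^ 2)⁻¹) * (σ ^ 2 + (η - ξc) ^ 2) =
      1 + (η - ξc) ^ 2 + σ ^ 2 + (σ ^ 2)⁻¹ * (η - ξc) ^ 2 := by
      linear_combination inv_mul_cancel₀ hσ2.ne'
    rw [this]
    have : 0 ≤ (σ ^ 2)⁻¹ * (η - ξc) ^ 2 := by positivity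
    linarith
  set Y := ‖∫ t : ℝ, (ψ t : ℂ) * Complex.exp ((σ + Complex.I * (ξc - η)) * t)‖
  calc Y * (1 + (η - ξc) ^ 2) ≤ Y * ((1 + (σ ^ 2)⁻¹) * (σ ^ 2 + (η - ξc) ^ 2)) := by gcongr
    _ = (1 + (σ ^ 2)⁻¹) * ((σ ^ 2 + (η - ξc) ^ 2) * Y) := by ring
    _ ≤ (1 + (σ ^ 2)⁻¹) * K := by gcongr; exact h1.trans_le h2
    _ = _ := by ring

/-- Fubini in sheared coordinates. -/
lemma integral_shear_mul {F V G : ℝ → ℂ} (hF : Integrable F) (hV : Integrable V)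
    (hG : Continuous G) {C : ℝ} (hC : ∀ τ, ‖G τ‖ ≤ C) (s : ℝ) :
    ∫ ξ : ℝ × ℝ, G (ξ.1 + s * ξ.2) * (F ξ.1 * V ξ.2) =
      ∫ τ : ℝ, G τ * ∫ η : ℝ, F (τ - s * η) * V η := by
  have h_int : Integrable (fun ξ : ℝ × ℝ => G (ξ.1 + s * ξ.2) * (F ξ.1 * V ξ.2))
      (volume.prod volume) :=
    (hF.mul_prod hV).bdd_mul (Continuous.aestronglyMeasurable (by fun_prop))
      (ae_of_all _ fun ξ => hC _)
  have hmp : MeasurePreserving (fun p : ℝ × ℝ => (p.1, p.2 - s * p.1))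
      (volume.prod volume) (volume.prod volume) :=
    (MeasurePreserving.id volume).skew_product (g := fun η τ : ℝ => τ - s * η)
      (by fun_prop) (ae_of_all _ fun η => (measurePreserving_sub_right volume (s * η)).map_eq)
  have hint2 := hmp.integrable_comp_of_integrable h_int.swap
  have e1 : ∀ τ : ℝ, G τ * ∫ η : ℝ, F (τ - s * η) * V η =
      ∫ η : ℝ, G τ * (F (τ - s * η) * V η) := fun τ => (integral_const_mul _ _).symm
  simp_rw [e1]
  rw [← integral_integral_swap (f := fun η τ : ℝ => G τ * (F (τ - s * η) * V η))]
  · have e2 : ∀ η : ℝ, ∫ τ : ℝ, G τ * (F (τ - s * η) * V η) =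
        ∫ τ : ℝ, G (τ + s * η) * (F τ * V η) := by
      intro η
      rw [← integral_sub_right_eq_self (fun τ : ℝ => G (τ + s * η) * (F τ * V η)) (s * η)]
      simp
    simp_rw [e2]
    exact integral_prod_symm _ h_int
  · refine hint2.congr (ae_of_all _ fun p => ?_)
    simp [Function.uncurry]

lemma integral_stepFT_shear_mul_lineFT (v : SchwartzMap ℝ ℂ) (ξc : ℝ) {ψ : ℝ → ℝ}
    (hψ : ContDiff ℝ (⊤ : ℕ∞) ψ)
    (hψ0 : ∀ t : ℝ, t ≤ -1 → ψ t = 0) (hψ1 : ∀ t : ℝ, 1 ≤ t → ψ t = 1) {σ : ℝ} (hσ : σ < 0)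
    (s τ : ℝ) :
    ∫ η : ℝ, stepFT ξc ψ σ (τ - s * η) * lineFT v η =
      2 * Real.pi * ∫ t : ℝ, (ψ t : ℂ) * v (s * t) *
        Complex.exp ((σ + Complex.I * (ξc - τ)) * t) := by
  set E : ℝ → ℂ := fun t => (ψ t : ℂ) * Complex.exp ((σ + Complex.I * (ξc - τ)) * t) with hE
  have hEint : Integrable E := by
    obtain ⟨C, -, hC⟩ := exists_bound_iteratedDeriv_of_eventually_const hψ hψ0 hψ1 0
    refine integrable_mul_cexp_of_re_neg (contDiff_ofReal_comp hψ).continuous (C := C)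
      (fun t => by simpa using hC t) (fun t ht => by simp [hψ0 t ht.le]) (by simpa using hσ)
  have h_int : Integrable (Function.uncurry fun η t : ℝ =>
      Complex.exp (Complex.I * (s * t : ℝ) * η) * (lineFT v η * E t)) (volume.prod volume) :=
    ((integrable_lineFT v).mul_prod hEint).bdd_mul (c := 1)
      (f := fun q : ℝ × ℝ => Complex.exp (Complex.I * (s * q.2 : ℝ) * q.1))
      (Continuous.aestronglyMeasurable (by fun_prop))
      (ae_of_all _ fun q => (norm_cexp_I_mul_real_mul_real _ _).le)
  have e1 : ∀ η : ℝ, stepFT ξc ψ σ (τ - s * η) * lineFT v η =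
      ∫ t : ℝ, Complex.exp (Complex.I * (s * t : ℝ) * η) * (lineFT v η * E t) := by
    intro η
    rw [stepFT, ← integral_mul_const]
    congr 1; ext t
    have : Complex.exp ((σ + Complex.I * (ξc - (τ - s * η : ℝ))) * t) =
        Complex.exp (Complex.I * (s * t : ℝ) * η) *
          Complex.exp ((σ + Complex.I * (ξc - τ)) * t) := by
      rw [← Complex.exp_add]; congr 1; push_cast; ring
    rw [this, hE]; ring
  simp_rw [e1]
  rw [integral_integral_swap h_int, ← integral_const_mul]
  congr 1; ext t
  have e2 : ∀ η : ℝ, Complex.exp (Complex.I * (s * t : ℝ) * η) * (lineFT v η * E t) =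
      (lineFT v η * Complex.exp (Complex.I * (s * t : ℝ) * η)) * E t := fun η => by ring
  simp_rw [e2]
  rw [integral_mul_const, integral_lineFT_mul_cexp, hE]
  ring

/-- The regularized test integral reduces to a one-dimensional one along the ray through `x`. -/
lemma isozakiTest_eq_integral (v : SchwartzMap ℝ ℂ) (ξc : ℝ) {ψ : ℝ → ℝ}
    (hψ : ContDiff ℝ (⊤ : ℕ∞) ψ)
    (hψ0 : ∀ t : ℝ, t ≤ -1 → ψ t = 0) (hψ1 : ∀ t : ℝ, 1 ≤ t → ψ t = 1) {χ : ℝ → ℝ}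
    (hχ : Continuous χ) {C : ℝ} (hC : ∀ t, ‖χ t‖ ≤ C) {σ : ℝ} (hσ : σ < 0) {x : ℝ × ℝ}
    (hx : 0 < x.1) :
    isozakiTest χ ξc ψ v σ x =
      ∫ τ : ℝ, (χ (x.1 / Real.sqrt (x.1 ^ 2 + x.2 ^ 2) * τ) : ℂ) *
        Complex.exp (Complex.I * x.1 * τ) * (2 * Real.pi * ∫ t : ℝ,
          (ψ t : ℂ) * v (x.2 / x.1 * t) * Complex.exp ((σ + Complex.I * (ξc - τ)) * t)) := by
  set r := Real.sqrt (x.1 ^ 2 + x.2 ^ 2) with hr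
  have hG : Continuous fun τ : ℝ =>
      (χ (x.1 / r * τ) : ℂ) * Complex.exp (Complex.I * x.1 * τ) := by fun_prop
  have hGC : ∀ τ : ℝ, ‖(χ (x.1 / r * τ) : ℂ) * Complex.exp (Complex.I * x.1 * τ)‖ ≤ C := by
    intro τ
    rw [norm_mul, norm_cexp_I_mul_real_mul_real, mul_one, Complex.norm_real]
    exact hC _
  have h := integral_shear_mul (integrable_stepFT ξc hψ hψ0 hψ1 hσ) (integrable_lineFT v) hG hGC
    (x.2 / x.1)
  simp_rw [integral_stepFT_shear_mul_lineFT v ξc hψ hψ0 hψ1 hσ] at h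
  rw [← h, isozakiTest]
  congr 1; ext ξ
  have h1 : (x.1 * ξ.1 + x.2 * ξ.2) / r = x.1 / r * (ξ.1 + x.2 / x.1 * ξ.2) := by
    have := hx.ne'
    field_simp
  have h2 : Complex.I * (x.1 * ξ.1 + x.2 * ξ.2) =
      Complex.I * x.1 * ((ξ.1 + x.2 / x.1 * ξ.2 : ℝ) : ℂ) := by
    have : (x.1 : ℂ) ≠ 0 := by exact_mod_cast hx.ne'
    push_cast
    field_simp
  rw [modeRegFT_eq_mul, ← hr, h1, h2]
  ring

/-- Integration by parts turns the symbol `ψ(t) v(st)` into its `M`-th derivative. -/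
lemma integral_step_mul_schwartz_eq (v : SchwartzMap ℝ ℂ) {ψ : ℝ → ℝ}
    (hψ : ContDiff ℝ (⊤ : ℕ∞) ψ)
    (hψ0 : ∀ t : ℝ, t ≤ -1 → ψ t = 0) (hψ1 : ∀ t : ℝ, 1 ≤ t → ψ t = 1) (s : ℝ) {z : ℂ}
    (hz : z.re < 0) (M : ℕ) :
    ∫ t : ℝ, (ψ t : ℂ) * v (s * t) * Complex.exp (z * t) =
      ((-z) ^ M)⁻¹ * ∫ t : ℝ, iteratedDeriv M (fun t => (ψ t : ℂ) * v (s * t)) t *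
        Complex.exp (z * t) := by
  have hsm : ContDiff ℝ (⊤ : ℕ∞) fun t => (ψ t : ℂ) * v (s * t) :=
    (contDiff_ofReal_comp hψ).mul ((v.smooth ⊤).comp (by fun_prop))
  have h_int : ∀ j, Integrable fun t : ℝ =>
      iteratedDeriv j (fun t => (ψ t : ℂ) * v (s * t)) t * Complex.exp (z * t) := by
    intro j
    obtain ⟨C, hC0, hC⟩ := exists_bound_iteratedDeriv_step_mul_schwartz v hψ hψ0 hψ1 |s| j
    refine integrable_mul_cexp_of_re_neg (C := C)
      (hsm.continuous_iteratedDeriv j (by exact_mod_cast le_top)) (fun t => ?_) (fun t ht => ?_) hz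
    · refine (hC s le_rfl t).trans (mul_le_of_le_one_right hC0 (inv_le_one_of_one_le₀ ?_))
      exact one_le_pow₀ (by simp)
    · have : (fun t => (ψ t : ℂ) * v (s * t)) =ᶠ[𝓝 t] fun _ => 0 := by
        filter_upwards [Iio_mem_nhds ht] with u hu
        rw [hψ0 u (le_of_lt hu), Complex.ofReal_zero, zero_mul]
      rw [this.iteratedDeriv_eq, iteratedDeriv_const, ite_self]
  have hz0 : z ≠ 0 := by rintro rfl; simp at hz
  have h := pow_mul_integral_mul_cexp hsm z h_int M
  have h1 : ((-1 : ℂ) ^ M) * (-1) ^ M = 1 := by rw [← mul_pow]; simp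
  rw [eq_inv_mul_iff_mul_eq₀ (pow_ne_zero _ (neg_ne_zero.2 hz0)), neg_pow, mul_assoc, h,
    ← mul_assoc, h1, one_mul]

lemma norm_integral_prod_le_of_decay {c : ℂ} (hc : ‖c‖ = 1) {g h : ℝ → ℂ} {p : ℝ → ℝ} {N : ℕ}
    {Cg Cp : ℝ} (hg : ∀ t, ‖g t‖ ≤ Cg * ((1 + |t|) ^ (N + 2))⁻¹) (hh : ∀ t, ‖h t‖ = 1)
    (hgm : AEStronglyMeasurable g) (hhm : AEStronglyMeasurable h) (hp : Integrable p)
    (hpk : ∀ y : ℝ, ‖∫ τ : ℝ, (p τ : ℂ) * Complex.exp (Complex.I * y * τ)‖ ≤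
      Cp * ((1 + |y|) ^ (N + 2))⁻¹) (hCg : 0 ≤ Cg) (hCp : 0 ≤ Cp) (X : ℝ) :
    ‖∫ q : ℝ × ℝ, c * (g q.2 * h q.2) *
        (p q.1 * Complex.exp (Complex.I * (X - q.2 : ℝ) * q.1))‖ ≤
      Cg * Cp * (∫ t : ℝ, ((1 + |t|) ^ 2)⁻¹) * ((1 + |X|) ^ N)⁻¹ := by
  have hgh : Integrable fun t => g t * h t := by
    refine ((integrable_inv_one_add_abs_pow (M := N + 2) (by omega)).const_mul Cg).mono'
      (hgm.mul hhm) (ae_of_all _ fun t => ?_)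
    rw [norm_mul, hh, mul_one]
    exact hg t
  have h_int : Integrable (fun q : ℝ × ℝ => c * (g q.2 * h q.2) *
      (p q.1 * Complex.exp (Complex.I * (X - q.2 : ℝ) * q.1))) (volume.prod volume) := by
    have hpC : Integrable fun τ : ℝ => (p τ : ℂ) := hp.ofReal
    refine (hpC.mul_prod hgh).bdd_mul (c := 1)
      (f := fun q : ℝ × ℝ => c * Complex.exp (Complex.I * (X - q.2 : ℝ) * q.1))
      (Continuous.aestronglyMeasurable (by fun_prop)) (ae_of_all _ fun q => ?_) |>.congr
      (ae_of_all _ fun q => ?_)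
    · rw [norm_mul, hc, norm_cexp_I_mul_real_mul_real, one_mul]
    · ring
  have e : ∫ q : ℝ × ℝ, c * (g q.2 * h q.2) *
      (p q.1 * Complex.exp (Complex.I * (X - q.2 : ℝ) * q.1)) =
      ∫ t : ℝ, c * (g t * h t) *
        ∫ τ : ℝ, (p τ : ℂ) * Complex.exp (Complex.I * (X - t : ℝ) * τ) := by
    refine (integral_prod_symm _ h_int).trans ?_
    congr 1; ext t
    exact integral_const_mul (c * (g t * h t)) _
  rw [e]
  have hb : ∀ t : ℝ, ‖c * (g t * h t) *
      ∫ τ : ℝ, (p τ : ℂ) * Complex.exp (Complex.I * (X - t : ℝ) * τ)‖ ≤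
      Cg * Cp * ((1 + |X|) ^ N)⁻¹ * ((1 + |t|) ^ 2)⁻¹ := by
    intro t
    rw [norm_mul, norm_mul, norm_mul, hc, hh, one_mul, mul_one]
    refine (mul_le_mul (hg t) (hpk (X - t)) (norm_nonneg _) (by positivity)).trans ?_
    have h1 : 1 + |X| ≤ (1 + |t|) * (1 + |X - t|) := by
      have : |X| ≤ |t| + |X - t| := by simpa using abs_add_le t (X - t)
      nlinarith [mul_nonneg (abs_nonneg t) (abs_nonneg (X - t))]
    have h2 : (1 + |X|) ^ N * (1 + |t|) ^ 2 ≤ (1 + |t|) ^ (N + 2) * (1 + |X - t|) ^ (N + 2) := by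
      calc (1 + |X|) ^ N * (1 + |t|) ^ 2
          ≤ ((1 + |t|) * (1 + |X - t|)) ^ N * (1 + |t|) ^ 2 := by gcongr
        _ = (1 + |t|) ^ (N + 2) * (1 + |X - t|) ^ N := by rw [mul_pow]; ring
        _ ≤ _ := by gcongr <;> simp
    have h3 := inv_anti₀ (by positivity) h2
    rw [mul_inv, mul_inv] at h3
    calc _ = Cg * Cp * (((1 + |t|) ^ (N + 2))⁻¹ * ((1 + |X - t|) ^ (N + 2))⁻¹) := by ring
      _ ≤ Cg * Cp * (((1 + |X|) ^ N)⁻¹ * ((1 + |t|) ^ 2)⁻¹) := by gcongr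
      _ = _ := by ring
  calc _ ≤ ∫ t : ℝ, Cg * Cp * ((1 + |X|) ^ N)⁻¹ * ((1 + |t|) ^ 2)⁻¹ :=
        norm_integral_le_of_norm_le ((integrable_inv_one_add_abs_pow le_rfl).const_mul _)
          (ae_of_all _ hb)
    _ = _ := by rw [integral_const_mul]; ring

/-- The limit of the regularized test integrals, as an absolutely convergent double integral
after `M` integrations by parts. -/
lemma tendsto_isozakiTest (v : SchwartzMap ℝ ℂ) (ξc : ℝ) {ψ : ℝ → ℝ}
    (hψ : ContDiff ℝ (⊤ : ℕ∞) ψ)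
    (hψ0 : ∀ t : ℝ, t ≤ -1 → ψ t = 0) (hψ1 : ∀ t : ℝ, 1 ≤ t → ψ t = 1) {χ : ℝ → ℝ}
    (hχ : Continuous χ) {C : ℝ} (hC : ∀ t, ‖χ t‖ ≤ C) {M : ℕ} (hM : 2 ≤ M) {x : ℝ × ℝ}
    (hx : 0 < x.1) (hχξ : χ (x.1 / Real.sqrt (x.1 ^ 2 + x.2 ^ 2) * ξc) = 0)
    (hp : Integrable fun τ : ℝ =>
      χ (x.1 / Real.sqrt (x.1 ^ 2 + x.2 ^ 2) * τ) * ((τ - ξc) ^ M)⁻¹) :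
    Tendsto (fun σ : ℝ => isozakiTest χ ξc ψ v σ x) (𝓝[<] 0)
      (𝓝 (2 * Real.pi * ∫ q : ℝ × ℝ, (Complex.I ^ M)⁻¹ *
        (iteratedDeriv M (fun t => (ψ t : ℂ) * v (x.2 / x.1 * t)) q.2 *
          Complex.exp (Complex.I * ξc * q.2)) *
        ((χ (x.1 / Real.sqrt (x.1 ^ 2 + x.2 ^ 2) * q.1) * ((q.1 - ξc) ^ M)⁻¹ : ℝ) *
          Complex.exp (Complex.I * (x.1 - q.2 : ℝ) * q.1)))) := by
  set w := x.1 / Real.sqrt (x.1 ^ 2 + x.2 ^ 2) with hw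
  set s := x.2 / x.1 with hs
  set g := iteratedDeriv M (fun t => (ψ t : ℂ) * v (s * t)) with hg
  have hsm : ContDiff ℝ (⊤ : ℕ∞) fun t => (ψ t : ℂ) * v (s * t) :=
    (contDiff_ofReal_comp hψ).mul ((v.smooth ⊤).comp (by fun_prop))
  have hgc : Continuous g := hsm.continuous_iteratedDeriv M (by exact_mod_cast le_top)
  obtain ⟨Cg, hCg0, hCg⟩ := exists_bound_iteratedDeriv_step_mul_schwartz v hψ hψ0 hψ1 |s| M
  have hg0 : ∀ t < -1, g t = 0 := by
    intro t ht
    have : (fun t => (ψ t : ℂ) * v (s * t)) =ᶠ[𝓝 t] fun _ => 0 := by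
      filter_upwards [Iio_mem_nhds ht] with u hu
      rw [hψ0 u (le_of_lt hu), Complex.ofReal_zero, zero_mul]
    rw [hg, this.iteratedDeriv_eq, iteratedDeriv_const, ite_self]
  set H : ℝ → ℝ × ℝ → ℂ := fun σ q =>
    (χ (w * q.1) : ℂ) * Complex.exp (Complex.I * x.1 * q.1) *
      (((-(σ + Complex.I * (ξc - q.1))) ^ M)⁻¹ *
        (g q.2 * Complex.exp ((σ + Complex.I * (ξc - q.1)) * q.2))) with hH
  have hdom : Integrable (fun q : ℝ × ℝ => |χ (w * q.1) * ((q.1 - ξc) ^ M)⁻¹| *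
      (Cg * ((1 + |q.2|) ^ M)⁻¹ * Real.exp 1)) (volume.prod volume) :=
    hp.abs.mul_prod (((integrable_inv_one_add_abs_pow hM).const_mul Cg).mul_const _)
  have hz0 : ∀ {σ : ℝ}, σ < 0 → ∀ τ : ℝ, (-(σ + Complex.I * (ξc - τ)) : ℂ) ≠ 0 := by
    intro σ hσ τ h0
    have := congrArg Complex.re h0
    simp at this
    exact hσ.ne this
  have hHm : ∀ {σ : ℝ}, σ < 0 → AEStronglyMeasurable (H σ) (volume.prod volume) := by
    intro σ hσ
    have h1 : Continuous fun q : ℝ × ℝ => ((-(σ + Complex.I * (ξc - q.1)) : ℂ) ^ M)⁻¹ :=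
      Continuous.inv₀ (by fun_prop) fun q => pow_ne_zero _ (hz0 hσ q.1)
    refine Continuous.aestronglyMeasurable ?_
    simp only [hH]
    fun_prop
  have hHb : ∀ {σ : ℝ}, σ < 0 → -1 < σ → ∀ q : ℝ × ℝ, ‖H σ q‖ ≤
      |χ (w * q.1) * ((q.1 - ξc) ^ M)⁻¹| * (Cg * ((1 + |q.2|) ^ M)⁻¹ * Real.exp 1) := by
    intro σ hσ hσ1 q
    by_cases hq : q.1 = ξc
    · simp [hH, hq, hχξ]
    rw [abs_mul, abs_inv, abs_pow]
    simp only [hH, norm_mul, norm_cexp_I_mul_real_mul_real, mul_one, norm_inv, norm_pow, norm_neg,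
      Complex.norm_real, Real.norm_eq_abs]
    rw [mul_assoc |χ (w * q.1)|]
    have hpos : 0 < |q.1 - ξc| := abs_pos.2 (sub_ne_zero.2 hq)
    have h1 : |q.1 - ξc| ≤ ‖(σ + Complex.I * (ξc - q.1) : ℂ)‖ := by
      have := Complex.abs_im_le_norm (σ + Complex.I * (ξc - q.1) : ℂ)
      rw [abs_sub_comm]
      simpa using this
    have h2 : ‖g q.2‖ * ‖Complex.exp ((σ + Complex.I * (ξc - q.1)) * q.2)‖ ≤
        Cg * ((1 + |q.2|) ^ M)⁻¹ * Real.exp 1 := by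
      rcases lt_or_ge q.2 (-1) with ht | ht
      · rw [hg0 _ ht, norm_zero, zero_mul]; positivity
      · refine mul_le_mul (hCg s le_rfl _) ?_ (norm_nonneg _) (by positivity)
        rw [Complex.norm_exp]
        refine Real.exp_le_exp.2 ?_
        have : ((σ + Complex.I * (ξc - q.1)) * q.2 : ℂ).re = σ * q.2 := by simp
        rw [this]
        nlinarith
    exact mul_le_mul_of_nonneg_left (mul_le_mul (inv_anti₀ (by positivity)
      (pow_le_pow_left₀ hpos.le h1 M)) h2 (by positivity) (by positivity)) (abs_nonneg _)
  have hHint : ∀ {σ : ℝ}, σ < 0 → -1 < σ → Integrable (H σ) (volume.prod volume) :=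
    fun hσ hσ1 => hdom.mono' (hHm hσ) (ae_of_all _ (hHb hσ hσ1))
  have hev : ∀ᶠ σ : ℝ in 𝓝[<] 0, σ < 0 ∧ -1 < σ :=
    (eventually_mem_nhdsWithin (s := Iio (0 : ℝ))).and
      (eventually_nhdsWithin_of_eventually_nhds (Ioi_mem_nhds (by norm_num)))
  have heq : ∀ {σ : ℝ}, σ < 0 → -1 < σ →
      2 * Real.pi * ∫ q : ℝ × ℝ, H σ q = isozakiTest χ ξc ψ v σ x := by
    intro σ hσ hσ1
    rw [isozakiTest_eq_integral v ξc hψ hψ0 hψ1 hχ hC hσ hx, ← integral_const_mul]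
    have e := integral_prod (μ := volume) (ν := volume) _
      ((hHint hσ hσ1).const_mul (2 * Real.pi : ℂ))
    refine e.trans ?_
    congr 1; ext τ
    rw [integral_step_mul_schwartz_eq v hψ hψ0 hψ1 _ (by simpa using hσ) M]
    simp only [hH]
    rw [integral_const_mul, integral_const_mul, integral_const_mul]
    ring
  refine Tendsto.congr' (hev.mono fun σ h => heq h.1 h.2) ?_
  refine Tendsto.const_mul _ ?_
  refine tendsto_integral_filter_of_dominated_convergence _ (hev.mono fun σ h => hHm h.1)
    (hev.mono fun σ h => ae_of_all _ (hHb h.1 h.2)) hdom (ae_of_all _ fun q => ?_)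
  by_cases hq : q.1 = ξc
  · simp [hH, hq, hχξ]
  · have hne : (-(((0 : ℝ) : ℂ) + Complex.I * (ξc - q.1)) : ℂ) ≠ 0 := by
      have : (ξc : ℂ) - q.1 ≠ 0 := sub_ne_zero.2 (by exact_mod_cast Ne.symm hq)
      simpa using this
    have hc : ContinuousAt (fun σ : ℝ => H σ q) 0 := by
      simp only [hH]
      refine ContinuousAt.mul continuousAt_const (ContinuousAt.mul ?_ ?_)
      · exact ContinuousAt.inv₀ (by fun_prop) (pow_ne_zero _ hne)
      · fun_prop
    have h0 : H 0 q = (Complex.I ^ M)⁻¹ * (g q.2 * Complex.exp (Complex.I * ξc * q.2)) *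
        ((χ (w * q.1) * ((q.1 - ξc) ^ M)⁻¹ : ℝ) *
          Complex.exp (Complex.I * (x.1 - q.2 : ℝ) * q.1)) := by
      have e1 : (-(((0 : ℝ) : ℂ) + Complex.I * (ξc - q.1)) : ℂ) ^ M =
          Complex.I ^ M * (q.1 - ξc : ℂ) ^ M := by
        rw [← mul_pow]; congr 1; push_cast; ring
      have e2 : Complex.exp (Complex.I * x.1 * q.1) *
          Complex.exp ((((0 : ℝ) : ℂ) + Complex.I * (ξc - q.1)) * q.2) =
          Complex.exp (Complex.I * ξc * q.2) *
            Complex.exp (Complex.I * (x.1 - q.2 : ℝ) * q.1) := by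
        rw [← Complex.exp_add, ← Complex.exp_add]; congr 1; push_cast; ring
      simp only [hH]
      rw [e1, mul_inv]
      push_cast at e2 ⊢
      linear_combination ((χ (w * q.1) : ℂ) * (Complex.I ^ M)⁻¹ * ((q.1 - ξc : ℂ) ^ M)⁻¹ *
        g q.2) * e2
    rw [← h0]
    exact hc.tendsto.mono_left nhdsWithin_le_nhds

lemma sqrt_sq_add_sq_le_of_mem_cone {ν : ℝ} {x : ℝ × ℝ} (hx : 0 < x.1)
    (hxν : |x.2| ≤ ν * x.1) :
    Real.sqrt (x.1 ^ 2 + x.2 ^ 2) ≤ Real.sqrt (1 + ν ^ 2) * x.1 := by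
  rw [Real.sqrt_le_left (by positivity), mul_pow, Real.sq_sqrt (by positivity)]
  have : |x.2| ^ 2 ≤ (ν * x.1) ^ 2 := pow_le_pow_left₀ (abs_nonneg _) hxν 2
  rw [sq_abs] at this
  linarith

end

/-- **A wave-guide mode with `ξ° > 0` satisfies Isozaki's outgoing radiation condition as
`x₁ → +∞`.**  With `v` Schwartz, `ψ₊` a smooth step function, `2ε < ξ°/√(1+ν²)`, and `χ₋` a
smooth cutoff equal to `1` on `(−∞, ε]` and `0` on `[2ε, ∞)`: (i) the integral `A_σ(x)`
converges absolutely for all `σ < 0`, `x ≠ 0`; (ii) for `x` in the cone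
`C_ν = {x₁ > 0, |x₂| ≤ νx₁}` the limit `A(x) = lim_{σ→0⁻} A_σ(x)` exists; and (iii) for each
`N` there is `C_N` with `|A(x)| ≤ C_N |x|^{−N}` on `C_ν ∩ {|x| ≥ 1}`. -/
theorem mode_satisfies_isozaki_outgoing
    (v : SchwartzMap ℝ ℂ) (ξc : ℝ) (hξc : 0 < ξc)
    (ψ : ℝ → ℝ) (hψ : ContDiff ℝ (⊤ : ℕ∞) ψ)
    (hψ0 : ∀ t : ℝ, t ≤ -1 → ψ t = 0) (hψ1 : ∀ t : ℝ, 1 ≤ t → ψ t = 1)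
    (ν ε : ℝ) (hν : 0 < ν) (hε : 0 < ε) (hεν : 2 * ε < ξc / Real.sqrt (1 + ν ^ 2))
    (χ : ℝ → ℝ) (hχ : ContDiff ℝ (⊤ : ℕ∞) χ)
    (hχ1 : ∀ t : ℝ, t ≤ ε → χ t = 1) (hχ0 : ∀ t : ℝ, 2 * ε ≤ t → χ t = 0) :
    (∀ σ : ℝ, σ < 0 → ∀ x : ℝ × ℝ, x ≠ 0 →
      Integrable (fun ξ : ℝ × ℝ =>
        (χ ((x.1 * ξ.1 + x.2 * ξ.2) / Real.sqrt (x.1 ^ 2 + x.2 ^ 2)) : ℂ) *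
          modeRegFT ξc ψ (⇑v) σ ξ * Complex.exp (Complex.I * (x.1 * ξ.1 + x.2 * ξ.2)))) ∧
    ∃ A : ℝ × ℝ → ℂ,
      (∀ x : ℝ × ℝ, 0 < x.1 → |x.2| ≤ ν * x.1 →
        Tendsto (fun σ : ℝ => isozakiTest χ ξc ψ (⇑v) σ x) (𝓝[<] 0) (𝓝 (A x))) ∧
      (∀ N : ℕ, ∃ C : ℝ, ∀ x : ℝ × ℝ, 0 < x.1 → |x.2| ≤ ν * x.1 →
        1 ≤ Real.sqrt (x.1 ^ 2 + x.2 ^ 2) →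
        ‖A x‖ ≤ C / Real.sqrt (x.1 ^ 2 + x.2 ^ 2) ^ N) := by
  have hB := exists_bound_iteratedDeriv_of_eventually_const hχ hχ1 hχ0
  obtain ⟨Cχ, -, hCχ⟩ := hB 0
  simp only [iteratedDeriv_zero] at hCχ
  have hsq : 0 < Real.sqrt (1 + ν ^ 2) := Real.sqrt_pos.2 (by positivity)
  have hab : 2 * ε * Real.sqrt (1 + ν ^ 2) < ξc := (lt_div_iff₀ hsq).1 hεν
  have hlim : ∀ N : ℕ, ∃ C : ℝ, ∀ x : ℝ × ℝ, 0 < x.1 → |x.2| ≤ ν * x.1 → ∃ B : ℂ,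
      Tendsto (fun σ : ℝ => isozakiTest χ ξc ψ (⇑v) σ x) (𝓝[<] 0) (𝓝 B) ∧
        ‖B‖ ≤ C / Real.sqrt (x.1 ^ 2 + x.2 ^ 2) ^ N := by
    intro N
    obtain ⟨Cp, hCp0, hCp⟩ :=
      exists_bound_integral_cutoff_mul_inv_pow hχ hB hab (M := N + 2) (by omega)
    obtain ⟨Cg, hCg0, hCg⟩ :=
      exists_bound_iteratedDeriv_step_mul_schwartz v hψ hψ0 hψ1 ν (N + 2)
    set J : ℝ := ∫ t : ℝ, ((1 + |t|) ^ 2)⁻¹ with hJ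
    have hJ0 : 0 ≤ J := integral_nonneg fun t => by positivity
    refine ⟨2 * Real.pi * (Cg * Cp * J) * Real.sqrt (1 + ν ^ 2) ^ N, fun x hx hxν => ?_⟩
    have hr : 0 < Real.sqrt (x.1 ^ 2 + x.2 ^ 2) := Real.sqrt_pos.2 (by positivity)
    have hrle := sqrt_sq_add_sq_le_of_mem_cone hx hxν
    have hw0 : 0 ≤ x.1 / Real.sqrt (x.1 ^ 2 + x.2 ^ 2) := by positivity
    have hw1 : x.1 / Real.sqrt (x.1 ^ 2 + x.2 ^ 2) ≤ 1 := by
      rw [div_le_one hr]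
      exact Real.le_sqrt_of_sq_le (le_add_of_nonneg_right (sq_nonneg _))
    have hw : ∀ τ, 2 * ε * Real.sqrt (1 + ν ^ 2) ≤ τ →
        χ (x.1 / Real.sqrt (x.1 ^ 2 + x.2 ^ 2) * τ) = 0 := by
      intro τ hτ
      refine hχ0 _ ?_
      rw [div_mul_eq_mul_div, le_div_iff₀ hr]
      calc 2 * ε * Real.sqrt (x.1 ^ 2 + x.2 ^ 2)
          ≤ 2 * ε * (Real.sqrt (1 + ν ^ 2) * x.1) := by gcongr
        _ = x.1 * (2 * ε * Real.sqrt (1 + ν ^ 2)) := by ring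
        _ ≤ x.1 * τ := by gcongr
    obtain ⟨hp, hpk⟩ := hCp _ hw0 hw1 hw
    have hs : |x.2 / x.1| ≤ ν := by
      rw [abs_div, abs_of_pos hx, div_le_iff₀ hx]; exact hxν
    have hsm : ContDiff ℝ (⊤ : ℕ∞) fun t => (ψ t : ℂ) * v (x.2 / x.1 * t) :=
      (contDiff_ofReal_comp hψ).mul ((v.smooth ⊤).comp (by fun_prop))
    have hgc (j : ℕ) : Continuous (iteratedDeriv j fun t => (ψ t : ℂ) * v (x.2 / x.1 * t)) :=
      hsm.continuous_iteratedDeriv j (by exact_mod_cast le_top)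
    refine ⟨_, tendsto_isozakiTest v ξc hψ hψ0 hψ1 hχ.continuous hCχ (M := N + 2) (by omega) hx
      (hw _ hab.le) hp, ?_⟩
    have hbd := norm_integral_prod_le_of_decay (c := (Complex.I ^ (N + 2))⁻¹) (by simp)
      (h := fun t : ℝ => Complex.exp (Complex.I * ξc * t))
      (hCg _ hs) (norm_cexp_I_mul_real_mul_real ξc)
      (hgc (N + 2)).aestronglyMeasurable
      (Continuous.aestronglyMeasurable (by fun_prop)) hp hpk hCg0 hCp0 x.1
    have h2π : ‖(2 * Real.pi : ℂ)‖ = 2 * Real.pi := by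
      simp [abs_of_pos Real.pi_pos]
    rw [norm_mul, h2π]
    refine (mul_le_mul_of_nonneg_left hbd (by positivity)).trans ?_
    rw [le_div_iff₀ (by positivity), ← hJ]
    have h1 : Real.sqrt (x.1 ^ 2 + x.2 ^ 2) ^ N ≤ Real.sqrt (1 + ν ^ 2) ^ N * (1 + |x.1|) ^ N := by
      rw [← mul_pow]
      refine pow_le_pow_left₀ hr.le (hrle.trans ?_) N
      gcongr
      linarith [le_abs_self x.1]
    calc 2 * Real.pi * (Cg * Cp * J * ((1 + |x.1|) ^ N)⁻¹) * Real.sqrt (x.1 ^ 2 + x.2 ^ 2) ^ N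
        ≤ 2 * Real.pi * (Cg * Cp * J * ((1 + |x.1|) ^ N)⁻¹) *
          (Real.sqrt (1 + ν ^ 2) ^ N * (1 + |x.1|) ^ N) := by gcongr
      _ = _ := by
        have : (1 + |x.1|) ^ N ≠ 0 := by positivity
        field_simp
  refine ⟨fun σ hσ x _ => ?_,
    fun x => limUnder (𝓝[<] 0) (fun σ : ℝ => isozakiTest χ ξc ψ (⇑v) σ x), ?_, fun N => ?_⟩
  · have hFV := (integrable_stepFT ξc hψ hψ0 hψ1 hσ).mul_prod (integrable_lineFT v)
    have hχc := hχ.continuous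
    refine (hFV.bdd_mul (c := Cχ) (f := fun ξ : ℝ × ℝ =>
      (χ ((x.1 * ξ.1 + x.2 * ξ.2) / Real.sqrt (x.1 ^ 2 + x.2 ^ 2)) : ℂ) *
        Complex.exp (Complex.I * (x.1 * ξ.1 + x.2 * ξ.2)))
      (Continuous.aestronglyMeasurable (by fun_prop)) (ae_of_all _ fun ξ => ?_)).congr
      (ae_of_all _ fun ξ => ?_)
    · rw [norm_mul, Complex.norm_real, Complex.norm_exp]
      simpa using hCχ _
    · simp only [modeRegFT_eq_mul]
      ring
  · intro x hx hxν
    obtain ⟨C, hC⟩ := hlim 0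
    obtain ⟨B, hB, -⟩ := hC x hx hxν
    beta_reduce
    rwa [hB.limUnder_eq]
  · obtain ⟨C, hC⟩ := hlim N
    refine ⟨C, fun x hx hxν _ => ?_⟩
    obtain ⟨B, hB, hBC⟩ := hC x hx hxν
    beta_reduce
    rwa [hB.limUnder_eq]
end
end
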